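/- Let n ≥ 1, −1 < γ < 0, 1 < p < ∞, K ∈ ℝⁿ with |K| ≥ 1, and let w be a bounded viscosity solution of the deviation equation ∂_t w − |Dw+K|^γ[Δw + (p−2)⟨D²w (Dw+K), Dw+K⟩/|Dw+K|²] = f̃ in Q₁ with w(0,0) = 0, ‖w‖_{L^∞(Q₁)} ≤ 1 and ‖f̃‖_{L^∞(Q₁)} ≤ 1. Then there exists a constant C̄ = C̄(p,n,γ) > 0 such that for all (x,t),(y,t) ∈ Q_{7/8} one has |w(x,t) − w(y,t)| ≤ C̄ |K|^{1/(1+γ)} |x−y|. -/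

import Mathlib

open Set Real RealInnerProductSpace

noncomputable section

/-- `ℝⁿ` with the Euclidean structure. -/
abbrev En (n : ℕ) : Type := EuclideanSpace ℝ (Fin n)

/-- The parabolic cylinder `Q_r := B_r(0) × (-r², 0) ⊂ ℝⁿ × ℝ`. -/
def pCyl (n : ℕ) (r : ℝ) : Set (En n × ℝ) :=
  {z | ‖z.1‖ < r ∧ z.2 ∈ Set.Ioo (-r ^ 2) (0 : ℝ)}

/-- The intrinsic cylinder `Q_r^a := B_r(0) × (-r² a^{-γ}, 0)`. -/
def iCyl (n : ℕ) (γ r a : ℝ) : Set (En n × ℝ) :=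
  {z | ‖z.1‖ < r ∧ z.2 ∈ Set.Ioo (-(r ^ 2 * a ^ (-γ))) (0 : ℝ)}

/-- Spatial gradient of a function of space and time. -/
def sGrad {n : ℕ} (φ : En n × ℝ → ℝ) (x : En n) (t : ℝ) : En n :=
  gradient (fun y => φ (y, t)) x

/-- Spatial Hessian of a function of space and time. -/
def sHess {n : ℕ} (φ : En n × ℝ → ℝ) (x : En n) (t : ℝ) : En n →L[ℝ] En n :=
  fderiv ℝ (fun y => sGrad φ y t) x

/-- The value `|q|^γ (tr H + (p-2) ⟨H q, q⟩ / |q|²)`, i.e. `|q|^γ` times the normalized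
`p`-Laplacian computed from a gradient `q ≠ 0` and a Hessian `H`. -/
def opVal {n : ℕ} (γ p : ℝ) (q : En n) (H : En n →L[ℝ] En n) : ℝ :=
  ‖q‖ ^ γ * (LinearMap.trace ℝ (En n) H.toLinearMap + (p - 2) * ⟪H q, q⟫ / ‖q‖ ^ 2)

/-- Viscosity supersolution of `∂ₜ u - |Du|^γ Δ_p^N u = f` on `Ω`. -/
def IsSupersol {n : ℕ} (γ p : ℝ) (f u : En n × ℝ → ℝ) (Ω : Set (En n × ℝ)) : Prop :=
  (∀ z ∈ Ω, ∀ φ : En n × ℝ → ℝ, ContDiff ℝ 2 φ →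
      sGrad φ z.1 z.2 ≠ 0 → φ z = u z → (∀ w ∈ Ω, φ w ≤ u w) →
      f z ≤ deriv (fun s => φ (z.1, s)) z.2
            - opVal γ p (sGrad φ z.1 z.2) (sHess φ z.1 z.2)) ∧
  (∀ z ∈ Ω, ∀ δ : ℝ, 0 < δ → ∀ φ : ℝ → ℝ,
      ContDiffOn ℝ 1 φ (Set.Ioo (z.2 - δ) (z.2 + δ)) → φ z.2 = 0 →
      (∀ t ∈ Set.Ioo (z.2 - δ) (z.2 + δ), u (z.1, z.2) ≤ u (z.1, t) - φ t) →
      (∃ ε > (0:ℝ), ∃ c : ℝ, ∀ x : En n, ‖x - z.1‖ < ε →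
          sInf ((fun t => u (x, t) - φ t) '' Set.Ioo (z.2 - δ) (z.2 + δ)) = c) →
      f z ≤ deriv φ z.2)

/-- Viscosity subsolution of `∂ₜ u - |Du|^γ Δ_p^N u = f` on `Ω`. -/
def IsSubsol {n : ℕ} (γ p : ℝ) (f u : En n × ℝ → ℝ) (Ω : Set (En n × ℝ)) : Prop :=
  (∀ z ∈ Ω, ∀ φ : En n × ℝ → ℝ, ContDiff ℝ 2 φ →
      sGrad φ z.1 z.2 ≠ 0 → φ z = u z → (∀ w ∈ Ω, u w ≤ φ w) →
      deriv (fun s => φ (z.1, s)) z.2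
            - opVal γ p (sGrad φ z.1 z.2) (sHess φ z.1 z.2) ≤ f z) ∧
  (∀ z ∈ Ω, ∀ δ : ℝ, 0 < δ → ∀ φ : ℝ → ℝ,
      ContDiffOn ℝ 1 φ (Set.Ioo (z.2 - δ) (z.2 + δ)) → φ z.2 = 0 →
      (∀ t ∈ Set.Ioo (z.2 - δ) (z.2 + δ), u (z.1, t) - φ t ≤ u (z.1, z.2)) →
      (∃ ε > (0:ℝ), ∃ c : ℝ, ∀ x : En n, ‖x - z.1‖ < ε →
          sSup ((fun t => u (x, t) - φ t) '' Set.Ioo (z.2 - δ) (z.2 + δ)) = c) →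
      deriv φ z.2 ≤ f z)

/-- Viscosity solution of `∂ₜ u - |Du|^γ Δ_p^N u = f` on `Ω`: a continuous function which is
both a viscosity supersolution and a viscosity subsolution. -/
def IsViscSol {n : ℕ} (γ p : ℝ) (f u : En n × ℝ → ℝ) (Ω : Set (En n × ℝ)) : Prop :=
  ContinuousOn u Ω ∧ IsSupersol γ p f u Ω ∧ IsSubsol γ p f u Ω

/-- Viscosity solution of the deviation equation
`∂ₜ w - |Dw+K|^γ [Δw + (p-2)⟨D²w (Dw+K), Dw+K⟩/|Dw+K|²] = f` on `Ω`; equivalently,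
`u(x,t) := w(x,t) + K·x` is a viscosity solution of `∂ₜ u - |Du|^γ Δ_p^N u = f`. -/
def IsDevSol {n : ℕ} (γ p : ℝ) (K : En n) (f w : En n × ℝ → ℝ) (Ω : Set (En n × ℝ)) : Prop :=
  IsViscSol γ p f (fun z => w z + ⟪K, z.1⟫) Ω

open Filter Topology Metric Pointwise in
/-- Points of density: every nearby point is well approximated by the set. -/
theorem aux_density {V : Type*} [NormedAddCommGroup V] [InnerProductSpace ℝ V]
    [FiniteDimensional ℝ V] [MeasurableSpace V] [BorelSpace V]
    (μ : MeasureTheory.Measure V) [μ.IsAddHaarMeasure] (s : Set V) (z : V) (hz : z ∈ s)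
    (h : Tendsto (fun r => μ (s ∩ closedBall z r) / μ (closedBall z r)) (𝓝[>] 0) (𝓝 1))
    (c : ℝ) (hc : 0 < c) :
    ∃ r0 > (0:ℝ), ∀ k : V, ‖k‖ < r0 → ∃ g ∈ s, ‖g - (z + k)‖ ≤ c * ‖k‖ := by
  have hcomp : IsCompact (sphere (0:V) 1) := isCompact_sphere 0 1
  obtain ⟨T, hT, hcov⟩ := hcomp.elim_nhds_subcover (fun θ => ball θ (c/2))
    (fun θ _ => ball_mem_nhds θ (by positivity))
  have hev : ∀ᶠ r in 𝓝[>] (0:ℝ), ∀ θ ∈ T, (s ∩ ({z} + r • ball θ (c/2))).Nonempty := by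
    rw [Filter.eventually_all_finset]
    intro θ _
    exact MeasureTheory.Measure.eventually_nonempty_inter_smul_of_density_one μ s z h _
      measurableSet_ball (measure_ball_pos μ θ (by positivity)).ne'
  rw [eventually_nhdsWithin_iff, Metric.eventually_nhds_iff] at hev
  obtain ⟨r0, hr0, hev⟩ := hev
  refine ⟨r0, hr0, fun k hk => ?_⟩
  by_cases hk0 : k = 0
  · exact ⟨z, hz, by simp [hk0]⟩
  have hkpos : 0 < ‖k‖ := norm_pos_iff.mpr hk0
  have hmem : (‖k‖⁻¹ • k) ∈ sphere (0:V) 1 := by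
    simp [norm_smul, hkpos.ne']
  obtain ⟨θ, hθT, hθ⟩ := mem_iUnion₂.mp (hcov hmem)
  obtain ⟨g, hgs, hg⟩ := hev (y := ‖k‖) (by simpa using hk) hkpos θ hθT
  rw [Set.mem_add] at hg
  obtain ⟨a, ha, b, hb, rfl⟩ := hg
  rw [Set.mem_singleton_iff] at ha
  subst ha
  obtain ⟨v, hv, rfl⟩ := Set.mem_smul_set.mp hb
  refine ⟨_, hgs, ?_⟩
  have e1 : a + ‖k‖ • v - (a + k) = ‖k‖ • (v - ‖k‖⁻¹ • k) := by
    rw [smul_sub, smul_smul, mul_inv_cancel₀ hkpos.ne', one_smul]; abel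
  rw [e1, norm_smul, norm_norm, mul_comm]
  have h1 : ‖v - ‖k‖⁻¹ • k‖ ≤ c := by
    rw [mem_ball, dist_eq_norm] at hv hθ
    calc ‖v - ‖k‖⁻¹ • k‖ = ‖(v - θ) - (‖k‖⁻¹ • k - θ)‖ := by congr 1; abel
      _ ≤ ‖v - θ‖ + ‖‖k‖⁻¹ • k - θ‖ := norm_sub_le _ _
      _ ≤ c := by linarith
  exact mul_le_mul_of_nonneg_right h1 hkpos.le

/-- One chain of increments. -/
theorem aux_chain (R : ℕ → ℝ) (b : ℝ) (N : ℕ) (h0 : R 0 = 0)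
    (h : ∀ i < N, |R (i+1) - R i| ≤ b) : |R N| ≤ N * b := by
  induction N with
  | zero => simp [h0]
  | succ k ih =>
    have h1 := ih (fun i hi => h i (by omega))
    have h2 := h k (by omega)
    have : |R (k+1)| ≤ |R (k+1) - R k| + |R k| := by
      have := abs_add_le (R (k+1) - R k) (R k)
      simpa using this
    push_cast; linarith

open Filter Topology Metric in
/-- Second order expansion at a density point of the contact set. -/
theorem aux_expansion {V : Type*} [NormedAddCommGroup V] [InnerProductSpace ℝ V]
    (U : V → ℝ) (C ρ : ℝ) (hC : 0 ≤ C) (Γ : Set V) (F : V → V) (z : V) (hz : z ∈ Γ)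
    (hzρ : ‖z‖ < ρ)
    (hup : ∀ g ∈ Γ, ∀ y, ‖y‖ ≤ ρ → U y ≤ U g + ⟪F g, y - g⟫)
    (hlow : ∀ g ∈ Γ, ∀ y, U g + ⟪F g, y - g⟫ - C / 2 * ‖y - g‖ ^ 2 ≤ U y)
    (hdens : ∀ c > (0:ℝ), ∃ r0 > (0:ℝ), ∀ k : V, ‖k‖ < r0 → ∃ g ∈ Γ, ‖g - (z + k)‖ ≤ c * ‖k‖)
    (D : V →L[ℝ] V) (hD : HasFDerivWithinAt F D Γ z) (η : ℝ) (hη : 0 < η) :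
    ∀ᶠ h in 𝓝 (0:V), |U (z + h) - U z - ⟪F z, h⟫ - 1 / 2 * ⟪D h, h⟫| ≤ η * ‖h‖ ^ 2 := by
  set C2 : ℝ := 4 * C + 2 + 2 * ‖D‖ with hC2
  have hC2pos : 0 < C2 := by positivity
  obtain ⟨N, hN⟩ := exists_nat_gt (C2 / η + 1)
  have hNpos : (0:ℝ) < N := by
    have : 0 < C2 / η := by positivity
    linarith
  have hN1 : (1:ℝ) ≤ N := by
    have : 0 < C2 / η := by positivity
    linarith
  set c : ℝ := 1 / N with hc
  have hcpos : 0 < c := by positivity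
  have hc1 : c ≤ 1 := by rw [hc, div_le_one hNpos]; exact hN1
  have hNc : N * c = 1 := by rw [hc]; field_simp
  obtain ⟨r0, hr0, hd⟩ := hdens c hcpos
  have hD' := hD.isLittleO.def hcpos
  rw [eventually_nhdsWithin_iff, Metric.eventually_nhds_iff] at hD'
  obtain ⟨r1, hr1, hD'⟩ := hD'
  rw [Metric.eventually_nhds_iff]
  refine ⟨min (min r0 (r1/2)) (ρ - ‖z‖), by
    have : 0 < ρ - ‖z‖ := by linarith
    positivity, fun h hh => ?_⟩
  rw [dist_zero_right] at hh
  have hh0 : ‖h‖ < r0 := lt_of_lt_of_le hh ((min_le_left _ _).trans (min_le_left _ _))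
  have hh1 : ‖h‖ < r1 / 2 := lt_of_lt_of_le hh ((min_le_left _ _).trans (min_le_right _ _))
  have hh2 : ‖h‖ < ρ - ‖z‖ := lt_of_lt_of_le hh (min_le_right _ _)
  -- step estimate
  have hball : ∀ s : ℝ, 0 ≤ s → s ≤ 1 → ‖z + s • h‖ ≤ ρ := by
    intro s hs0 hs1
    have : ‖s • h‖ ≤ ‖h‖ := by
      rw [norm_smul, Real.norm_of_nonneg hs0]
      exact mul_le_of_le_one_left (norm_nonneg _) hs1
    linarith [norm_add_le z (s • h)]
  set Rf : ℝ → ℝ := fun s => U (z + s • h) - U z - s * ⟪F z, h⟫ - 1 / 2 * s ^ 2 * ⟪D h, h⟫ with hRf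
  have hstep : ∀ s : ℝ, 0 ≤ s → s + c ≤ 1 → |Rf (s + c) - Rf s| ≤ c ^ 2 * C2 * ‖h‖ ^ 2 := by
    intro s hs0 hs1
    have hs1' : s ≤ 1 := by linarith
    have hsh : ‖s • h‖ ≤ ‖h‖ := by
      rw [norm_smul, Real.norm_of_nonneg hs0]
      exact mul_le_of_le_one_left (norm_nonneg _) hs1'
    obtain ⟨g, hg, hgk⟩ := hd (s • h) (lt_of_le_of_lt hsh hh0)
    have hgk1 : ‖g - (z + s • h)‖ ≤ c * ‖h‖ := hgk.trans (by gcongr)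
    have hgz : ‖g - z‖ ≤ 2 * ‖h‖ := by
      calc ‖g - z‖ = ‖(g - (z + s • h)) + s • h‖ := by congr 1; abel
        _ ≤ ‖g - (z + s • h)‖ + ‖s • h‖ := norm_add_le _ _
        _ ≤ c * ‖h‖ + ‖h‖ := by gcongr
        _ ≤ 2 * ‖h‖ := by nlinarith [norm_nonneg h]
    have hFg := hD' (y := g) (by rw [dist_eq_norm]; linarith) hg
    set e1 := F g - F z - D (g - z) with he1
    have he1n : ‖e1‖ ≤ c * (2 * ‖h‖) := hFg.trans (by gcongr)
    set y1 := z + s • h with hy1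
    set y2 := z + (s + c) • h with hy2
    have hd1 : ‖y1 - g‖ ≤ c * ‖h‖ := by rw [norm_sub_rev]; exact hgk1
    have hd2 : ‖y2 - g‖ ≤ 2 * (c * ‖h‖) := by
      calc ‖y2 - g‖ = ‖(y1 - g) + c • h‖ := by rw [hy1, hy2, add_smul]; congr 1; abel
        _ ≤ ‖y1 - g‖ + ‖c • h‖ := norm_add_le _ _
        _ ≤ c * ‖h‖ + c * ‖h‖ := by
            gcongr; rw [norm_smul, Real.norm_of_nonneg hcpos.le]
        _ = _ := by ring
    have hsq1 : ‖y1 - g‖ ^ 2 ≤ c ^ 2 * ‖h‖ ^ 2 := by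
      calc ‖y1 - g‖ ^ 2 ≤ (c * ‖h‖) ^ 2 := by gcongr
        _ = _ := by ring
    have hsq2 : ‖y2 - g‖ ^ 2 ≤ 4 * (c ^ 2 * ‖h‖ ^ 2) := by
      calc ‖y2 - g‖ ^ 2 ≤ (2 * (c * ‖h‖)) ^ 2 := by gcongr
        _ = _ := by ring
    have u1 := hup g hg y1 (hball s hs0 hs1')
    have u2 := hup g hg y2 (hball (s+c) (by linarith) hs1)
    have l1 := hlow g hg y1
    have l2 := hlow g hg y2
    have hin : ⟪F g, y2 - g⟫ - ⟪F g, y1 - g⟫ = c * ⟪F z, h⟫ + s * c * ⟪D h, h⟫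
        + c * ⟪D (g - y1), h⟫ + c * ⟪e1, h⟫ := by
      have a1 : y2 - g - (y1 - g) = c • h := by rw [hy1, hy2, add_smul]; abel
      have a2 : F g = F z + s • D h + D (g - y1) + e1 := by
        have : g - y1 = g - z - s • h := by rw [hy1]; abel
        rw [he1, this, map_sub, map_smul]; abel
      rw [← inner_sub_right, a1, inner_smul_right, a2]
      simp only [inner_add_left, inner_smul_left, RCLike.conj_to_real]
      ring
    have b1 : |⟪D (g - y1), h⟫| ≤ ‖D‖ * c * ‖h‖ ^ 2 := by
      calc |⟪D (g - y1), h⟫| ≤ ‖D (g - y1)‖ * ‖h‖ := abs_real_inner_le_norm _ _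
        _ ≤ ‖D‖ * (c * ‖h‖) * ‖h‖ := by
            gcongr
            exact (D.le_opNorm _).trans (by gcongr)
        _ = _ := by ring
    have b2 : |⟪e1, h⟫| ≤ 2 * c * ‖h‖ ^ 2 := by
      calc |⟪e1, h⟫| ≤ ‖e1‖ * ‖h‖ := abs_real_inner_le_norm _ _
        _ ≤ c * (2 * ‖h‖) * ‖h‖ := by gcongr
        _ = _ := by ring
    have b3 : |⟪D h, h⟫| ≤ ‖D‖ * ‖h‖ ^ 2 := by
      calc |⟪D h, h⟫| ≤ ‖D h‖ * ‖h‖ := abs_real_inner_le_norm _ _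
        _ ≤ ‖D‖ * ‖h‖ * ‖h‖ := by
            gcongr
            exact D.le_opNorm _
        _ = _ := by ring
    have hdiff : Rf (s + c) - Rf s = (U y2 - U y1 - (⟪F g, y2 - g⟫ - ⟪F g, y1 - g⟫))
        + c * ⟪D (g - y1), h⟫ + c * ⟪e1, h⟫ - 1 / 2 * c ^ 2 * ⟪D h, h⟫ := by
      rw [hin]; simp only [hRf]; ring
    rw [hdiff]
    have b1' : |c * ⟪D (g - y1), h⟫| ≤ c * (‖D‖ * c * ‖h‖ ^ 2) := by
      rw [abs_mul, abs_of_pos hcpos]; gcongr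
    have b2' : |c * ⟪e1, h⟫| ≤ c * (2 * c * ‖h‖ ^ 2) := by
      rw [abs_mul, abs_of_pos hcpos]; gcongr
    have b3' : |1 / 2 * c ^ 2 * ⟪D h, h⟫| ≤ 1 / 2 * c ^ 2 * (‖D‖ * ‖h‖ ^ 2) := by
      rw [abs_mul, abs_of_nonneg (by positivity : (0:ℝ) ≤ 1 / 2 * c ^ 2)]; gcongr
    have q1 : C / 2 * ‖y1 - g‖ ^ 2 ≤ C / 2 * (c ^ 2 * ‖h‖ ^ 2) := by gcongr
    have q2 : C / 2 * ‖y2 - g‖ ^ 2 ≤ C / 2 * (4 * (c ^ 2 * ‖h‖ ^ 2)) := by gcongr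
    have hT : 0 ≤ c ^ 2 * ‖h‖ ^ 2 := by positivity
    have hDT : 0 ≤ ‖D‖ * (c ^ 2 * ‖h‖ ^ 2) := by positivity
    have hCT : 0 ≤ C * (c ^ 2 * ‖h‖ ^ 2) := by positivity
    have hexp : c ^ 2 * C2 * ‖h‖ ^ 2 = 4 * (C * (c ^ 2 * ‖h‖ ^ 2)) + 2 * (c ^ 2 * ‖h‖ ^ 2)
      + 2 * (‖D‖ * (c ^ 2 * ‖h‖ ^ 2)) := by rw [hC2]; ring
    rw [hexp]
    rw [abs_le] at b1' b2' b3' ⊢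
    constructor <;> linarith [b1'.1, b1'.2, b2'.1, b2'.2, b3'.1, b3'.2]
  have hfin := aux_chain (fun i => Rf (i * c)) (c ^ 2 * C2 * ‖h‖ ^ 2) N (by simp [hRf]) (by
    intro i hi
    have : (i:ℝ) + 1 ≤ N := by exact_mod_cast hi
    have h2 : (i:ℝ) * c + c ≤ 1 := by nlinarith
    have := hstep (i * c) (by positivity) h2
    have e : ((i+1 : ℕ) : ℝ) * c = i * c + c := by push_cast; ring
    rw [e]; exact this)
  simp only [hNc] at hfin
  have e1 : Rf 1 = U (z + h) - U z - ⟪F z, h⟫ - 1 / 2 * ⟪D h, h⟫ := by simp [hRf]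
  rw [e1] at hfin
  refine hfin.trans ?_
  have : (N:ℝ) * (c ^ 2 * C2 * ‖h‖ ^ 2) = (c * C2) * ‖h‖ ^ 2 := by
    calc (N:ℝ) * (c ^ 2 * C2 * ‖h‖ ^ 2) = (N * c) * (c * C2 * ‖h‖ ^ 2) := by ring
      _ = _ := by rw [hNc]; ring
  rw [this]
  gcongr
  rw [hc, one_div, inv_mul_le_iff₀ hNpos]
  have : C2 / η < N := by linarith
  rw [div_lt_iff₀ hη] at this
  exact this.le

open Filter Topology Metric in
/-- The Jensen lemma combined with the Alexandrov theorem on the contact set. -/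
theorem aux_jensen {V : Type*} [NormedAddCommGroup V] [InnerProductSpace ℝ V]
    [FiniteDimensional ℝ V] (U : V → ℝ) (C ρ κ : ℝ) (hC : 0 ≤ C) (hρ : 0 < ρ) (hκ : 0 < κ)
    (hconv : ConvexOn ℝ univ (fun z => U z + C / 2 * ‖z‖ ^ 2))
    (hmax : ∀ z, ‖z‖ ≤ ρ → U z ≤ U 0 - κ * ‖z‖ ^ 2) (ε : ℝ) (hε : 0 < ε) :
    ∃ (z p : V) (D : V →L[ℝ] V), ‖z‖ < ε ∧ ‖p‖ < ε ∧
      (∀ᶠ h in 𝓝 (0:V), U (z + h) ≤ U z + ⟪p, h⟫) ∧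
      ∀ η > (0:ℝ), ∀ᶠ h in 𝓝 (0:V),
        |U (z + h) - U z - ⟪p, h⟫ - 1 / 2 * ⟪D h, h⟫| ≤ η * ‖h‖ ^ 2 := by
  have hcont : Continuous U := by
    have h1 := hconv.continuousOn isOpen_univ
    rw [continuousOn_univ] at h1
    have h2 : Continuous (fun z => (U z + C / 2 * ‖z‖ ^ 2) - C / 2 * ‖z‖ ^ 2) := by fun_prop
    simpa using h2
  set ε' := min ε (ρ / 4) with hε'
  have hε'pos : 0 < ε' := by positivity
  set δ := min ε (κ * ε' / 2) with hδ
  have hδpos : 0 < δ := by positivity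
  set ctc : V → V → Prop := fun z p => ∀ y, ‖y‖ ≤ ρ → U y ≤ U z + ⟪p, y - z⟫ with hctc
  -- existence of contact points
  have hex : ∀ p, ‖p‖ < δ → ∃ z, ‖z‖ < ε' ∧ ctc z p := by
    intro p hp
    obtain ⟨z, hz, hzmax⟩ := (isCompact_closedBall (0:V) ρ).exists_isMaxOn
      ⟨0, by simp [hρ.le]⟩ (f := fun y => U y - ⟪p, y⟫) (by fun_prop)
    rw [mem_closedBall, dist_zero_right] at hz
    have h0 := hzmax (show (0:V) ∈ closedBall 0 ρ by simp [hρ.le])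
    simp only [mem_ofPred_eq, inner_zero_right, sub_zero] at h0
    have h1 := hmax z hz
    have h2 : -⟪p, z⟫ ≤ ‖p‖ * ‖z‖ := (neg_le_abs _).trans (abs_real_inner_le_norm _ _)
    refine ⟨z, ?_, ?_⟩
    · by_contra hcon
      push Not at hcon
      have hzpos : 0 < ‖z‖ := lt_of_lt_of_le hε'pos hcon
      have h3 : κ * ‖z‖ ^ 2 ≤ ‖p‖ * ‖z‖ := by linarith
      have h4 : κ * ‖z‖ ≤ ‖p‖ := by
        by_contra h5
        push Not at h5
        nlinarith
      have h6 : δ ≤ κ * ε' / 2 := min_le_right _ _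
      have h7 : κ * ε' ≤ κ * ‖z‖ := by gcongr
      nlinarith [mul_pos hκ hε'pos]
    · intro y hy
      have := hzmax (show y ∈ closedBall 0 ρ by simpa using hy)
      simp only [mem_ofPred_eq] at this
      rw [inner_sub_right]; linarith
  -- lower bound
  have hlow : ∀ z p, ‖z‖ < ε' → ctc z p → ∀ y, U z + ⟪p, y - z⟫ - C / 2 * ‖y - z‖ ^ 2 ≤ U y := by
    intro z p hz hzp y
    have hz4 : ‖z‖ < ρ / 4 := lt_of_lt_of_le hz (min_le_right _ _)
    set h := y - z with hh
    have hy : y = z + h := by rw [hh]; abel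
    -- for small s
    have key : ∀ s : ℝ, 0 < s → s * ‖h‖ ≤ ρ / 4 →
        U z + ⟪p, h⟫ - C / 2 * ‖h‖ ^ 2 - s * (C / 2 * ‖h‖ ^ 2) ≤ U y := by
      intro s hs hsh
      have hb : ‖z - s • h‖ ≤ ρ := by
        have := norm_sub_le z (s • h)
        rw [norm_smul, Real.norm_of_nonneg hs.le] at this
        linarith
      have h1 := hzp _ hb
      have e0 : z - s • h - z = -(s • h) := by abel
      rw [e0, inner_neg_right, inner_smul_right] at h1
      -- z is convex combination of y and z - s h with weights s/(1+s), 1/(1+s)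
      have hcv := hconv.2 (mem_univ y) (mem_univ (z - s • h))
        (show 0 ≤ s / (1 + s) by positivity) (show 0 ≤ 1 / (1 + s) by positivity)
        (by field_simp; ring)
      have ez : (s / (1 + s)) • y + (1 / (1 + s)) • (z - s • h) = z := by
        rw [hh]
        match_scalars <;> field_simp <;> ring
      simp only [ez, smul_eq_mul] at hcv
      have hm := mul_le_mul_of_nonneg_left hcv (show 0 ≤ 1 + s by positivity)
      have e2 : (1 + s) * (s / (1 + s) * (U y + C / 2 * ‖y‖ ^ 2)
          + 1 / (1 + s) * (U (z - s • h) + C / 2 * ‖z - s • h‖ ^ 2))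
          = s * (U y + C / 2 * ‖y‖ ^ 2) + (U (z - s • h) + C / 2 * ‖z - s • h‖ ^ 2) := by
        field_simp
      rw [e2] at hm
      have n1 : ‖y‖ ^ 2 = ‖z‖ ^ 2 + 2 * ⟪z, h⟫ + ‖h‖ ^ 2 := by
        rw [hy, norm_add_sq_real]
      have n2 : ‖z - s • h‖ ^ 2 = ‖z‖ ^ 2 - 2 * s * ⟪z, h⟫ + s ^ 2 * ‖h‖ ^ 2 := by
        rw [norm_sub_sq_real, inner_smul_right, norm_smul, Real.norm_of_nonneg hs.le]; ring
      rw [n1, n2] at hm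
      have : s * (U z + ⟪p, h⟫ - C / 2 * ‖h‖ ^ 2 - s * (C / 2 * ‖h‖ ^ 2)) ≤ s * U y := by
        nlinarith
      exact le_of_mul_le_mul_left this hs
    have hlim : Tendsto (fun s : ℝ => U z + ⟪p, h⟫ - C / 2 * ‖h‖ ^ 2 - s * (C / 2 * ‖h‖ ^ 2))
        (𝓝[>] 0) (𝓝 (U z + ⟪p, h⟫ - C / 2 * ‖h‖ ^ 2 - 0 * (C / 2 * ‖h‖ ^ 2))) := by
      apply Tendsto.mono_left _ nhdsWithin_le_nhds
      apply Continuous.tendsto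
      fun_prop
    have := le_of_tendsto hlim (b := U y) (by
      have ev : ∀ᶠ s : ℝ in 𝓝[>] 0, s * ‖h‖ < ρ / 4 := by
        have : Tendsto (fun s : ℝ => s * ‖h‖) (𝓝[>] 0) (𝓝 (0 * ‖h‖)) := by
          apply Tendsto.mono_left _ nhdsWithin_le_nhds
          apply Continuous.tendsto
          fun_prop
        rw [zero_mul] at this
        exact this.eventually_lt_const (by positivity)
      filter_upwards [ev, self_mem_nhdsWithin] with s hs hs0
      exact key s hs0 hs.le)
    simpa using this
  -- Lipschitz
  have hLip : ∀ z1 p1 z2 p2, ‖z1‖ < ε' → ‖z2‖ < ε' → ctc z1 p1 → ctc z2 p2 →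
      ‖p2 - p1‖ ≤ C * ‖z2 - z1‖ := by
    intro z1 p1 z2 p2 hz1 hz2 h1 h2
    have hz14 : ‖z1‖ < ρ / 4 := lt_of_lt_of_le hz1 (min_le_right _ _)
    have hz24 : ‖z2‖ < ρ / 4 := lt_of_lt_of_le hz2 (min_le_right _ _)
    by_cases hp : p2 = p1
    · rw [hp]; simp; positivity
    have hd : 0 < ‖p2 - p1‖ := norm_pos_iff.mpr (sub_ne_zero.mpr hp)
    have hdz : ‖z2 - z1‖ < ρ / 2 := by linarith [norm_sub_le z2 z1]
    have key : ∀ s : ℝ, 0 < s → s ≤ ρ / 2 →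
        ‖p2 - p1‖ * s ≤ C / 2 * (s ^ 2 + ‖z2 - z1‖ ^ 2) := by
      intro s hs hsρ
      set k := (s / ‖p2 - p1‖) • (p2 - p1) with hk
      have hkn : ‖k‖ = s := by
        rw [hk, norm_smul, Real.norm_of_nonneg (by positivity)]; field_simp
      have hb : ‖z2 + k‖ ≤ ρ := by linarith [norm_add_le z2 k]
      have a1 := h1 _ hb
      have a2 := hlow z2 p2 hz2 h2 (z2 + k)
      have a3 := hlow z1 p1 hz1 h1 z2
      have a4 := h2 z1 (by linarith)
      have a5 := h1 z2 (by linarith)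
      have a6 := hlow z2 p2 hz2 h2 z1
      have e1 : z2 + k - z2 = k := by abel
      have e2 : z2 + k - z1 = (z2 - z1) + k := by abel
      rw [e1, hkn] at a2
      rw [e2, inner_add_right] at a1
      have ek : ⟪p2, k⟫ - ⟪p1, k⟫ = ‖p2 - p1‖ * s := by
        rw [← inner_sub_left, hk, inner_smul_right, real_inner_self_eq_norm_sq]
        field_simp
      nlinarith
    by_cases hz : z2 = z1
    · exfalso
      subst hz
      simp only [sub_self, norm_zero] at key
      set s := min (ρ / 2) (‖p2 - p1‖ / (C + 1)) with hs
      have hspos : 0 < s := by positivity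
      have k1 := key s hspos (min_le_left _ _)
      have k2 : s ≤ ‖p2 - p1‖ / (C + 1) := min_le_right _ _
      rw [le_div_iff₀ (by positivity)] at k2
      nlinarith
    · have hzp : 0 < ‖z2 - z1‖ := norm_pos_iff.mpr (sub_ne_zero.mpr hz)
      have := key _ hzp hdz.le
      have h3 : ‖p2 - p1‖ * ‖z2 - z1‖ ≤ (C * ‖z2 - z1‖) * ‖z2 - z1‖ := by nlinarith
      exact le_of_mul_le_mul_right h3 hzp
  -- the contact set
  set Γ : Set V := {z | ‖z‖ < ε' ∧ ∃ p, ‖p‖ < δ ∧ ctc z p} with hΓ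
  have hchoice : ∀ z, ∃ p, z ∈ Γ → (‖p‖ < δ ∧ ctc z p) := by
    intro z
    by_cases hz : z ∈ Γ
    · obtain ⟨_, p, hp⟩ := hz
      exact ⟨p, fun _ => hp⟩
    · exact ⟨0, fun h => absurd h hz⟩
  choose F hF using hchoice
  have hFL : LipschitzOnWith (Real.toNNReal C) F Γ := by
    rw [lipschitzOnWith_iff_norm_sub_le]
    intro z1 hz1 z2 hz2
    rw [Real.coe_toNNReal _ hC]
    exact hLip z2 (F z2) z1 (F z1) hz2.1 hz1.1 (hF z2 hz2).2 (hF z1 hz1).2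
  have hsurj : ball (0:V) δ ⊆ F '' Γ := by
    intro p hp
    rw [mem_ball, dist_zero_right] at hp
    obtain ⟨z, hz, hzp⟩ := hex p hp
    have hzΓ : z ∈ Γ := ⟨hz, p, hp, hzp⟩
    refine ⟨z, hzΓ, ?_⟩
    have := hLip z p z (F z) hz hz hzp (hF z hzΓ).2
    simp only [sub_self, norm_zero, mul_zero] at this
    exact sub_eq_zero.mp (norm_le_zero_iff.mp this)
  let _ : MeasurableSpace V := borel V
  have _ : BorelSpace V := ⟨rfl⟩
  set μ : MeasureTheory.Measure V := MeasureTheory.Measure.hausdorffMeasure (Module.finrank ℝ V : ℝ)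
    with hμ
  have _ : μ.IsAddHaarMeasure := MeasureTheory.isAddHaarMeasure_hausdorffMeasure
  have hΓpos : μ Γ ≠ 0 := by
    intro h0
    have h1 := hFL.hausdorffMeasure_image_le (d := (Module.finrank ℝ V : ℝ)) (by positivity)
    rw [← hμ, h0, mul_zero] at h1
    have h2 : μ (ball (0:V) δ) ≤ 0 := (MeasureTheory.measure_mono hsurj).trans h1
    exact absurd h2 (not_le.mpr (measure_ball_pos μ 0 hδpos))
  have hdens := Besicovitch.ae_tendsto_measure_inter_div μ Γ
  have hdiff := hFL.ae_differentiableWithinAt_of_mem (μ := μ)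
  have hgood : ∃ z ∈ Γ, Tendsto (fun r => μ (Γ ∩ closedBall z r) / μ (closedBall z r)) (𝓝[>] 0) (𝓝 1)
      ∧ DifferentiableWithinAt ℝ F Γ z := by
    by_contra hcon
    push Not at hcon
    apply hΓpos
    set B1 := {x | ¬ Tendsto (fun r => μ (Γ ∩ closedBall x r) / μ (closedBall x r)) (𝓝[>] 0) (𝓝 1)}
    set B2 := {x | ¬ (x ∈ Γ → DifferentiableWithinAt ℝ F Γ x)}
    have hB1 : μ (B1 ∩ Γ) = 0 := by
      have := MeasureTheory.Measure.le_restrict_apply (μ := μ) Γ B1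
      have h0 : (μ.restrict Γ) B1 = 0 := hdens
      rw [h0] at this
      exact le_antisymm this (zero_le)
    have hB2 : μ B2 = 0 := hdiff
    have hsub : Γ ⊆ (B1 ∩ Γ) ∪ B2 := by
      intro z hz
      by_cases hzB : z ∈ B1
      · exact Or.inl ⟨hzB, hz⟩
      · right
        intro hc
        have h1 : Tendsto (fun r => μ (Γ ∩ closedBall z r) / μ (closedBall z r)) (𝓝[>] 0) (𝓝 1) := by
          by_contra h
          exact hzB h
        exact hcon z hz h1 (hc hz)
    exact MeasureTheory.measure_mono_null hsub (MeasureTheory.measure_union_null hB1 hB2)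
  obtain ⟨z, hzΓ, hzd, hzD⟩ := hgood
  have hzρ : ‖z‖ < ρ := by
    have : ‖z‖ < ρ / 4 := lt_of_lt_of_le hzΓ.1 (min_le_right _ _)
    linarith
  refine ⟨z, F z, fderivWithin ℝ F Γ z, lt_of_lt_of_le hzΓ.1 (min_le_left _ _),
    lt_of_lt_of_le (hF z hzΓ).1 (min_le_left _ _), ?_, ?_⟩
  · rw [Metric.eventually_nhds_iff]
    refine ⟨ρ - ‖z‖, by linarith, fun h hh => ?_⟩
    rw [dist_zero_right] at hh
    have := (hF z hzΓ).2 (z + h) (by linarith [norm_add_le z h])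
    simpa using this
  · intro η hη
    exact aux_expansion U C ρ hC Γ F z hzΓ hzρ (fun g hg => (hF g hg).2)
      (fun g hg => hlow g (F g) hg.1 (hF g hg).2)
      (fun c hc => aux_density μ Γ z hzΓ hzd c hc) _ hzD.hasFDerivWithinAt η hη

theorem aux_quad_convex {V : Type*} [NormedAddCommGroup V] [InnerProductSpace ℝ V]
    (T : V →L[ℝ] V) (h : ∀ z, 0 ≤ ⟪T z, z⟫) : ConvexOn ℝ univ (fun z => ⟪T z, z⟫) := by
  refine ⟨convex_univ, fun x _ y _ a b ha hb hab => ?_⟩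
  have h1 := mul_nonneg (mul_nonneg ha hb) (h (x - y))
  have hb' : b = 1 - a := by linarith
  subst hb'
  simp only [map_add, map_sub, map_smul, inner_add_left, inner_add_right, inner_sub_left,
    inner_sub_right, inner_smul_left, inner_smul_right, RCLike.conj_to_real, smul_eq_mul] at h1 ⊢
  nlinarith

open Filter Topology in
theorem aux_quad_nonpos {V : Type*} [NormedAddCommGroup V] [InnerProductSpace ℝ V]
    (Q : V → ℝ) (hQ : ∀ (s : ℝ) h, Q (s • h) = s ^ 2 * Q h)
    (hev : ∀ η > (0:ℝ), ∀ᶠ h in 𝓝 (0:V), Q h ≤ η * ‖h‖ ^ 2) (h : V) : Q h ≤ 0 := by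
  have hη : ∀ η > (0:ℝ), Q h ≤ η * ‖h‖ ^ 2 := by
    intro η hη
    have ht : Tendsto (fun s : ℝ => s • h) (𝓝[>] 0) (𝓝 0) := by
      have : Tendsto (fun s : ℝ => s • h) (𝓝 0) (𝓝 ((0:ℝ) • h)) :=
        (by fun_prop : Continuous (fun s : ℝ => s • h)).tendsto 0
      rw [zero_smul] at this
      exact this.mono_left nhdsWithin_le_nhds
    obtain ⟨s, hs, hs0⟩ := ((ht.eventually (hev η hη)).and self_mem_nhdsWithin).exists
    have hs0' : (0:ℝ) < s := hs0
    rw [hQ, norm_smul, Real.norm_of_nonneg hs0'.le] at hs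
    have : s ^ 2 * Q h ≤ s ^ 2 * (η * ‖h‖ ^ 2) := by linarith
    exact le_of_mul_le_mul_left this (by positivity)
  by_contra hc
  push Not at hc
  have := hη (Q h / (2 * (‖h‖ ^ 2 + 1))) (by positivity)
  have h3 : Q h / (2 * (‖h‖ ^ 2 + 1)) * ‖h‖ ^ 2 ≤ Q h / 2 := by
    rw [div_mul_eq_mul_div, div_le_div_iff₀ (by positivity) (by norm_num)]
    nlinarith [sq_nonneg ‖h‖]
  linarith

open Filter Topology in
theorem aux_jensen2 {V : Type*} [NormedAddCommGroup V] [InnerProductSpace ℝ V]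
    [FiniteDimensional ℝ V] (U : V → ℝ) (C : ℝ) (hC : 0 ≤ C)
    (hconv : ConvexOn ℝ univ (fun z => U z + C / 2 * ‖z‖ ^ 2)) (zh p0 : V) (A : V →L[ℝ] V)
    (hA : ∀ x y, ⟪A x, y⟫ = ⟪x, A y⟫)
    (hmax : ∀ η > (0:ℝ), ∀ᶠ h in 𝓝 (0:V),
      U (zh + h) ≤ U zh + ⟪p0, h⟫ + 1 / 2 * ⟪A h, h⟫ + η * ‖h‖ ^ 2) (ε : ℝ) (hε : 0 < ε) :
    ∃ (z p : V) (D : V →L[ℝ] V), ‖z - zh‖ < ε ∧ ‖p - p0‖ < ε ∧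
      (∀ h, ⟪D h, h⟫ ≤ ⟪A h, h⟫ + ε * ‖h‖ ^ 2) ∧
      ∀ η > (0:ℝ), ∀ᶠ h in 𝓝 (0:V),
        |U (z + h) - U z - ⟪p, h⟫ - 1 / 2 * ⟪D h, h⟫| ≤ η * ‖h‖ ^ 2 := by
  set κ := ε / 8 with hκ
  have hκpos : 0 < κ := by positivity
  obtain ⟨ρ, hρ, hρmax⟩ := Metric.eventually_nhds_iff.mp (hmax κ hκpos)
  set U' : V → ℝ := fun z => U (zh + z) - ⟪p0, z⟫ - 1 / 2 * ⟪A z, z⟫ - 2 * κ * ‖z‖ ^ 2 with hU'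
  set C' := C + ‖A‖ + 4 * κ with hC'
  have hC'0 : 0 ≤ C' := by positivity
  have hconv' : ConvexOn ℝ univ (fun z => U' z + C' / 2 * ‖z‖ ^ 2) := by
    have c1 : ConvexOn ℝ univ (fun z => U (zh + z) + C / 2 * ‖zh + z‖ ^ 2) := by
      have := hconv.translate_right zh
      simpa [Function.comp_def] using this
    have c2 := aux_quad_convex (V := V) ((1/2 : ℝ) • (‖A‖ • ContinuousLinearMap.id ℝ V - A)) (by
      intro z
      have : ⟪A z, z⟫ ≤ ‖A‖ * ‖z‖ ^ 2 := by
        calc ⟪A z, z⟫ ≤ ‖A z‖ * ‖z‖ := real_inner_le_norm _ _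
          _ ≤ ‖A‖ * ‖z‖ * ‖z‖ := by gcongr; exact A.le_opNorm _
          _ = _ := by ring
      simp [inner_smul_left, inner_sub_left]
      exact this)
    have c3 : ConvexOn ℝ univ (fun z : V => -(⟪C • zh + p0, z⟫) - C / 2 * ‖zh‖ ^ 2) := by
      refine ⟨convex_univ, fun x _ y _ a b ha hb hab => le_of_eq ?_⟩
      have hb' : b = 1 - a := by linarith
      subst hb'
      simp only [inner_add_right, inner_smul_right, smul_eq_mul]
      ring
    have c4 := (c1.add c2).add c3
    refine c4.congr (fun z _ => ?_)
    simp only [Pi.add_apply, hU', hC']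
    rw [norm_add_sq_real]
    simp [inner_smul_left, inner_sub_left, inner_add_left]
    ring
  have hmax' : ∀ z, ‖z‖ ≤ ρ / 2 → U' z ≤ U' 0 - κ * ‖z‖ ^ 2 := by
    intro z hz
    have := hρmax (y := z) (by rw [dist_zero_right]; linarith)
    simp only [hU']
    simp only [add_zero, inner_zero_right, map_zero, norm_zero]
    linarith
  set ε2 := ε / (2 + ‖A‖ + 4 * κ) with hε2
  have hε2pos : 0 < ε2 := by positivity
  have hε2le : ε2 * (2 + ‖A‖ + 4 * κ) = ε := by rw [hε2]; field_simp
  obtain ⟨z, p, D, hz, hp, hup, hexp⟩ := aux_jensen U' C' (ρ/2) κ hC'0 (by positivity) hκpos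
    hconv' hmax' ε2 hε2pos
  have hDneg : ∀ h, ⟪D h, h⟫ ≤ 0 := by
    apply aux_quad_nonpos
    · intro s h
      simp only [map_smul, inner_smul_left, inner_smul_right, RCLike.conj_to_real]; ring
    · intro η hη
      filter_upwards [hup, hexp (η/2) (by positivity)] with h h1 h2
      rw [abs_le] at h2
      linarith [h2.1]
  refine ⟨zh + z, p + p0 + A z + (4 * κ) • z, D + A + (4 * κ) • ContinuousLinearMap.id ℝ V,
    ?_, ?_, ?_, ?_⟩
  · have : zh + z - zh = z := by abel
    rw [this]
    nlinarith [norm_nonneg A]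
  · have e : p + p0 + A z + (4 * κ) • z - p0 = p + A z + (4 * κ) • z := by abel
    rw [e]
    calc ‖p + A z + (4 * κ) • z‖ ≤ ‖p‖ + ‖A z‖ + ‖(4 * κ) • z‖ := norm_add₃_le
      _ ≤ ‖p‖ + ‖A‖ * ‖z‖ + 4 * κ * ‖z‖ := by
          rw [norm_smul, Real.norm_of_nonneg (by positivity)]
          gcongr
          exact A.le_opNorm _
      _ < ε := by nlinarith [norm_nonneg A, norm_nonneg z]
  · intro h
    simp only [ContinuousLinearMap.add_apply, ContinuousLinearMap.smul_apply,
      ContinuousLinearMap.id_apply, inner_add_left, inner_smul_left, RCLike.conj_to_real,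
      real_inner_self_eq_norm_sq]
    have := hDneg h
    have h2 : 4 * κ * ‖h‖ ^ 2 ≤ ε * ‖h‖ ^ 2 := by
      gcongr; rw [hκ]; linarith
    linarith
  · intro η hη
    filter_upwards [hexp η hη] with h hh
    convert hh using 2
    simp only [hU']
    have e1 : ⟪A (z + h), z + h⟫ = ⟪A z, z⟫ + 2 * ⟪A z, h⟫ + ⟪A h, h⟫ := by
      simp only [map_add, inner_add_left, inner_add_right]
      rw [hA h z, real_inner_comm (A z) h]
      ring
    rw [e1, norm_add_sq_real]
    simp only [ContinuousLinearMap.add_apply, ContinuousLinearMap.smul_apply,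
      ContinuousLinearMap.id_apply, inner_add_left, inner_add_right, inner_smul_left,
      RCLike.conj_to_real, real_inner_self_eq_norm_sq]
    rw [add_assoc zh z h]
    ring

open Filter Topology in
/-- Theorem on sums. -/
theorem aux_sums {V : Type*} [NormedAddCommGroup V] [InnerProductSpace ℝ V]
    [FiniteDimensional ℝ V] (u v : V → ℝ) (C : ℝ) (hC : 0 ≤ C)
    (hu : ConvexOn ℝ univ (fun z => u z + C / 2 * ‖z‖ ^ 2))
    (hv : ConvexOn ℝ univ (fun z => v z + C / 2 * ‖z‖ ^ 2)) (xh yh p1 p2 : V)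
    (A : WithLp 2 (V × V) →L[ℝ] WithLp 2 (V × V))
    (hA : ∀ x y, ⟪A x, y⟫ = ⟪x, A y⟫)
    (hmax : ∀ η > (0:ℝ), ∀ᶠ h in 𝓝 (0:WithLp 2 (V × V)),
      u (xh + h.fst) + v (yh + h.snd) ≤ u xh + v yh + ⟪p1, h.fst⟫ + ⟪p2, h.snd⟫
        + 1 / 2 * ⟪A h, h⟫ + η * ‖h‖ ^ 2) (ε : ℝ) (hε : 0 < ε) :
    ∃ (x y q1 q2 : V) (D1 D2 : V →L[ℝ] V), ‖x - xh‖ < ε ∧ ‖y - yh‖ < ε ∧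
      ‖q1 - p1‖ < ε ∧ ‖q2 - p2‖ < ε ∧
      (∀ h k, ⟪D1 h, k⟫ = ⟪h, D1 k⟫) ∧ (∀ h k, ⟪D2 h, k⟫ = ⟪h, D2 k⟫) ∧
      (∀ h k, ⟪D1 h, h⟫ + ⟪D2 k, k⟫ ≤ ⟪A (WithLp.toLp 2 (h, k)), WithLp.toLp 2 (h, k)⟫
        + ε * (‖h‖ ^ 2 + ‖k‖ ^ 2)) ∧
      (∀ η > (0:ℝ), ∀ᶠ h in 𝓝 (0:V),
        u (x + h) ≤ u x + ⟪q1, h⟫ + 1 / 2 * ⟪D1 h, h⟫ + η * ‖h‖ ^ 2) ∧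
      (∀ η > (0:ℝ), ∀ᶠ h in 𝓝 (0:V),
        v (y + h) ≤ v y + ⟪q2, h⟫ + 1 / 2 * ⟪D2 h, h⟫ + η * ‖h‖ ^ 2) := by
  set U : WithLp 2 (V × V) → ℝ := fun z => u z.fst + v z.snd with hU
  set ι1 : V →L[ℝ] WithLp 2 (V × V) :=
    ((WithLp.prodContinuousLinearEquiv 2 ℝ V V).symm : V × V →L[ℝ] WithLp 2 (V × V)).comp
      (ContinuousLinearMap.inl ℝ V V) with hι1
  set ι2 : V →L[ℝ] WithLp 2 (V × V) :=
    ((WithLp.prodContinuousLinearEquiv 2 ℝ V V).symm : V × V →L[ℝ] WithLp 2 (V × V)).comp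
      (ContinuousLinearMap.inr ℝ V V) with hι2
  have hι1a : ∀ h, ι1 h = WithLp.toLp 2 (h, 0) := fun h => rfl
  have hι2a : ∀ h, ι2 h = WithLp.toLp 2 (0, h) := fun h => rfl
  have hnsq : ∀ z : WithLp 2 (V × V), ‖z‖ ^ 2 = ‖z.fst‖ ^ 2 + ‖z.snd‖ ^ 2 :=
    fun z => WithLp.prod_norm_sq_eq_of_L2 z
  have hconvU : ConvexOn ℝ univ (fun z => U z + C / 2 * ‖z‖ ^ 2) := by
    refine ⟨convex_univ, fun x _ y _ a b ha hb hab => ?_⟩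
    have h1 := hu.2 (mem_univ x.fst) (mem_univ y.fst) ha hb hab
    have h2 := hv.2 (mem_univ x.snd) (mem_univ y.snd) ha hb hab
    simp only [smul_eq_mul] at h1 h2 ⊢
    simp only [hU, hnsq, WithLp.add_fst, WithLp.add_snd, WithLp.smul_fst, WithLp.smul_snd]
    linarith
  obtain ⟨z, p, D, hz, hp, hDA, hexp⟩ := aux_jensen2 U C hC hconvU (WithLp.toLp 2 (xh, yh))
    (WithLp.toLp 2 (p1, p2)) A hA (by
      intro η hη
      filter_upwards [hmax η hη] with h hh
      simp only [hU, WithLp.add_fst, WithLp.add_snd, WithLp.prod_inner_apply]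
      simp only [WithLp.prod_inner_apply] at hh
      have e : ∀ q : WithLp 2 (V × V), q.fst = q.ofLp.1 := fun _ => rfl
      have e' : ∀ q : WithLp 2 (V × V), q.snd = q.ofLp.2 := fun _ => rfl
      simp only [e, e'] at hh ⊢
      linarith) ε hε
  set S : WithLp 2 (V × V) →L[ℝ] WithLp 2 (V × V) :=
    (1/2 : ℝ) • (D + ContinuousLinearMap.adjoint D) with hS
  have hSsym : ∀ x y, ⟪S x, y⟫ = ⟪x, S y⟫ := by
    intro x y
    simp only [hS, ContinuousLinearMap.smul_apply, ContinuousLinearMap.add_apply, inner_smul_left,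
      inner_smul_right, inner_add_left, inner_add_right, RCLike.conj_to_real,
      ContinuousLinearMap.adjoint_inner_left, ContinuousLinearMap.adjoint_inner_right]
    ring
  have hSq : ∀ x, ⟪S x, x⟫ = ⟪D x, x⟫ := by
    intro x
    simp only [hS, ContinuousLinearMap.smul_apply, ContinuousLinearMap.add_apply, inner_smul_left,
      inner_add_left, RCLike.conj_to_real,
      ContinuousLinearMap.adjoint_inner_left]
    rw [real_inner_comm x (D x)]
    ring
  set D1 : V →L[ℝ] V := (ContinuousLinearMap.adjoint ι1).comp (S.comp ι1) with hD1
  set D2 : V →L[ℝ] V := (ContinuousLinearMap.adjoint ι2).comp (S.comp ι2) with hD2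
  have hD1i : ∀ h k, ⟪D1 h, k⟫ = ⟪S (ι1 h), ι1 k⟫ := fun h k => by
    simp [hD1, ContinuousLinearMap.adjoint_inner_left]
  have hD2i : ∀ h k, ⟪D2 h, k⟫ = ⟪S (ι2 h), ι2 k⟫ := fun h k => by
    simp [hD2, ContinuousLinearMap.adjoint_inner_left]
  have hn1 : ∀ h, ‖ι1 h‖ ^ 2 = ‖h‖ ^ 2 := fun h => by rw [hnsq, hι1a]; simp
  have hn2 : ∀ h, ‖ι2 h‖ ^ 2 = ‖h‖ ^ 2 := fun h => by rw [hnsq, hι2a]; simp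
  have ht1 : Tendsto ι1 (𝓝 0) (𝓝 0) := by simpa using ι1.continuous.tendsto 0
  have ht2 : Tendsto ι2 (𝓝 0) (𝓝 0) := by simpa using ι2.continuous.tendsto 0
  have hf1 : ∀ w : WithLp 2 (V × V), ‖w.fst‖ ^ 2 ≤ ‖w‖ ^ 2 := fun w => by
    rw [hnsq w]; nlinarith [sq_nonneg ‖w.snd‖]
  have hf2 : ∀ w : WithLp 2 (V × V), ‖w.snd‖ ^ 2 ≤ ‖w‖ ^ 2 := fun w => by
    rw [hnsq w]; nlinarith [sq_nonneg ‖w.fst‖]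
  have hsplit : ∀ w : WithLp 2 (V × V),
      ⟪D (ι1 w.fst), ι1 w.fst⟫ + ⟪D (ι2 w.snd), ι2 w.snd⟫ - ⟪D w, w⟫ ≤ 0 := by
    apply aux_quad_nonpos
    · intro s h
      simp only [WithLp.smul_fst, WithLp.smul_snd, map_smul, inner_smul_left, inner_smul_right,
        RCLike.conj_to_real]
      ring
    · intro η hη
      have t1 : Tendsto (fun w : WithLp 2 (V × V) => ι1 w.fst) (𝓝 0) (𝓝 0) := by
        have : Continuous (fun w : WithLp 2 (V × V) => ι1 w.fst) := by fun_prop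
        simpa using this.tendsto 0
      have t2 : Tendsto (fun w : WithLp 2 (V × V) => ι2 w.snd) (𝓝 0) (𝓝 0) := by
        have : Continuous (fun w : WithLp 2 (V × V) => ι2 w.snd) := by fun_prop
        simpa using this.tendsto 0
      have he := hexp (η / 6) (by positivity)
      filter_upwards [he, t1.eventually he, t2.eventually he] with w h0 h1 h2
      rw [hn1] at h1
      rw [hn2] at h2
      have k1 := hf1 w
      have k2 := hf2 w
      have ew : ⟪p, w⟫ = ⟪p, ι1 w.fst⟫ + ⟪p, ι2 w.snd⟫ := by
        rw [← inner_add_right]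
        congr 1
        rw [hι1a, hι2a, ← WithLp.toLp_add]
        simp
        rfl
      have eU : U (z + w) - U z = (U (z + ι1 w.fst) - U z) + (U (z + ι2 w.snd) - U z) := by
        simp only [hU, hι1a, hι2a, WithLp.add_fst, WithLp.add_snd]
        simp
        ring
      rw [abs_le] at h0 h1 h2
      have m1 : η / 6 * ‖w.fst‖ ^ 2 ≤ η / 6 * ‖w‖ ^ 2 := by gcongr
      have m2 : η / 6 * ‖w.snd‖ ^ 2 ≤ η / 6 * ‖w‖ ^ 2 := by gcongr
      linarith [h0.1, h0.2, h1.1, h1.2, h2.1, h2.2]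
  have hcomp : ∀ w : WithLp 2 (V × V), ‖w.fst‖ ≤ ‖w‖ ∧ ‖w.snd‖ ≤ ‖w‖ := fun w =>
    ⟨(sq_le_sq₀ (norm_nonneg _) (norm_nonneg _)).mp (hf1 w), (sq_le_sq₀ (norm_nonneg _) (norm_nonneg _)).mp (hf2 w)⟩
  refine ⟨z.fst, z.snd, p.fst, p.snd, D1, D2, ?_, ?_, ?_, ?_, ?_, ?_, ?_, ?_, ?_⟩
  · exact lt_of_le_of_lt (hcomp (z - WithLp.toLp 2 (xh, yh))).1 hz
  · exact lt_of_le_of_lt (hcomp (z - WithLp.toLp 2 (xh, yh))).2 hz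
  · exact lt_of_le_of_lt (hcomp (p - WithLp.toLp 2 (p1, p2))).1 hp
  · exact lt_of_le_of_lt (hcomp (p - WithLp.toLp 2 (p1, p2))).2 hp
  · intro h k
    rw [hD1i, hSsym, real_inner_comm, ← hD1i, real_inner_comm]
  · intro h k
    rw [hD2i, hSsym, real_inner_comm, ← hD2i, real_inner_comm]
  · intro h k
    have h1 := hsplit (WithLp.toLp 2 (h, k))
    have h2 := hDA (WithLp.toLp 2 (h, k))
    rw [hnsq] at h2
    rw [hD1i, hD2i, hSq, hSq]
    change ⟪D (ι1 h), ι1 h⟫ + ⟪D (ι2 k), ι2 k⟫ - _ ≤ 0 at h1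
    change _ ≤ _ + ε * (‖h‖ ^ 2 + ‖k‖ ^ 2) at h2
    linarith
  · intro η hη
    filter_upwards [ht1.eventually (hexp η hη)] with h hh
    rw [hn1] at hh
    rw [hD1i, hSq]
    have eU : U (z + ι1 h) - U z = u (z.fst + h) - u z.fst := by
      simp only [hU, hι1a, WithLp.add_fst, WithLp.add_snd]
      simp
    have ep : ⟪p, ι1 h⟫ = ⟪p.fst, h⟫ := by
      rw [hι1a, WithLp.prod_inner_apply]; simp
    rw [abs_le] at hh
    linarith [hh.2]
  · intro η hη
    filter_upwards [ht2.eventually (hexp η hη)] with h hh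
    rw [hn2] at hh
    rw [hD2i, hSq]
    have eU : U (z + ι2 h) - U z = v (z.snd + h) - v z.snd := by
      simp only [hU, hι2a, WithLp.add_fst, WithLp.add_snd]
      simp
    have ep : ⟪p, ι2 h⟫ = ⟪p.snd, h⟫ := by
      rw [hι2a, WithLp.prod_inner_apply]; simp
    rw [abs_le] at hh
    linarith [hh.2]

/-- Sup-convolution. -/
theorem aux_supconv {V : Type*} [NormedAddCommGroup V] [InnerProductSpace ℝ V]
    (w : V → ℝ) (S : Set V) (hS : IsCompact S) (hne : S.Nonempty) (hw : ContinuousOn w S)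
    (l : ℝ) (hl : 0 < l) :
    ∃ U : V → ℝ, ConvexOn ℝ univ (fun z => U z + (1 / l) / 2 * ‖z‖ ^ 2) ∧
      (∀ x, ∃ y ∈ S, U x = w y - ‖x - y‖ ^ 2 / (2 * l)) ∧
      (∀ x, ∀ y ∈ S, w y - ‖x - y‖ ^ 2 / (2 * l) ≤ U x) := by
  have hex : ∀ x, ∃ y ∈ S, ∀ y' ∈ S, w y' - ‖x - y'‖ ^ 2 / (2 * l) ≤ w y - ‖x - y‖ ^ 2 / (2 * l) := by
    intro x
    obtain ⟨y, hy, hm⟩ := hS.exists_isMaxOn hne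
      (f := fun y => w y - ‖x - y‖ ^ 2 / (2 * l)) (by fun_prop)
    exact ⟨y, hy, fun y' hy' => hm hy'⟩
  choose Y hYS hY using hex
  refine ⟨fun x => w (Y x) - ‖x - Y x‖ ^ 2 / (2 * l), ?_, fun x => ⟨Y x, hYS x, rfl⟩, hY⟩
  refine ⟨convex_univ, fun x _ y _ a b ha hb hab => ?_⟩
  set m := a • x + b • y with hm
  have h1 := hY x (Y m) (hYS m)
  have h2 := hY y (Y m) (hYS m)
  have h1' := mul_le_mul_of_nonneg_left h1 ha
  have h2' := mul_le_mul_of_nonneg_left h2 hb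
  simp only [smul_eq_mul]
  have key : ‖m - Y m‖ ^ 2 - ‖m‖ ^ 2
      = a * (‖x - Y m‖ ^ 2 - ‖x‖ ^ 2) + b * (‖y - Y m‖ ^ 2 - ‖y‖ ^ 2) := by
    simp only [norm_sub_sq_real]
    have : ⟪m, Y m⟫ = a * ⟪x, Y m⟫ + b * ⟪y, Y m⟫ := by
      rw [hm, inner_add_left, inner_smul_left, inner_smul_left]; simp
    rw [this]
    have hb' : b = 1 - a := by linarith
    rw [hb']; ring
  have hb' : w (Y m) = a * w (Y m) + b * w (Y m) := by rw [← add_mul, hab, one_mul]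
  have key2 : -(‖m - Y m‖ ^ 2 / (2 * l)) + 1 / l / 2 * ‖m‖ ^ 2
      = a * (-(‖x - Y m‖ ^ 2 / (2 * l)) + 1 / l / 2 * ‖x‖ ^ 2)
      + b * (-(‖y - Y m‖ ^ 2 / (2 * l)) + 1 / l / 2 * ‖y‖ ^ 2) := by
    have e : ∀ s t : ℝ, -(s / (2 * l)) + 1 / l / 2 * t = -(1 / (2 * l)) * (s - t) := by
      intro s t; field_simp; ring
    rw [e, e, e, key]; ring
  linarith

/-- Derivatives of the polynomial test functions. -/
theorem aux_testpoly {n : ℕ} (xs : En n) (ts c0 a η c N : ℝ) (q : En n)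
    (X : En n →L[ℝ] En n) (hX : ∀ h k, ⟪X h, k⟫ = ⟪h, X k⟫) (φ : En n × ℝ → ℝ)
    (hφ : φ = fun z => c0 + ⟪q, z.1 - xs⟫ + a * (z.2 - ts) + 1 / 2 * ⟪X (z.1 - xs), z.1 - xs⟫
      + η * ‖z.1 - xs‖ ^ 2 + c * (z.2 - ts) ^ 2 + N * (‖z.1 - xs‖ ^ 2 + (z.2 - ts) ^ 2) ^ 2) :
    ContDiff ℝ 2 φ ∧ sGrad φ xs ts = q ∧
      sHess φ xs ts = X + (2 * η) • ContinuousLinearMap.id ℝ (En n) ∧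
      deriv (fun s => φ (xs, s)) ts = a := by
  have hgr : ∀ y, sGrad φ y ts = q + X (y - xs) + (2 * η) • (y - xs)
      + (4 * N * ‖y - xs‖ ^ 2) • (y - xs) := by
    intro y
    unfold sGrad
    apply HasGradientAt.gradient
    rw [hasGradientAt_iff_hasFDerivAt]
    have e0 : HasFDerivAt (fun y : En n => y - xs) (ContinuousLinearMap.id ℝ (En n)) y :=
      (hasFDerivAt_id y).sub_const xs
    have e1 := (hasFDerivAt_const q y).inner ℝ e0
    have e2 := (X.hasFDerivAt.comp y e0).inner ℝ e0
    have e3 := e0.norm_sq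
    have e4 := (e3.add_const ((ts - ts) ^ 2)).pow 2
    have e5 := (((((e1.const_add c0).add_const (a * (ts - ts))).add (e2.const_mul (1 / 2))).add
      (e3.const_mul η)).add_const (c * (ts - ts) ^ 2)).add (e4.const_mul N)
    rw [hφ]
    refine e5.congr_fderiv ?_
    ext h
    simp [inner_add_left, inner_smul_left, fderivInnerCLM_apply]
    have h3 : ⟪X h, y - xs⟫ = ⟪X y - X xs, h⟫ := by
      rw [hX, real_inner_comm, ← map_sub]
    rw [h3, inner_sub_left]
    ring
  refine ⟨?_, ?_, ?_, ?_⟩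
  · rw [hφ]
    have h1 : ContDiff ℝ 2 (fun z : En n × ℝ => z.1 - xs) := contDiff_fst.sub contDiff_const
    have h2 : ContDiff ℝ 2 (fun z : En n × ℝ => z.2 - ts) := contDiff_snd.sub contDiff_const
    have h3 := contDiff_const (c := q) |>.inner ℝ h1
    have h4 := (X.contDiff.comp h1).inner ℝ h1
    have h5 := h1.norm_sq ℝ
    exact (((((contDiff_const.add h3).add (contDiff_const.mul h2)).add
      (contDiff_const.mul h4)).add (contDiff_const.mul h5)).add
        (contDiff_const.mul (h2.pow 2))).add (contDiff_const.mul ((h5.add (h2.pow 2)).pow 2))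
  · rw [hgr]; simp
  · unfold sHess
    apply HasFDerivAt.fderiv
    have e0 : HasFDerivAt (fun y : En n => y - xs) (ContinuousLinearMap.id ℝ (En n)) xs :=
      (hasFDerivAt_id xs).sub_const xs
    have e3 := (e0.norm_sq.const_mul (4 * N)).smul e0
    have e2 := X.hasFDerivAt.comp xs e0
    have e5 := ((e2.const_add q).add (e0.const_smul (2 * η))).add e3
    have : (fun y => sGrad φ y ts) = fun y => q + X (y - xs) + (2 * η) • (y - xs)
      + (4 * N * ‖y - xs‖ ^ 2) • (y - xs) := funext hgr
    rw [this]
    refine e5.congr_fderiv ?_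
    ext h
    simp
  · apply HasDerivAt.deriv
    have e0 : HasDerivAt (fun s : ℝ => s - ts) 1 ts := (hasDerivAt_id ts).sub_const ts
    rw [hφ]
    have e := ((((e0.const_mul a).const_add (c0 + ⟪q, xs - xs⟫)).add_const
      (1 / 2 * ⟪X (xs - xs), xs - xs⟫)).add_const (η * ‖xs - xs‖ ^ 2)).add
        ((e0.pow 2).const_mul c) |>.add ((((e0.pow 2).const_add (‖xs - xs‖ ^ 2)).pow 2).const_mul N)
    refine e.congr_deriv ?_
    simp

open Filter Topology in
/-- Second order superjets of a subsolution satisfy the differential inequality. -/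
theorem aux_jet {n : ℕ} (γ p : ℝ) (K : En n) (f u : En n × ℝ → ℝ)
    (hsub : ∀ z ∈ pCyl n 1, ∀ φ : En n × ℝ → ℝ, ContDiff ℝ 2 φ →
      sGrad φ z.1 z.2 ≠ 0 → φ z = u z + ⟪K, z.1⟫ →
      (∀ w ∈ pCyl n 1, u w + ⟪K, w.1⟫ ≤ φ w) →
      deriv (fun s => φ (z.1, s)) z.2
            - opVal γ p (sGrad φ z.1 z.2) (sHess φ z.1 z.2) ≤ f z)
    (hu : ∀ z ∈ pCyl n 1, |u z| ≤ 1) (hf : ∀ z ∈ pCyl n 1, f z ≤ 1)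
    (xs : En n) (ts : ℝ) (hz : (xs, ts) ∈ pCyl n 1) (q : En n) (a : ℝ)
    (X : En n →L[ℝ] En n) (hX : ∀ h k, ⟪X h, k⟫ = ⟪h, X k⟫) (hq : q + K ≠ 0)
    (hjet : ∀ η > (0:ℝ), ∃ c : ℝ, ∀ᶠ h : En n × ℝ in 𝓝 0,
      u (xs + h.1, ts + h.2) ≤ u (xs, ts) + ⟪q, h.1⟫ + a * h.2 + 1 / 2 * ⟪X h.1, h.1⟫
        + η * ‖h.1‖ ^ 2 + c * h.2 ^ 2) :
    a ≤ 1 + opVal γ p (q + K) X := by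
  have key : ∀ η > (0:ℝ), a - opVal γ p (q + K) (X + (2 * η) • ContinuousLinearMap.id ℝ (En n))
      ≤ 1 := by
    intro η hη
    obtain ⟨c, hc⟩ := hjet η hη
    obtain ⟨δ, hδ, hb⟩ := Metric.eventually_nhds_iff.mp hc
    set N : ℝ := (2 + 2 * ‖q‖ + |a| + 2 * ‖X‖ + |c|) / δ ^ 4 with hN
    have hN0 : 0 ≤ N := by positivity
    obtain ⟨h1, h2, h3, h4⟩ := aux_testpoly xs ts (u (xs, ts) + ⟪K, xs⟫) a η c N (q + K) X hX _ rfl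
    have := hsub (xs, ts) hz _ h1 (by rw [h2]; exact hq) (by simp) ?_
    · simp only [h2, h3, h4] at this
      exact this.trans (hf _ hz)
    · rintro ⟨x, t⟩ hxt
      simp only
      have eK : ⟪K, x⟫ = ⟪K, xs⟫ + ⟪K, x - xs⟫ := by rw [← inner_add_right]; simp
      rw [inner_add_left, eK]
      by_cases hd : dist ((x - xs, t - ts) : En n × ℝ) 0 < δ
      · have := hb hd
        simp only [add_sub_cancel] at this
        have : 0 ≤ N * (‖x - xs‖ ^ 2 + (t - ts) ^ 2) ^ 2 := by positivity
        linarith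
      · push Not at hd
        rw [dist_zero_right, Prod.norm_def] at hd
        simp only [Real.norm_eq_abs] at hd
        have hs : δ ^ 2 ≤ ‖x - xs‖ ^ 2 + (t - ts) ^ 2 := by
          rcases le_max_iff.mp hd with h | h
          · have := pow_le_pow_left₀ hδ.le h 2
            nlinarith [sq_nonneg (t - ts)]
          · have := pow_le_pow_left₀ hδ.le h 2
            rw [sq_abs] at this
            nlinarith [sq_nonneg ‖x - xs‖]
        have hs2 : δ ^ 4 ≤ (‖x - xs‖ ^ 2 + (t - ts) ^ 2) ^ 2 := by
          have := pow_le_pow_left₀ (by positivity) hs 2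
          calc δ ^ 4 = (δ ^ 2) ^ 2 := by ring
            _ ≤ _ := this
        have hs3 : 2 + 2 * ‖q‖ + |a| + 2 * ‖X‖ + |c| ≤ N * (‖x - xs‖ ^ 2 + (t - ts) ^ 2) ^ 2 := by
          calc 2 + 2 * ‖q‖ + |a| + 2 * ‖X‖ + |c| = N * δ ^ 4 := by rw [hN]; field_simp
            _ ≤ _ := by gcongr
        have hx2 : ‖x - xs‖ ≤ 2 := by
          have := norm_sub_le x xs
          have h1 := hxt.1; have h2 := hz.1
          simp only at h1 h2; linarith
        have ht1 : |t - ts| ≤ 1 := by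
          have h1 := hxt.2; have h2 := hz.2
          simp only [mem_Ioo] at h1 h2
          rw [abs_le]; constructor <;> linarith [h1.1, h1.2, h2.1, h2.2]
        have b1 : -(2 * ‖q‖) ≤ ⟪q, x - xs⟫ := by
          have := (abs_le.mp (abs_real_inner_le_norm q (x - xs))).1
          nlinarith [norm_nonneg q, norm_nonneg (x - xs)]
        have b2 : -|a| ≤ a * (t - ts) := by
          have : |a * (t - ts)| ≤ |a| := by
            rw [abs_mul]; nlinarith [abs_nonneg a]
          linarith [(abs_le.mp this).1]
        have b3 : -(4 * ‖X‖) ≤ ⟪X (x - xs), x - xs⟫ := by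
          have e1 := (abs_le.mp (abs_real_inner_le_norm (X (x - xs)) (x - xs))).1
          have e2 := X.le_opNorm (x - xs)
          have : ‖X (x - xs)‖ * ‖x - xs‖ ≤ (‖X‖ * 2) * 2 := by
            gcongr
            exact e2.trans (by gcongr)
          linarith
        have b4 : -|c| ≤ c * (t - ts) ^ 2 := by
          have : |c * (t - ts) ^ 2| ≤ |c| := by
            rw [abs_mul, abs_pow]
            have : |t - ts| ^ 2 ≤ 1 := pow_le_one₀ (abs_nonneg _) ht1
            nlinarith [abs_nonneg c]
          linarith [(abs_le.mp this).1]
        have b5 : 0 ≤ η * ‖x - xs‖ ^ 2 := by positivity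
        have u1 := (abs_le.mp (hu _ hxt)).2
        have u2 := (abs_le.mp (hu _ hz)).1
        linarith
  have hlin : ∀ η : ℝ, opVal γ p (q + K) (X + (2 * η) • ContinuousLinearMap.id ℝ (En n))
      = opVal γ p (q + K) X + η * (2 * ‖q + K‖ ^ γ * (n + (p - 2))) := by
    intro η
    generalize hQ : q + K = Q at hq
    unfold opVal
    have hne : ‖Q‖ ≠ 0 := norm_ne_zero_iff.mpr hq
    have e1 : LinearMap.trace ℝ (En n)
        (X + (2 * η) • ContinuousLinearMap.id ℝ (En n)).toLinearMap
        = LinearMap.trace ℝ (En n) X.toLinearMap + 2 * η * n := by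
      rw [ContinuousLinearMap.toLinearMap_add, map_add, ContinuousLinearMap.coe_smul, map_smul,
        ContinuousLinearMap.coe_id, LinearMap.trace_id]
      simp
    have e2 : ⟪(X + (2 * η) • ContinuousLinearMap.id ℝ (En n)) Q, Q⟫
        = ⟪X Q, Q⟫ + 2 * η * ‖Q‖ ^ 2 := by
      rw [_root_.add_apply, _root_.smul_apply, ContinuousLinearMap.id_apply, inner_add_left,
        real_inner_smul_left, real_inner_self_eq_norm_sq]
    rw [e1, e2]
    field_simp
    ring
  by_contra hcon
  push Not at hcon
  set B := 2 * ‖q + K‖ ^ γ * (n + (p - 2)) with hB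
  set d := a - 1 - opVal γ p (q + K) X with hd
  have hd0 : 0 < d := by linarith
  have hη : 0 < d / (2 * (|B| + 1)) := by positivity
  have h := key _ hη
  rw [hlin] at h
  have h2 : d / (2 * (|B| + 1)) * B ≤ d / 2 := by
    have : B ≤ |B| + 1 := by linarith [le_abs_self B]
    calc d / (2 * (|B| + 1)) * B ≤ d / (2 * (|B| + 1)) * (|B| + 1) := by gcongr
      _ = d / 2 := by field_simp
  linarith

/-- The square root of the diffusion matrix. -/
def auxSig {n : ℕ} (γ p : ℝ) (q v : En n) : En n :=
  ‖q‖ ^ (γ / 2) • (v + ((√(p - 1) - 1) * ⟪q, v⟫ / ‖q‖ ^ 2) • q)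

theorem aux_sig_sum {n : ℕ} (γ p : ℝ) (hp : 1 < p) (q : En n) (hq : q ≠ 0)
    (H : En n →L[ℝ] En n) (hH : ∀ h k, ⟪H h, k⟫ = ⟪h, H k⟫)
    (b : OrthonormalBasis (Fin n) ℝ (En n)) :
    ∑ i, ⟪H (auxSig γ p q (b i)), auxSig γ p q (b i)⟫ = opVal γ p q H := by
  set τ := √(p - 1) - 1 with hτ
  have hτ2 : τ ^ 2 + 2 * τ = p - 2 := by
    have : √(p - 1) ^ 2 = p - 1 := Real.sq_sqrt (by linarith)
    have h2 : √(p - 1) = τ + 1 := by rw [hτ]; ring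
    rw [h2] at this; linarith
  have hne : ‖q‖ ≠ 0 := norm_ne_zero_iff.mpr hq
  have hpos : 0 < ‖q‖ := norm_pos_iff.mpr hq
  have hα : ‖q‖ ^ (γ / 2) * ‖q‖ ^ (γ / 2) = ‖q‖ ^ γ := by
    rw [← Real.rpow_add hpos]; congr 1; ring
  have e1 : ∀ i, ⟪H (auxSig γ p q (b i)), auxSig γ p q (b i)⟫ = ‖q‖ ^ γ * (⟪b i, H (b i)⟫
      + (2 * τ / ‖q‖ ^ 2) * (⟪q, b i⟫ * ⟪b i, H q⟫)
      + (τ ^ 2 / ‖q‖ ^ 4 * ⟪H q, q⟫) * (⟪q, b i⟫ * ⟪b i, q⟫)) := by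
    intro i
    unfold auxSig
    rw [← hτ]
    simp only [map_smul, map_add, inner_add_left, inner_add_right, real_inner_smul_left,
      real_inner_smul_right]
    have h1 : ⟪H (b i), q⟫ = ⟪b i, H q⟫ := hH _ _
    have h2 : ⟪H q, b i⟫ = ⟪b i, H q⟫ := real_inner_comm _ _
    have h3 : ⟪H (b i), b i⟫ = ⟪b i, H (b i)⟫ := hH _ _
    have h4 : ⟪b i, q⟫ = ⟪q, b i⟫ := real_inner_comm _ _
    rw [h1, h2, h3, h4, ← hα]
    field_simp
    ring
  simp_rw [e1]
  rw [← Finset.mul_sum, Finset.sum_add_distrib, Finset.sum_add_distrib, ← Finset.mul_sum,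
    ← Finset.mul_sum, b.sum_inner_mul_inner, b.sum_inner_mul_inner, real_inner_self_eq_norm_sq]
  unfold opVal
  rw [LinearMap.trace_eq_sum_inner _ b, ← hτ2, ← hH q q]
  simp only [ContinuousLinearMap.coe_coe]
  field_simp
  ring

theorem aux_opVal_neg {n : ℕ} (γ p : ℝ) (q : En n) (H : En n →L[ℝ] En n) :
    opVal γ p (-q) H = opVal γ p q H := by
  unfold opVal; simp

theorem aux_opVal_neg' {n : ℕ} (γ p : ℝ) (q : En n) (H : En n →L[ℝ] En n) :
    opVal γ p (-q) (-H) = - opVal γ p q H := by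
  unfold opVal; simp; ring

theorem aux_pow_bounds (γ P x : ℝ) (hγ : γ ∈ Set.Ioo (-1 : ℝ) 0) (hP : 0 < P) (h1 : P / 2 ≤ x)
    (h2 : x ≤ 2 * P) : P ^ (γ / 2) / 2 ≤ x ^ (γ / 2) ∧ x ^ (γ / 2) ≤ 2 * P ^ (γ / 2) := by
  have hx : 0 < x := by linarith
  constructor
  · calc P ^ (γ / 2) / 2 = (2:ℝ) ^ (-1 : ℝ) * P ^ (γ / 2) := by
          rw [Real.rpow_neg_one]; ring
      _ ≤ 2 ^ (γ / 2) * P ^ (γ / 2) := by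
          gcongr
          · norm_num
          · linarith [hγ.1]
      _ = (2 * P) ^ (γ / 2) := by rw [Real.mul_rpow (by norm_num) hP.le]
      _ ≤ x ^ (γ / 2) := Real.rpow_le_rpow_of_nonpos hx h2 (by linarith [hγ.2])
  · calc x ^ (γ / 2) ≤ (P / 2) ^ (γ / 2) :=
          Real.rpow_le_rpow_of_nonpos (by linarith) h1 (by linarith [hγ.2])
      _ = 2 ^ (-(γ / 2)) * P ^ (γ / 2) := by
          rw [Real.div_rpow hP.le (by norm_num), Real.rpow_neg (by norm_num)]; field_simp
      _ ≤ 2 ^ (1:ℝ) * P ^ (γ / 2) := by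
          gcongr
          · norm_num
          · linarith [hγ.1]
      _ = _ := by rw [Real.rpow_one]

theorem aux_pow_diff (γ P x y : ℝ) (hγ : γ ∈ Set.Ioo (-1 : ℝ) 0) (hP : 0 < P) (h1 : P / 2 ≤ x)
    (h2 : x ≤ 2 * P) (h3 : x ≤ y) :
    |x ^ (γ / 2) - y ^ (γ / 2)| ≤ 4 * P ^ (γ / 2) * ((y - x) / P) := by
  have hx : 0 < x := by linarith
  have hy : 0 < y := by linarith
  have hle : y ^ (γ / 2) ≤ x ^ (γ / 2) :=
    Real.rpow_le_rpow_of_nonpos hx h3 (by linarith [hγ.2])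
  rw [abs_of_nonneg (by linarith)]
  have hb := (aux_pow_bounds γ P x hγ hP h1 h2).2
  -- y^{γ/2} ≥ x^{γ/2} * (x / y)
  have hk : x ^ (γ / 2) * (x / y) ≤ y ^ (γ / 2) := by
    have e1 : x / y ≤ (x / y) ^ (-(γ / 2)) := by
      have hxy : x / y ≤ 1 := by rw [div_le_one hy]; exact h3
      calc x / y = (x / y) ^ (1:ℝ) := (Real.rpow_one _).symm
        _ ≤ _ := Real.rpow_le_rpow_of_exponent_ge (by positivity) hxy (by linarith [hγ.1])
    calc x ^ (γ / 2) * (x / y) ≤ x ^ (γ / 2) * (x / y) ^ (-(γ / 2)) := by gcongr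
      _ = y ^ (γ / 2) := by
        rw [Real.rpow_neg (by positivity), Real.div_rpow hx.le hy.le]
        have := (Real.rpow_pos_of_pos hx (γ / 2)).ne'
        field_simp
  have e2 : 1 - x / y ≤ 2 * ((y - x) / P) := by
    have : 1 - x / y = (y - x) / y := by field_simp
    rw [this]
    calc (y - x) / y ≤ (y - x) / (P / 2) := by
          apply div_le_div_of_nonneg_left <;> linarith
      _ = _ := by field_simp
  have hA : 0 < P ^ (γ / 2) := Real.rpow_pos_of_pos hP _
  calc x ^ (γ / 2) - y ^ (γ / 2) ≤ x ^ (γ / 2) * (1 - x / y) := by linarith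
    _ ≤ (2 * P ^ (γ / 2)) * (2 * ((y - x) / P)) := by
      apply mul_le_mul hb e2 _ (by positivity)
      have : x / y ≤ 1 := by rw [div_le_one hy]; exact h3
      linarith
    _ = _ := by ring

theorem aux_pow_diff' (γ P x y : ℝ) (hγ : γ ∈ Set.Ioo (-1 : ℝ) 0) (hP : 0 < P) (h1 : P / 2 ≤ x)
    (h2 : x ≤ 2 * P) (h3 : P / 2 ≤ y) (h4 : y ≤ 2 * P) :
    |x ^ (γ / 2) - y ^ (γ / 2)| ≤ 4 * P ^ (γ / 2) * (|x - y| / P) := by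
  rcases le_total x y with h | h
  · have := aux_pow_diff γ P x y hγ hP h1 h2 h
    rwa [abs_sub_comm x y, abs_of_nonneg (by linarith : 0 ≤ y - x)]
  · have := aux_pow_diff γ P y x hγ hP h3 h4 h
    rwa [abs_sub_comm, abs_of_nonneg (by linarith : 0 ≤ x - y)]

/-- The projection difference. -/
theorem aux_proj_diff {n : ℕ} (P : ℝ) (q1 q2 v : En n) (hP : 0 < P) (h1 : P / 2 ≤ ‖q1‖)
    (h2 : P / 2 ≤ ‖q2‖) :
    ‖(⟪q1, v⟫ / ‖q1‖ ^ 2) • q1 - (⟪q2, v⟫ / ‖q2‖ ^ 2) • q2‖ ≤ 8 * (‖q1 - q2‖ / P) * ‖v‖ := by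
  have p1 : 0 < ‖q1‖ := by linarith
  have p2 : 0 < ‖q2‖ := by linarith
  set e1 := ‖q1‖⁻¹ • q1 with he1
  set e2 := ‖q2‖⁻¹ • q2 with he2
  have n1 : ‖e1‖ = 1 := by
    rw [he1, norm_smul, norm_inv, norm_norm]; field_simp
  have n2 : ‖e2‖ = 1 := by
    rw [he2, norm_smul, norm_inv, norm_norm]; field_simp
  have hd : ‖e1 - e2‖ ≤ 4 * (‖q1 - q2‖ / P) := by
    have : e1 - e2 = ‖q1‖⁻¹ • ((q1 - q2) + (‖q2‖ - ‖q1‖) • e2) := by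
      have hq1 : q1 = ‖q1‖ • e1 := by rw [he1, smul_smul, mul_inv_cancel₀ p1.ne', one_smul]
      have hq2 : q2 = ‖q2‖ • e2 := by rw [he2, smul_smul, mul_inv_cancel₀ p2.ne', one_smul]
      have h3 : (q1 - q2) + (‖q2‖ - ‖q1‖) • e2 = ‖q1‖ • (e1 - e2) := by
        rw [sub_smul, ← hq2, smul_sub, ← hq1]; abel
      rw [h3, smul_smul, inv_mul_cancel₀ p1.ne', one_smul]
    rw [this, norm_smul, norm_inv, norm_norm]
    have e3 : ‖(q1 - q2) + (‖q2‖ - ‖q1‖) • e2‖ ≤ 2 * ‖q1 - q2‖ := by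
      calc _ ≤ ‖q1 - q2‖ + ‖(‖q2‖ - ‖q1‖) • e2‖ := norm_add_le _ _
        _ = ‖q1 - q2‖ + |‖q2‖ - ‖q1‖| := by rw [norm_smul, n2, mul_one, Real.norm_eq_abs]
        _ ≤ _ := by
          have := abs_norm_sub_norm_le q1 q2
          rw [abs_sub_comm]; linarith
    calc ‖q1‖⁻¹ * _ ≤ (P / 2)⁻¹ * (2 * ‖q1 - q2‖) := by gcongr
      _ = _ := by field_simp; ring
  have r1 : (⟪q1, v⟫ / ‖q1‖ ^ 2) • q1 = ⟪e1, v⟫ • e1 := by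
    rw [he1, real_inner_smul_left, smul_smul]; congr 1; field_simp
  have r2 : (⟪q2, v⟫ / ‖q2‖ ^ 2) • q2 = ⟪e2, v⟫ • e2 := by
    rw [he2, real_inner_smul_left, smul_smul]; congr 1; field_simp
  rw [r1, r2]
  have : ⟪e1, v⟫ • e1 - ⟪e2, v⟫ • e2 = ⟪e1, v⟫ • (e1 - e2) + ⟪e1 - e2, v⟫ • e2 := by
    rw [inner_sub_left, sub_smul, smul_sub]; abel
  rw [this]
  have b1 := abs_real_inner_le_norm e1 v
  have b2 := abs_real_inner_le_norm (e1 - e2) v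
  rw [n1, one_mul] at b1
  calc _ ≤ ‖⟪e1, v⟫ • (e1 - e2)‖ + ‖⟪e1 - e2, v⟫ • e2‖ := norm_add_le _ _
    _ = |⟪e1, v⟫| * ‖e1 - e2‖ + |⟪e1 - e2, v⟫| := by
      rw [norm_smul, norm_smul, n2, mul_one, Real.norm_eq_abs, Real.norm_eq_abs]
    _ ≤ ‖v‖ * ‖e1 - e2‖ + ‖e1 - e2‖ * ‖v‖ := by gcongr
    _ = 2 * ‖e1 - e2‖ * ‖v‖ := by ring
    _ ≤ 2 * (4 * (‖q1 - q2‖ / P)) * ‖v‖ := by gcongr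
    _ = _ := by ring

theorem aux_sig_bound {n : ℕ} (γ p P : ℝ) (q v : En n) (hγ : γ ∈ Set.Ioo (-1 : ℝ) 0) (hP : 0 < P)
    (h1 : P / 2 ≤ ‖q‖) (h2 : ‖q‖ ≤ 2 * P) :
    ‖v + ((√(p - 1) - 1) * ⟪q, v⟫ / ‖q‖ ^ 2) • q‖ ≤ (1 + |√(p - 1) - 1|) * ‖v‖ ∧
    ‖auxSig γ p q v‖ ≤ 2 * P ^ (γ / 2) * ((1 + |√(p - 1) - 1|) * ‖v‖) := by
  set τ := √(p - 1) - 1 with hτ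
  have hq : 0 < ‖q‖ := by linarith
  have hb : ‖v + (τ * ⟪q, v⟫ / ‖q‖ ^ 2) • q‖ ≤ (1 + |τ|) * ‖v‖ := by
    calc _ ≤ ‖v‖ + ‖(τ * ⟪q, v⟫ / ‖q‖ ^ 2) • q‖ := norm_add_le _ _
      _ = ‖v‖ + |τ| * |⟪q, v⟫| / ‖q‖ := by
        rw [norm_smul, Real.norm_eq_abs, abs_div, abs_mul, abs_of_nonneg (sq_nonneg ‖q‖)]
        field_simp
      _ ≤ ‖v‖ + |τ| * (‖q‖ * ‖v‖) / ‖q‖ := by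
        gcongr
        exact abs_real_inner_le_norm _ _
      _ = _ := by field_simp
  refine ⟨hb, ?_⟩
  unfold auxSig
  rw [norm_smul, Real.norm_eq_abs, abs_of_nonneg (by positivity)]
  have := (aux_pow_bounds γ P ‖q‖ hγ hP h1 h2).2
  gcongr

theorem aux_sig_diff {n : ℕ} (γ p P : ℝ) (q1 q2 v : En n) (hγ : γ ∈ Set.Ioo (-1 : ℝ) 0)
    (hP : 0 < P) (h1 : P / 2 ≤ ‖q1‖) (h1' : ‖q1‖ ≤ 2 * P)
    (h2 : P / 2 ≤ ‖q2‖) (h2' : ‖q2‖ ≤ 2 * P) :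
    ‖auxSig γ p q1 v - auxSig γ p q2 v‖ ≤
      (4 + 20 * |√(p - 1) - 1|) * (P ^ (γ / 2) * (‖q1 - q2‖ / P) * ‖v‖) := by
  set τ := √(p - 1) - 1 with hτ
  have hb := (aux_sig_bound γ p P q1 v hγ hP h1 h1').1
  have hpd := aux_proj_diff P q1 q2 v hP h1 h2
  have hsd := aux_pow_diff' γ P ‖q1‖ ‖q2‖ hγ hP h1 h1' h2 h2'
  have hsb := (aux_pow_bounds γ P ‖q2‖ hγ hP h2 h2').2
  rw [← hτ] at hb
  have hA : 0 < P ^ (γ / 2) := Real.rpow_pos_of_pos hP _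
  have e : auxSig γ p q1 v - auxSig γ p q2 v
      = (‖q1‖ ^ (γ / 2) - ‖q2‖ ^ (γ / 2)) • (v + (τ * ⟪q1, v⟫ / ‖q1‖ ^ 2) • q1)
        + (‖q2‖ ^ (γ / 2) * τ) • ((⟪q1, v⟫ / ‖q1‖ ^ 2) • q1 - (⟪q2, v⟫ / ‖q2‖ ^ 2) • q2) := by
    unfold auxSig
    rw [← hτ]
    module
  have hsd' : |‖q1‖ ^ (γ / 2) - ‖q2‖ ^ (γ / 2)| ≤ 4 * P ^ (γ / 2) * (‖q1 - q2‖ / P) := by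
    refine hsd.trans ?_
    have := abs_norm_sub_norm_le q1 q2
    gcongr
  rw [e]
  calc _ ≤ ‖(‖q1‖ ^ (γ / 2) - ‖q2‖ ^ (γ / 2)) • (v + (τ * ⟪q1, v⟫ / ‖q1‖ ^ 2) • q1)‖
        + ‖(‖q2‖ ^ (γ / 2) * τ) • ((⟪q1, v⟫ / ‖q1‖ ^ 2) • q1 - (⟪q2, v⟫ / ‖q2‖ ^ 2) • q2)‖ :=
        norm_add_le _ _
    _ ≤ (4 * P ^ (γ / 2) * (‖q1 - q2‖ / P)) * ((1 + |τ|) * ‖v‖)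
        + (2 * P ^ (γ / 2) * |τ|) * (8 * (‖q1 - q2‖ / P) * ‖v‖) := by
      rw [norm_smul, norm_smul, Real.norm_eq_abs, Real.norm_eq_abs, abs_mul,
        abs_of_nonneg (Real.rpow_nonneg (norm_nonneg q2) _)]
      gcongr
    _ = _ := by ring

set_option maxHeartbeats 1000000 in
/-- The Ishii–Lions algebraic lemma. -/
theorem aux_algebra (n : ℕ) (γ p : ℝ) (hγ : γ ∈ Set.Ioo (-1 : ℝ) 0) (hp : 1 < p) :
    ∃ C : ℝ, 1 ≤ C ∧ ∀ (P a b M κ : ℝ) (z q1 q2 : En n) (X Y : En n →L[ℝ] En n),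
      0 < P → 0 < a → 0 < κ → 0 ≤ M → z ≠ 0 → κ = -(a + b * ‖z‖ ^ 2) →
      (∀ h k, ⟪X h, k⟫ = ⟪h, X k⟫) → (∀ h k, ⟪Y h, k⟫ = ⟪h, Y k⟫) →
      (∀ h k, ⟪X h, h⟫ + ⟪Y k, k⟫ ≤ a * ‖h - k‖ ^ 2 + b * ⟪z, h - k⟫ ^ 2
        + M * (‖h‖ ^ 2 + ‖k‖ ^ 2)) →
      P / 2 ≤ ‖q1‖ → ‖q1‖ ≤ 2 * P → P / 2 ≤ ‖q2‖ → ‖q2‖ ≤ 2 * P → C * ‖q1 - q2‖ ≤ P →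
      opVal γ p q1 X + opVal γ p q2 Y ≤
        P ^ γ * (-κ / C + C * a * (‖q1 - q2‖ / P) ^ 2 + C * M) := by
  set τ := √(p - 1) - 1 with hτ
  have hτ1 : 0 < 1 + τ := by
    have : 0 < √(p - 1) := Real.sqrt_pos.mpr (by linarith)
    rw [hτ]; linarith
  set c0 := 1 + |τ| / (1 + τ) with hc0
  set C1 := 4 + 20 * |τ| with hC1
  have c0p : 1 ≤ c0 := by rw [hc0]; have : 0 ≤ |τ| / (1 + τ) := by positivity
                          linarith
  have C1p : 4 ≤ C1 := by rw [hC1]; linarith [abs_nonneg τ]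
  set C := 1 + 2 * c0 * C1 + n * C1 ^ 2 + 4 * c0 ^ 2 + 8 * n * (1 + |τ|) ^ 2 with hC
  have g1 : 0 ≤ 2 * c0 * C1 := by positivity
  have g2 : 0 ≤ n * C1 ^ 2 := by positivity
  have g3 : 0 ≤ 4 * c0 ^ 2 := by positivity
  have g4 : 0 ≤ 8 * n * (1 + |τ|) ^ 2 := by positivity
  have hC0 : 1 ≤ C := by linarith
  refine ⟨C, hC0, ?_⟩
  intro P a b M κ z q1 q2 X Y hP ha hκ hM hz hκe hX hY hXY h1 h1' h2 h2' hΔ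
  have hq1 : q1 ≠ 0 := norm_pos_iff.mp (by linarith)
  have hq2 : q2 ≠ 0 := norm_pos_iff.mp (by linarith)
  have hz0 : 0 < ‖z‖ := norm_pos_iff.mpr hz
  have hq20 : 0 < ‖q2‖ := norm_pos_iff.mpr hq2
  obtain ⟨e, ne, hze⟩ : ∃ e : En n, ‖e‖ = 1 ∧ z = ‖z‖ • e :=
    ⟨‖z‖⁻¹ • z, by rw [norm_smul, norm_inv, norm_norm]; field_simp,
      by rw [smul_smul, mul_inv_cancel₀ hz0.ne', one_smul]⟩
  set A := P ^ (γ / 2) with hA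
  have hA0 : 0 < A := Real.rpow_pos_of_pos hP _
  have hAA : A ^ 2 = P ^ γ := by
    rw [hA, ← Real.rpow_natCast, ← Real.rpow_mul hP.le]; congr 1; push_cast; ring
  have hb0 : b ≤ 0 := by
    by_contra hb; push Not at hb
    have : 0 < b * ‖z‖ ^ 2 := by positivity
    linarith
  set D := ‖q1 - q2‖ / P with hD
  have hD0 : 0 ≤ D := by positivity
  have hD1 : 2 * c0 * C1 * D ≤ 1 := by
    have : 2 * c0 * C1 * ‖q1 - q2‖ ≤ P := by
      refine le_trans ?_ hΔ
      gcongr; linarith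
    rw [hD, ← mul_div_assoc, div_le_one hP]; exact this
  -- the special direction
  set m' := e - (τ / (1 + τ) * ⟪q2, e⟫ / ‖q2‖ ^ 2) • q2 with hm'
  have hsm' : auxSig γ p q2 m' = ‖q2‖ ^ (γ / 2) • e := by
    unfold auxSig
    congr 1
    rw [← hτ]
    have : ⟪q2, m'⟫ = ⟪q2, e⟫ / (1 + τ) := by
      rw [hm', inner_sub_right, real_inner_smul_right, real_inner_self_eq_norm_sq]
      field_simp
      ring
    rw [this, hm', sub_add, ← sub_smul]
    have : τ / (1 + τ) * ⟪q2, e⟫ / ‖q2‖ ^ 2 - τ * (⟪q2, e⟫ / (1 + τ)) / ‖q2‖ ^ 2 = 0 := by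
      field_simp; ring
    rw [this]; simp
  have hm'n : ‖m'‖ ≤ c0 := by
    calc ‖m'‖ ≤ ‖e‖ + ‖(τ / (1 + τ) * ⟪q2, e⟫ / ‖q2‖ ^ 2) • q2‖ := norm_sub_le _ _
      _ = 1 + |τ| / (1 + τ) * |⟪q2, e⟫| / ‖q2‖ := by
        rw [norm_smul, Real.norm_eq_abs, abs_div, abs_mul, abs_div, abs_of_pos hτ1,
          abs_of_nonneg (sq_nonneg ‖q2‖), ne]
        field_simp
      _ ≤ 1 + |τ| / (1 + τ) * (‖q2‖ * ‖e‖) / ‖q2‖ := by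
        gcongr
        exact abs_real_inner_le_norm _ _
      _ = c0 := by rw [ne, hc0]; field_simp
  have hα := (aux_pow_bounds γ P ‖q2‖ hγ hP h2 h2').1
  have hαp : 0 < ‖q2‖ ^ (γ / 2) := Real.rpow_pos_of_pos hq20 _
  have hm'ne : m' ≠ 0 := by
    intro h0
    rw [h0] at hsm'
    have : ‖(‖q2‖ ^ (γ / 2)) • e‖ = 0 := by rw [← hsm']; simp [auxSig]
    rw [norm_smul, ne, mul_one, Real.norm_eq_abs, abs_of_pos hαp] at this
    linarith
  have hm'p : 0 < ‖m'‖ := norm_pos_iff.mpr hm'ne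
  set m := ‖m'‖⁻¹ • m' with hm
  have hmn : ‖m‖ = 1 := by rw [hm, norm_smul, norm_inv, norm_norm]; field_simp
  set s := ‖q2‖ ^ (γ / 2) / ‖m'‖ with hs
  have hsm : auxSig γ p q2 m = s • e := by
    have : auxSig γ p q2 m = ‖m'‖⁻¹ • auxSig γ p q2 m' := by
      unfold auxSig
      rw [hm, real_inner_smul_right]
      module
    rw [this, hsm', smul_smul, hs]; congr 1; field_simp
  have hsl : A / (2 * c0) ≤ s := by
    rw [hs]
    calc A / (2 * c0) = (A / 2) / c0 := by field_simp
      _ ≤ ‖q2‖ ^ (γ / 2) / ‖m'‖ := by gcongr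
  -- orthonormal basis
  have hn : 0 < n := by
    rcases Nat.eq_zero_or_pos n with h | h
    · subst h
      exact absurd (Subsingleton.elim z 0) hz
    · exact h
  obtain ⟨B, hB⟩ := Orthonormal.exists_orthonormalBasis_extension_of_card_eq (𝕜 := ℝ) (E := En n)
    (ι := Fin n) (by simp) (v := fun _ => m) (s := {⟨0, hn⟩}) (by
      constructor
      · intro i; exact hmn
      · intro i j hij
        exact absurd (Subtype.ext ((mem_singleton_iff.mp i.2).trans (mem_singleton_iff.mp j.2).symm)) hij)
  set i0 : Fin n := ⟨0, hn⟩ with hi0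
  have hBm : B i0 = m := hB i0 rfl
  have hsd : ∀ v : En n, ‖v‖ = 1 → ‖auxSig γ p q1 v - auxSig γ p q2 v‖ ≤ C1 * (A * D) := by
    intro v hv
    have := aux_sig_diff γ p P q1 q2 v hγ hP h1 h1' h2 h2'
    rw [hv, mul_one] at this
    exact this
  have hsb1 : ∀ v : En n, ‖v‖ = 1 → ‖auxSig γ p q1 v‖ ^ 2 ≤ 4 * A ^ 2 * (1 + |τ|) ^ 2 := by
    intro v hv
    have := (aux_sig_bound γ p P q1 v hγ hP h1 h1').2
    rw [hv, mul_one] at this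
    calc _ ≤ (2 * A * (1 + |τ|)) ^ 2 := pow_le_pow_left₀ (norm_nonneg _) this 2
      _ = _ := by ring
  have hsb2 : ∀ v : En n, ‖v‖ = 1 → ‖auxSig γ p q2 v‖ ^ 2 ≤ 4 * A ^ 2 * (1 + |τ|) ^ 2 := by
    intro v hv
    have := (aux_sig_bound γ p P q2 v hγ hP h2 h2').2
    rw [hv, mul_one] at this
    calc _ ≤ (2 * A * (1 + |τ|)) ^ 2 := pow_le_pow_left₀ (norm_nonneg _) this 2
      _ = _ := by ring
  set R := a * (C1 * (A * D)) ^ 2 + M * (4 * A ^ 2 * (1 + |τ|) ^ 2 + 4 * A ^ 2 * (1 + |τ|) ^ 2)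
    with hR
  have hgen : ∀ i, ⟪X (auxSig γ p q1 (B i)), auxSig γ p q1 (B i)⟫
      + ⟪Y (auxSig γ p q2 (B i)), auxSig γ p q2 (B i)⟫ ≤ R := by
    intro i
    have hBi : ‖B i‖ = 1 := B.norm_eq_one i
    refine (hXY _ _).trans ?_
    have t1 := pow_le_pow_left₀ (norm_nonneg _) (hsd _ hBi) 2
    have t2 := hsb1 _ hBi
    have t3 := hsb2 _ hBi
    have t4 : b * ⟪z, auxSig γ p q1 (B i) - auxSig γ p q2 (B i)⟫ ^ 2 ≤ 0 :=
      mul_nonpos_of_nonpos_of_nonneg hb0 (sq_nonneg _)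
    have t5 : a * ‖auxSig γ p q1 (B i) - auxSig γ p q2 (B i)‖ ^ 2 ≤ a * (C1 * (A * D)) ^ 2 := by
      gcongr
    have t6 : M * (‖auxSig γ p q1 (B i)‖ ^ 2 + ‖auxSig γ p q2 (B i)‖ ^ 2) ≤
      M * (4 * A ^ 2 * (1 + |τ|) ^ 2 + 4 * A ^ 2 * (1 + |τ|) ^ 2) := by gcongr
    linarith
  have hspec : ⟪X (auxSig γ p q1 (B i0)), auxSig γ p q1 (B i0)⟫
      + ⟪Y (auxSig γ p q2 (B i0)), auxSig γ p q2 (B i0)⟫ ≤ R - κ * (A / (2 * c0)) ^ 2 := by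
    rw [hBm]
    have h := hXY (auxSig γ p q1 m) (-auxSig γ p q2 m)
    rw [map_neg, inner_neg_neg, norm_neg] at h
    refine h.trans ?_
    set δ := auxSig γ p q1 m - auxSig γ p q2 m with hδ
    have hδn : ‖δ‖ ≤ C1 * (A * D) := hsd m hmn
    have hδs : ‖δ‖ ≤ s := by
      refine hδn.trans (le_trans ?_ hsl)
      rw [le_div_iff₀ (by positivity)]
      calc C1 * (A * D) * (2 * c0) = A * (2 * c0 * C1 * D) := by ring
        _ ≤ A * 1 := by gcongr
        _ = A := mul_one _
    have hd : auxSig γ p q1 m - -auxSig γ p q2 m = (2 * s) • e + δ := by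
      rw [hδ, hsm]; module
    have hn2 : ‖(2 * s) • e + δ‖ ^ 2 = (2 * s) ^ 2 + 2 * (2 * s) * ⟪e, δ⟫ + ‖δ‖ ^ 2 := by
      rw [norm_add_sq_real, norm_smul, ne, real_inner_smul_left, mul_one, Real.norm_eq_abs, sq_abs]
      ring
    have hi2 : ⟪z, (2 * s) • e + δ⟫ = ‖z‖ * (2 * s + ⟪e, δ⟫) := by
      rw [hze, norm_smul, ne, norm_norm, mul_one, real_inner_smul_left, inner_add_right, real_inner_smul_right, real_inner_self_eq_norm_sq,
        ne]
      ring
    rw [hd, hn2, hi2]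
    have hi : -s ≤ ⟪e, δ⟫ := by
      have := (abs_le.mp (abs_real_inner_le_norm e δ)).1
      rw [ne, one_mul] at this
      linarith
    have hsp : 0 < A / (2 * c0) := by positivity
    have hsq : (A / (2 * c0)) ^ 2 ≤ (2 * s + ⟪e, δ⟫) ^ 2 :=
      pow_le_pow_left₀ hsp.le (by linarith) 2
    have t1 := pow_le_pow_left₀ (norm_nonneg _) hδn 2
    have t2 := hsb1 _ hmn
    have t3 := hsb2 _ hmn
    have t5 : a * ‖δ‖ ^ 2 ≤ a * (C1 * (A * D)) ^ 2 := by gcongr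
    have t6 : M * (‖auxSig γ p q1 m‖ ^ 2 + ‖auxSig γ p q2 m‖ ^ 2) ≤
      M * (4 * A ^ 2 * (1 + |τ|) ^ 2 + 4 * A ^ 2 * (1 + |τ|) ^ 2) := by gcongr
    have t7 : κ * (A / (2 * c0)) ^ 2 ≤ κ * (2 * s + ⟪e, δ⟫) ^ 2 := by gcongr
    have t8 : b * (‖z‖ * (2 * s + ⟪e, δ⟫)) ^ 2 = -(a + κ) * (2 * s + ⟪e, δ⟫) ^ 2 := by
      rw [hκe]; ring
    have t9 : 0 ≤ a * ⟪e, δ⟫ ^ 2 := by positivity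
    rw [t8, hR]
    have t10 : a * ((2 * s) ^ 2 + 2 * (2 * s) * ⟪e, δ⟫ + ‖δ‖ ^ 2)
        + -(a + κ) * (2 * s + ⟪e, δ⟫) ^ 2
        = a * ‖δ‖ ^ 2 - κ * (2 * s + ⟪e, δ⟫) ^ 2 - a * ⟪e, δ⟫ ^ 2 := by ring
    linarith
  rw [← aux_sig_sum γ p hp q1 hq1 X hX B, ← aux_sig_sum γ p hp q2 hq2 Y hY B,
    ← Finset.sum_add_distrib, ← Finset.add_sum_erase _ _ (Finset.mem_univ i0)]
  have hR0 : 0 ≤ R := by positivity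
  have hrest : ∑ i ∈ Finset.univ.erase i0, (⟪X (auxSig γ p q1 (B i)), auxSig γ p q1 (B i)⟫
      + ⟪Y (auxSig γ p q2 (B i)), auxSig γ p q2 (B i)⟫) ≤ (n - 1 : ℝ) * R := by
    refine (Finset.sum_le_card_nsmul _ _ R (fun i _ => hgen i)).trans ?_
    rw [Finset.card_erase_of_mem (Finset.mem_univ _), Finset.card_univ, Fintype.card_fin,
      nsmul_eq_mul, Nat.cast_sub hn]
    simp
  refine (add_le_add hspec hrest).trans ?_
  rw [← hAA]
  have f1 : A ^ 2 * (n * C1 ^ 2 * (a * D ^ 2)) ≤ A ^ 2 * (C * (a * D ^ 2)) := by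
    gcongr; linarith
  have f2 : A ^ 2 * (8 * n * (1 + |τ|) ^ 2 * M) ≤ A ^ 2 * (C * M) := by
    gcongr; linarith
  have f3 : A ^ 2 * (κ / C) ≤ A ^ 2 * (κ / (4 * c0 ^ 2)) := by
    gcongr; linarith
  have f4 : κ * (A / (2 * c0)) ^ 2 = A ^ 2 * (κ / (4 * c0 ^ 2)) := by field_simp; ring
  rw [f4, hR]
  have f5 : A ^ 2 * (-κ / C + C * a * D ^ 2 + C * M) = A ^ 2 * (C * (a * D ^ 2)) + A ^ 2 * (C * M)
    - A ^ 2 * (κ / C) := by ring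
  rw [f5]
  linarith

/-- The negative of a supersolution satisfies the subsolution test condition. -/
theorem aux_neg_sub {n : ℕ} (γ p : ℝ) (K : En n) (f w : En n × ℝ → ℝ) (Ω : Set (En n × ℝ))
    (h : IsSupersol γ p f (fun z => w z + ⟪K, z.1⟫) Ω) :
    ∀ z ∈ Ω, ∀ φ : En n × ℝ → ℝ, ContDiff ℝ 2 φ →
      sGrad φ z.1 z.2 ≠ 0 → φ z = -w z + ⟪-K, z.1⟫ →
      (∀ y ∈ Ω, -w y + ⟪-K, y.1⟫ ≤ φ y) →
      deriv (fun s => φ (z.1, s)) z.2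
            - opVal γ p (sGrad φ z.1 z.2) (sHess φ z.1 z.2) ≤ -f z := by
  intro z hz φ hφ hg heq hle
  have eG : ∀ y t, sGrad (fun z => -φ z) y t = - sGrad φ y t := by
    intro y t
    unfold sGrad gradient
    rw [fderiv_fun_neg, map_neg]
  have eH : sHess (fun z => -φ z) z.1 z.2 = - sHess φ z.1 z.2 := by
    unfold sHess
    simp only [eG]
    rw [fderiv_fun_neg]
  have := h.1 z hz (fun z => -φ z) hφ.neg (by rw [eG]; simpa using hg)
    (by simp only [heq, inner_neg_left]; ring)
    (fun y hy => by
      have := hle y hy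
      rw [inner_neg_left] at this
      linarith)
  rw [eG, eH, aux_opVal_neg', deriv.fun_neg] at this
  linarith

open Filter Topology in
/-- Transfer of second-order jets from the sup-convolution to the subsolution. -/
theorem aux_transfer {n : ℕ} (γ p : ℝ) (K : En n) (f u : En n × ℝ → ℝ)
    (hsub : ∀ z ∈ pCyl n 1, ∀ φ : En n × ℝ → ℝ, ContDiff ℝ 2 φ →
      sGrad φ z.1 z.2 ≠ 0 → φ z = u z + ⟪K, z.1⟫ →
      (∀ w ∈ pCyl n 1, u w + ⟪K, w.1⟫ ≤ φ w) →
      deriv (fun s => φ (z.1, s)) z.2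
            - opVal γ p (sGrad φ z.1 z.2) (sHess φ z.1 z.2) ≤ f z)
    (hu : ∀ z ∈ pCyl n 1, |u z| ≤ 1) (hf : ∀ z ∈ pCyl n 1, f z ≤ 1)
    (S : Set (WithLp 2 (En n × ℝ))) (hS : ∀ z ∈ S, (z.fst, z.snd) ∈ pCyl n 1)
    (l : ℝ) (hl : 0 < l) (U : WithLp 2 (En n × ℝ) → ℝ)
    (hU1 : ∀ x, ∃ y ∈ S, U x = u (y.fst, y.snd) - ‖x - y‖ ^ 2 / (2 * l))
    (hU2 : ∀ x, ∀ y ∈ S, u (y.fst, y.snd) - ‖x - y‖ ^ 2 / (2 * l) ≤ U x)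
    (x : WithLp 2 (En n × ℝ)) (hx : x ∈ S)
    (hinS : ∀ y, ‖x - y‖ ^ 2 ≤ 4 * l → S ∈ 𝓝 y)
    (q : WithLp 2 (En n × ℝ)) (D : WithLp 2 (En n × ℝ) →L[ℝ] WithLp 2 (En n × ℝ))
    (hD : ∀ h k, ⟪D h, k⟫ = ⟪h, D k⟫)
    (hjet : ∀ η > (0:ℝ), ∀ᶠ h in 𝓝 (0 : WithLp 2 (En n × ℝ)),
      U (x + h) ≤ U x + ⟪q, h⟫ + 1 / 2 * ⟪D h, h⟫ + η * ‖h‖ ^ 2)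
    (hq : q.fst + K ≠ 0) :
    ∃ X : En n →L[ℝ] En n, (∀ h k, ⟪X h, k⟫ = ⟪h, X k⟫) ∧
      (∀ h, ⟪X h, h⟫ = ⟪D (WithLp.toLp 2 (h, 0)), WithLp.toLp 2 (h, 0)⟫) ∧
      q.snd ≤ 1 + opVal γ p (q.fst + K) X := by
  obtain ⟨y, hyS, hy⟩ := hU1 x
  have hdist : ‖x - y‖ ^ 2 ≤ 4 * l := by
    have h1 := hU2 x x hx
    rw [hy, sub_self] at h1
    have b1 := (abs_le.mp (hu _ (hS _ hx))).1
    have b2 := (abs_le.mp (hu _ (hS _ hyS))).2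
    have : ‖x - y‖ ^ 2 / (2 * l) ≤ 2 := by simp at h1; linarith
    rw [div_le_iff₀ (by positivity)] at this
    linarith
  have hyn : S ∈ 𝓝 y := hinS y hdist
  -- linear maps
  let ι : En n →L[ℝ] WithLp 2 (En n × ℝ) :=
    ((WithLp.prodContinuousLinearEquiv 2 ℝ (En n) ℝ).symm : (En n × ℝ) →L[ℝ] WithLp 2 (En n × ℝ)).comp
      (ContinuousLinearMap.inl ℝ (En n) ℝ)
  have hι : ∀ h, ι h = WithLp.toLp 2 (h, 0) := fun h => rfl
  let pr : WithLp 2 (En n × ℝ) →L[ℝ] En n := (ContinuousLinearMap.fst ℝ (En n) ℝ).comp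
    ((WithLp.prodContinuousLinearEquiv 2 ℝ (En n) ℝ) : WithLp 2 (En n × ℝ) →L[ℝ] (En n × ℝ))
  have hpr : ∀ z, pr z = z.fst := fun z => rfl
  let X : En n →L[ℝ] En n := pr.comp (D.comp ι)
  have hXi : ∀ h k, ⟪X h, k⟫ = ⟪D (ι h), ι k⟫ := by
    intro h k
    change ⟪(D (ι h)).fst, k⟫ = _
    rw [hι k, WithLp.prod_inner_apply]
    simp
  have hXs : ∀ h k, ⟪X h, k⟫ = ⟪h, X k⟫ := by
    intro h k
    rw [hXi, hD, real_inner_comm, ← hXi, real_inner_comm]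
  refine ⟨X, hXs, fun h => hXi h h, ?_⟩
  refine aux_jet γ p K f u hsub hu hf y.fst y.snd (hS y hyS) q.fst q.snd X hXs hq ?_
  intro η hη
  set e : WithLp 2 (En n × ℝ) := WithLp.toLp 2 (0, 1) with he
  set B := ‖D (e)‖ with hB
  refine ⟨1 / 2 * ⟪D e, e⟫ + η / 2 + B ^ 2 / (2 * η), ?_⟩
  have htend : Tendsto (fun h : En n × ℝ => (WithLp.toLp 2 h : WithLp 2 (En n × ℝ))) (𝓝 0) (𝓝 0) := by
    have := (WithLp.prodContinuousLinearEquiv 2 ℝ (En n) ℝ).symm.continuous.tendsto 0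
    rw [map_zero] at this
    exact this
  have htend2 : Tendsto (fun h : En n × ℝ => y + (WithLp.toLp 2 h : WithLp 2 (En n × ℝ))) (𝓝 0) (𝓝 y) := by
    simpa using htend.const_add y
  filter_upwards [htend.eventually (hjet (η / 2) (by positivity)), htend2.eventually hyn] with h h1 h2
  have h3 := hU2 (x + WithLp.toLp 2 h) _ h2
  rw [add_sub_add_right_eq_sub] at h3
  have h4 : u (y.fst + h.1, y.snd + h.2) ≤ u (y.fst, y.snd) + ⟪q, WithLp.toLp 2 h⟫
      + 1 / 2 * ⟪D (WithLp.toLp 2 h), WithLp.toLp 2 h⟫ + η / 2 * ‖(WithLp.toLp 2 h : WithLp 2 (En n × ℝ))‖ ^ 2 := by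
    have : u (y.fst + h.1, y.snd + h.2) - ‖x - y‖ ^ 2 / (2 * l) ≤ U (x + WithLp.toLp 2 h) := h3
    linarith
  have hdec : (WithLp.toLp 2 h : WithLp 2 (En n × ℝ)) = ι h.1 + h.2 • e := by
    rw [hι, he, ← WithLp.toLp_smul, ← WithLp.toLp_add]; simp
  have hnorm : ‖(WithLp.toLp 2 h : WithLp 2 (En n × ℝ))‖ ^ 2 = ‖h.1‖ ^ 2 + h.2 ^ 2 := by
    rw [WithLp.prod_norm_sq_eq_of_L2]; simp
  have hinn : ⟪q, WithLp.toLp 2 h⟫ = ⟪q.fst, h.1⟫ + q.snd * h.2 := by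
    rw [WithLp.prod_inner_apply]; simp [mul_comm]
  have hDD : ⟪D (WithLp.toLp 2 h), WithLp.toLp 2 h⟫ = ⟪X h.1, h.1⟫ + 2 * (h.2 * ⟪D e, ι h.1⟫)
      + h.2 ^ 2 * ⟪D e, e⟫ := by
    rw [hdec, map_add, map_smul, hXi]
    simp only [inner_add_left, inner_add_right, real_inner_smul_left, real_inner_smul_right]
    have : ⟪D (ι h.1), e⟫ = ⟪D e, ι h.1⟫ := by rw [hD, real_inner_comm]
    rw [this]; ring
  have hιn : ‖ι h.1‖ = ‖h.1‖ := by
    have : ‖ι h.1‖ ^ 2 = ‖h.1‖ ^ 2 := by rw [hι, WithLp.prod_norm_sq_eq_of_L2]; simp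
    exact (sq_eq_sq₀ (norm_nonneg _) (norm_nonneg _)).mp this
  have hcross : h.2 * ⟪D e, ι h.1⟫ ≤ η / 2 * ‖h.1‖ ^ 2 + B ^ 2 / (2 * η) * h.2 ^ 2 := by
    have b := abs_real_inner_le_norm (D e) (ι h.1)
    rw [hιn, ← hB] at b
    have : h.2 * ⟪D e, ι h.1⟫ ≤ |h.2| * (B * ‖h.1‖) := by
      calc _ ≤ |h.2 * ⟪D e, ι h.1⟫| := le_abs_self _
        _ = |h.2| * |⟪D e, ι h.1⟫| := abs_mul _ _
        _ ≤ _ := by gcongr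
    refine this.trans ?_
    have e1 : η / 2 * ‖h.1‖ ^ 2 + B ^ 2 / (2 * η) * h.2 ^ 2 - |h.2| * (B * ‖h.1‖)
        = (η * ‖h.1‖ - B * |h.2|) ^ 2 / (2 * η) := by
      rw [← sq_abs h.2]; field_simp; ring
    have e2 : 0 ≤ (η * ‖h.1‖ - B * |h.2|) ^ 2 / (2 * η) := by positivity
    linarith
  rw [hinn, hDD, hnorm] at h4
  have e3 : (1 / 2 * ⟪D e, e⟫ + η / 2 + B ^ 2 / (2 * η)) * h.2 ^ 2 = 1 / 2 * (h.2 ^ 2 * ⟪D e, e⟫)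
    + η / 2 * h.2 ^ 2 + B ^ 2 / (2 * η) * h.2 ^ 2 := by ring
  rw [e3]
  linarith

open Filter Topology in
/-- Second order Taylor expansion in one variable. -/
theorem aux_taylor1 (g g1 : ℝ → ℝ) (g2 x : ℝ) (h1 : ∀ᶠ y in 𝓝 x, HasDerivAt g (g1 y) y)
    (h2 : HasDerivAt g1 g2 x) :
    ∀ η > (0:ℝ), ∀ᶠ s in 𝓝 (0:ℝ), g (x + s) ≤ g x + g1 x * s + 1 / 2 * g2 * s ^ 2 + η * s ^ 2 := by
  intro η hη
  have h3 := (hasDerivAt_iff_isLittleO.mp h2).def hη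
  obtain ⟨δ, hδ, hb⟩ := Metric.eventually_nhds_iff.mp (h1.and h3)
  refine Metric.eventually_nhds_iff.mpr ⟨δ, hδ, fun s hs => ?_⟩
  rw [Real.dist_eq, sub_zero] at hs
  set F : ℝ → ℝ := fun s => g (x + s) - g1 x * s - 1 / 2 * g2 * s ^ 2 with hF
  have hd : ∀ σ ∈ Set.Icc (-|s|) |s|, HasDerivWithinAt F (g1 (x + σ) - g1 x - g2 * σ)
      (Set.Icc (-|s|) |s|) σ := by
    intro σ hσ
    have hσ' : |σ| ≤ |s| := abs_le.mpr hσ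
    have hd := (hb (y := x + σ) (by rw [Real.dist_eq, add_sub_cancel_left]; linarith)).1
    have e1 : HasDerivAt (fun σ => g (x + σ)) (g1 (x + σ)) σ := by
      simpa using hd.comp_const_add x σ
    have e2 := (e1.sub ((hasDerivAt_id σ).const_mul (g1 x))).sub
      (((hasDerivAt_id σ).pow 2).const_mul (1 / 2 * g2))
    refine (e2.congr_deriv ?_).hasDerivWithinAt
    simp; ring
  have hbd : ∀ σ ∈ Set.Icc (-|s|) |s|, ‖g1 (x + σ) - g1 x - g2 * σ‖ ≤ η * |s| := by
    intro σ hσ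
    have hσ' : |σ| ≤ |s| := abs_le.mpr hσ
    have hd := (hb (y := x + σ) (by rw [Real.dist_eq, add_sub_cancel_left]; linarith)).2
    rw [add_sub_cancel_left, smul_eq_mul, mul_comm σ] at hd
    refine hd.trans ?_
    rw [Real.norm_eq_abs]
    gcongr
  have := Convex.norm_image_sub_le_of_norm_hasDerivWithin_le hd hbd (convex_Icc _ _)
    (x := 0) (y := s) (by simp) (by simp [neg_abs_le, le_abs_self])
  simp only [hF] at this
  rw [Real.norm_eq_abs, sub_zero, Real.norm_eq_abs] at this
  have h4 := (abs_le.mp this).2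
  have : η * |s| * |s| = η * s ^ 2 := by rw [← sq_abs s]; ring
  simp at h4
  linarith

open Filter Topology in
/-- Expansion of a radial function. -/
theorem aux_radial {n : ℕ} (g : ℝ → ℝ) (a1 a2 : ℝ) (z : En n)
    (hg : ∀ η > (0:ℝ), ∀ᶠ s in 𝓝 (0:ℝ), g (‖z‖ ^ 2 + s) ≤ g (‖z‖ ^ 2) + a1 * s
      + 1 / 2 * a2 * s ^ 2 + η * s ^ 2) :
    ∀ η > (0:ℝ), ∀ᶠ k in 𝓝 (0:En n), g (‖z + k‖ ^ 2) ≤ g (‖z‖ ^ 2) + 2 * a1 * ⟪z, k⟫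
      + 1 / 2 * (2 * a1 * ‖k‖ ^ 2 + 4 * a2 * ⟪z, k⟫ ^ 2) + η * ‖k‖ ^ 2 := by
  intro η hη
  set c := 2 * ‖z‖ + 1 with hc
  have hc0 : 0 < c := by positivity
  have ht : Tendsto (fun k : En n => 2 * ⟪z, k⟫ + ‖k‖ ^ 2) (𝓝 0) (𝓝 0) := by
    have : Continuous (fun k : En n => 2 * ⟪z, k⟫ + ‖k‖ ^ 2) := by fun_prop
    simpa using this.tendsto 0
  set δ := min 1 (η / 2 / (|a2| * c + 1)) with hδ
  have hδ0 : 0 < δ := by positivity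
  filter_upwards [ht.eventually (hg (η / 2 / c ^ 2) (by positivity)),
    Metric.ball_mem_nhds (0:En n) hδ0] with k h1 h2
  rw [mem_ball_zero_iff] at h2
  have hk1 : ‖k‖ ≤ 1 := (h2.trans_le (min_le_left _ _)).le
  have hk2 : (|a2| * c + 1) * ‖k‖ ≤ η / 2 := by
    have := (h2.trans_le (min_le_right _ _)).le
    rw [le_div_iff₀ (by positivity)] at this
    linarith
  set s := 2 * ⟪z, k⟫ + ‖k‖ ^ 2 with hs
  have e : ‖z + k‖ ^ 2 = ‖z‖ ^ 2 + s := by rw [norm_add_sq_real]; ring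
  rw [e]
  have hi := abs_real_inner_le_norm z k
  have hsb : |s| ≤ c * ‖k‖ := by
    calc |s| ≤ |2 * ⟪z, k⟫| + |‖k‖ ^ 2| := abs_add_le _ _
      _ = 2 * |⟪z, k⟫| + ‖k‖ ^ 2 := by rw [abs_mul, abs_of_nonneg (sq_nonneg ‖k‖)]; norm_num
      _ ≤ 2 * (‖z‖ * ‖k‖) + 1 * ‖k‖ := by
        rw [sq]; gcongr
      _ = _ := by rw [hc]; ring
  have hs2 : s ^ 2 ≤ c ^ 2 * ‖k‖ ^ 2 := by
    rw [← sq_abs, ← mul_pow]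
    exact pow_le_pow_left₀ (abs_nonneg _) hsb 2
  have hs3 : η / 2 / c ^ 2 * s ^ 2 ≤ η / 2 * ‖k‖ ^ 2 := by
    calc _ ≤ η / 2 / c ^ 2 * (c ^ 2 * ‖k‖ ^ 2) := by gcongr
      _ = _ := by field_simp
  have hs4 : 1 / 2 * a2 * s ^ 2 ≤ 1 / 2 * a2 * (4 * ⟪z, k⟫ ^ 2) + η / 2 * ‖k‖ ^ 2 := by
    have e1 : s ^ 2 - 4 * ⟪z, k⟫ ^ 2 = ‖k‖ ^ 2 * (4 * ⟪z, k⟫ + ‖k‖ ^ 2) := by rw [hs]; ring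
    have e2 : |4 * ⟪z, k⟫ + ‖k‖ ^ 2| ≤ 2 * c * ‖k‖ := by
      calc _ ≤ |4 * ⟪z, k⟫| + |‖k‖ ^ 2| := abs_add_le _ _
        _ = 4 * |⟪z, k⟫| + ‖k‖ ^ 2 := by rw [abs_mul, abs_of_nonneg (sq_nonneg ‖k‖)]; norm_num
        _ ≤ 4 * (‖z‖ * ‖k‖) + 1 * ‖k‖ := by
          rw [sq]; gcongr
        _ ≤ _ := by rw [hc]; nlinarith [norm_nonneg k]
    have e3 : 1 / 2 * a2 * (s ^ 2 - 4 * ⟪z, k⟫ ^ 2) ≤ η / 2 * ‖k‖ ^ 2 := by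
      calc _ ≤ |1 / 2 * a2 * (s ^ 2 - 4 * ⟪z, k⟫ ^ 2)| := le_abs_self _
        _ = 1 / 2 * |a2| * (‖k‖ ^ 2 * |4 * ⟪z, k⟫ + ‖k‖ ^ 2|) := by
          rw [e1, abs_mul, abs_mul, abs_mul, abs_of_nonneg (sq_nonneg ‖k‖)]; norm_num
        _ ≤ 1 / 2 * |a2| * (‖k‖ ^ 2 * (2 * c * ‖k‖)) := by gcongr
        _ = (|a2| * c * ‖k‖) * ‖k‖ ^ 2 := by ring
        _ ≤ (η / 2) * ‖k‖ ^ 2 := by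
          gcongr
          nlinarith [norm_nonneg k]
    linarith
  have e5 : a1 * s = 2 * a1 * ⟪z, k⟫ + a1 * ‖k‖ ^ 2 := by rw [hs]; ring
  rw [e5] at h1
  linarith

/-- Existence of the symmetric operator representing a combination of squares. -/
theorem aux_isQ {V F : Type*} [NormedAddCommGroup V] [InnerProductSpace ℝ V]
    [FiniteDimensional ℝ V] [NormedAddCommGroup F] [InnerProductSpace ℝ F]
    [FiniteDimensional ℝ F] (c : ℝ) (ℓ : V →L[ℝ] F) :
    ∃ A : V →L[ℝ] V, (∀ x y, ⟪A x, y⟫ = ⟪x, A y⟫) ∧ ∀ x, ⟪A x, x⟫ = c * ‖ℓ x‖ ^ 2 := by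
  have := FiniteDimensional.complete ℝ V
  have := FiniteDimensional.complete ℝ F
  refine ⟨c • (ContinuousLinearMap.adjoint ℓ).comp ℓ, fun x y => ?_, fun x => ?_⟩
  · simp only [_root_.smul_apply, ContinuousLinearMap.comp_apply, real_inner_smul_left,
      real_inner_smul_right, ContinuousLinearMap.adjoint_inner_left,
      ContinuousLinearMap.adjoint_inner_right]
  · simp only [_root_.smul_apply, ContinuousLinearMap.comp_apply, real_inner_smul_left,
      ContinuousLinearMap.adjoint_inner_left, real_inner_self_eq_norm_sq]

open Filter Topology in
/-- The differential inequality at the doubled maximum point. -/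
theorem aux_point (n : ℕ) (γ p : ℝ) (hγ : γ ∈ Set.Ioo (-1 : ℝ) 0) (hp : 1 < p) :
    ∃ C : ℝ, 1 ≤ C ∧ ∀ (K : En n) (w f : En n × ℝ → ℝ), IsDevSol γ p K f w (pCyl n 1) →
      (∀ z ∈ pCyl n 1, |w z| ≤ 1) → (∀ z ∈ pCyl n 1, |f z| ≤ 1) →
      ∀ (S : Set (WithLp 2 (En n × ℝ))), (∀ z ∈ S, (z.fst, z.snd) ∈ pCyl n 1) →
      ∀ (l : ℝ), 0 < l → ∀ (U V : WithLp 2 (En n × ℝ) → ℝ),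
      ConvexOn ℝ univ (fun z => U z + (1 / l) / 2 * ‖z‖ ^ 2) →
      ConvexOn ℝ univ (fun z => V z + (1 / l) / 2 * ‖z‖ ^ 2) →
      (∀ x, ∃ y ∈ S, U x = w (y.fst, y.snd) - ‖x - y‖ ^ 2 / (2 * l)) →
      (∀ x, ∀ y ∈ S, w (y.fst, y.snd) - ‖x - y‖ ^ 2 / (2 * l) ≤ U x) →
      (∀ x, ∃ y ∈ S, V x = -w (y.fst, y.snd) - ‖x - y‖ ^ 2 / (2 * l)) →
      (∀ x, ∀ y ∈ S, -w (y.fst, y.snd) - ‖x - y‖ ^ 2 / (2 * l) ≤ V x) →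
      ∀ (zh1 zh2 p1 p2 : WithLp 2 (En n × ℝ)) (d : ℝ), 0 < d →
      (∀ x y, ‖x - zh1‖ < d → ‖x - y‖ ^ 2 ≤ 4 * l → S ∈ 𝓝 y) →
      (∀ x y, ‖x - zh2‖ < d → ‖x - y‖ ^ 2 ≤ 4 * l → S ∈ 𝓝 y) →
      ∀ (A : WithLp 2 (WithLp 2 (En n × ℝ) × WithLp 2 (En n × ℝ)) →L[ℝ]
          WithLp 2 (WithLp 2 (En n × ℝ) × WithLp 2 (En n × ℝ))),
      (∀ x y, ⟪A x, y⟫ = ⟪x, A y⟫) →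
      (∀ η > (0:ℝ), ∀ᶠ h in 𝓝 (0:WithLp 2 (WithLp 2 (En n × ℝ) × WithLp 2 (En n × ℝ))),
        U (zh1 + h.fst) + V (zh2 + h.snd) ≤ U zh1 + V zh2 + ⟪p1, h.fst⟫ + ⟪p2, h.snd⟫
        + 1 / 2 * ⟪A h, h⟫ + η * ‖h‖ ^ 2) →
      ∀ (P a b M κ : ℝ) (z : En n), 0 < P → 0 < a → 0 < κ → 0 ≤ M → z ≠ 0 →
      κ = -(a + b * ‖z‖ ^ 2) →
      (∀ h k : En n, ⟪A (WithLp.toLp 2 (WithLp.toLp 2 (h, 0), WithLp.toLp 2 (k, 0))),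
        WithLp.toLp 2 (WithLp.toLp 2 (h, 0), WithLp.toLp 2 (k, 0))⟫
          = a * ‖h - k‖ ^ 2 + b * ⟪z, h - k⟫ ^ 2 + M * ‖h‖ ^ 2) →
      P / 2 < ‖p1.fst + K‖ → ‖p1.fst + K‖ < 2 * P →
      P / 2 < ‖p2.fst - K‖ → ‖p2.fst - K‖ < 2 * P → C * ‖p1.fst + p2.fst‖ < P →
      p1.snd + p2.snd ≤ 2 + P ^ γ * (-κ / C + C * a * (‖p1.fst + p2.fst‖ / P) ^ 2 + C * M) := by
  obtain ⟨C, hC, halg⟩ := aux_algebra n γ p hγ hp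
  refine ⟨C, hC, ?_⟩
  intro K w f hsol hw hf S hS l hl U V hUc hVc hU1 hU2 hV1 hV2 zh1 zh2 p1 p2 d hd hi1 hi2 A hA hmax
    P a b M κ z hP ha hκ hM hz hκe hAs hb1 hb2 hb3 hb4 hb5
  obtain ⟨_, hsup, hsubs⟩ := hsol
  -- the inequality for every small ε
  have key : ∀ᶠ ε in 𝓝[>] (0:ℝ), p1.snd + p2.snd - 2 * ε ≤
      2 + P ^ γ * (-κ / C + C * a * ((‖p1.fst + p2.fst‖ + 2 * ε) / P) ^ 2 + C * (M + ε)) := by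
    have c1 : ∀ᶠ ε in 𝓝[>] (0:ℝ), P / 2 < ‖p1.fst + K‖ - ε := by
      apply Filter.Eventually.filter_mono nhdsWithin_le_nhds
      have : Tendsto (fun ε : ℝ => ‖p1.fst + K‖ - ε) (𝓝 0) (𝓝 (‖p1.fst + K‖ - 0)) :=
        tendsto_const_nhds.sub tendsto_id
      exact this.eventually (lt_mem_nhds (by simpa using hb1))
    have c2 : ∀ᶠ ε in 𝓝[>] (0:ℝ), ‖p1.fst + K‖ + ε < 2 * P := by
      apply Filter.Eventually.filter_mono nhdsWithin_le_nhds
      have : Tendsto (fun ε : ℝ => ‖p1.fst + K‖ + ε) (𝓝 0) (𝓝 (‖p1.fst + K‖ + 0)) :=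
        tendsto_const_nhds.add tendsto_id
      exact this.eventually (gt_mem_nhds (by simpa using hb2))
    have c3 : ∀ᶠ ε in 𝓝[>] (0:ℝ), P / 2 < ‖p2.fst - K‖ - ε := by
      apply Filter.Eventually.filter_mono nhdsWithin_le_nhds
      have : Tendsto (fun ε : ℝ => ‖p2.fst - K‖ - ε) (𝓝 0) (𝓝 (‖p2.fst - K‖ - 0)) :=
        tendsto_const_nhds.sub tendsto_id
      exact this.eventually (lt_mem_nhds (by simpa using hb3))
    have c4 : ∀ᶠ ε in 𝓝[>] (0:ℝ), ‖p2.fst - K‖ + ε < 2 * P := by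
      apply Filter.Eventually.filter_mono nhdsWithin_le_nhds
      have : Tendsto (fun ε : ℝ => ‖p2.fst - K‖ + ε) (𝓝 0) (𝓝 (‖p2.fst - K‖ + 0)) :=
        tendsto_const_nhds.add tendsto_id
      exact this.eventually (gt_mem_nhds (by simpa using hb4))
    have c5 : ∀ᶠ ε in 𝓝[>] (0:ℝ), C * (‖p1.fst + p2.fst‖ + 2 * ε) < P := by
      apply Filter.Eventually.filter_mono nhdsWithin_le_nhds
      have h0 : Continuous (fun ε : ℝ => C * (‖p1.fst + p2.fst‖ + 2 * ε)) := by fun_prop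
      have := h0.tendsto 0
      exact this.eventually (gt_mem_nhds (by simpa using hb5))
    have c6 : ∀ᶠ ε in 𝓝[>] (0:ℝ), ε < d :=
      Filter.Eventually.filter_mono nhdsWithin_le_nhds (gt_mem_nhds hd)
    filter_upwards [c1, c2, c3, c4, c5, c6, self_mem_nhdsWithin] with ε c1 c2 c3 c4 c5 c6 hε
    have hε : 0 < ε := hε
    obtain ⟨x, y, q1, q2, D1, D2, hx, hy, hq1, hq2, hD1, hD2, hle, hj1, hj2⟩ :=
      aux_sums U V (1 / l) (by positivity) hUc hVc zh1 zh2 p1 p2 A hA hmax ε hε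
    have hcomp : ∀ v : WithLp 2 (En n × ℝ), ‖v.fst‖ ≤ ‖v‖ ∧ |v.snd| ≤ ‖v‖ := by
      intro v
      have h := WithLp.prod_norm_sq_eq_of_L2 v
      constructor
      · apply (sq_le_sq₀ (norm_nonneg _) (norm_nonneg _)).mp
        nlinarith [sq_nonneg ‖v.snd‖]
      · rw [← Real.norm_eq_abs]
        apply (sq_le_sq₀ (norm_nonneg _) (norm_nonneg _)).mp
        nlinarith [sq_nonneg ‖v.fst‖]
    have e1 : ‖q1.fst - p1.fst‖ < ε := lt_of_le_of_lt (hcomp (q1 - p1)).1 hq1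
    have e2 : ‖q2.fst - p2.fst‖ < ε := lt_of_le_of_lt (hcomp (q2 - p2)).1 hq2
    have e3 : |q1.snd - p1.snd| < ε := lt_of_le_of_lt (hcomp (q1 - p1)).2 hq1
    have e4 : |q2.snd - p2.snd| < ε := lt_of_le_of_lt (hcomp (q2 - p2)).2 hq2
    have d1 : |‖q1.fst + K‖ - ‖p1.fst + K‖| < ε := by
      refine lt_of_le_of_lt (abs_norm_sub_norm_le _ _) ?_
      rwa [add_sub_add_right_eq_sub]
    have d2 : |‖q2.fst - K‖ - ‖p2.fst - K‖| < ε := by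
      refine lt_of_le_of_lt (abs_norm_sub_norm_le _ _) ?_
      rwa [sub_sub_sub_cancel_right]
    rw [abs_lt] at d1 d2 e3 e4
    have n1 : q1.fst + K ≠ 0 := norm_pos_iff.mp (by linarith [d1.1])
    have n2 : q2.fst + (-K) ≠ 0 := norm_pos_iff.mp (by rw [← sub_eq_add_neg]; linarith [d2.1])
    have hxS : x ∈ S := mem_of_mem_nhds (hi1 x x (hx.trans c6) (by simp; positivity))
    have hyS : y ∈ S := mem_of_mem_nhds (hi2 y y (hy.trans c6) (by simp; positivity))
    obtain ⟨X, hXs, hXq, hX1⟩ := aux_transfer γ p K f w hsubs.1 hw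
      (fun z hz => (abs_le.mp (hf z hz)).2) S hS l hl U hU1 hU2 x hxS
      (fun y' => hi1 x y' (hx.trans c6)) q1 D1 hD1 hj1 n1
    obtain ⟨Y, hYs, hYq, hY1⟩ := aux_transfer γ p (-K) (fun z => -f z) (fun z => -w z)
      (aux_neg_sub γ p K f w _ hsup) (fun z hz => by simpa using hw z hz)
      (fun z hz => by linarith [(abs_le.mp (hf z hz)).1]) S hS l hl V hV1 hV2 y hyS
      (fun y' => hi2 y y' (hy.trans c6)) q2 D2 hD2 hj2 n2
    have hdiff : ‖(q1.fst + K) - (-(q2.fst + -K))‖ ≤ ‖p1.fst + p2.fst‖ + 2 * ε := by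
      have : (q1.fst + K) - (-(q2.fst + -K)) = (p1.fst + p2.fst) + ((q1.fst - p1.fst)
        + (q2.fst - p2.fst)) := by abel
      rw [this]
      have t1 := norm_add_le (p1.fst + p2.fst) ((q1.fst - p1.fst) + (q2.fst - p2.fst))
      have t2 := norm_add_le (q1.fst - p1.fst) (q2.fst - p2.fst)
      linarith
    have hmain := halg P a b (M + ε) κ z (q1.fst + K) (-(q2.fst + -K)) X Y hP ha hκ (by linarith) hz
      hκe hXs hYs (by
        intro h k
        rw [hXq, hYq]
        have t := hle (WithLp.toLp 2 (h, 0)) (WithLp.toLp 2 (k, 0))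
        rw [hAs] at t
        have n1 : ‖(WithLp.toLp 2 (h, (0:ℝ)) : WithLp 2 (En n × ℝ))‖ ^ 2 = ‖h‖ ^ 2 := by
          rw [WithLp.prod_norm_sq_eq_of_L2]; simp
        have n2 : ‖(WithLp.toLp 2 (k, (0:ℝ)) : WithLp 2 (En n × ℝ))‖ ^ 2 = ‖k‖ ^ 2 := by
          rw [WithLp.prod_norm_sq_eq_of_L2]; simp
        rw [n1, n2] at t
        have : 0 ≤ M * ‖k‖ ^ 2 := by positivity
        linarith)
      (by linarith [d1.1]) (by linarith [d1.2])
      (by rw [norm_neg, ← sub_eq_add_neg]; linarith [d2.1])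
      (by rw [norm_neg, ← sub_eq_add_neg]; linarith [d2.2])
      (by
        refine le_trans ?_ c5.le
        gcongr)
    rw [aux_opVal_neg] at hmain
    have hup : P ^ γ * (-κ / C + C * a * (‖(q1.fst + K) - (-(q2.fst + -K))‖ / P) ^ 2 + C * (M + ε))
        ≤ P ^ γ * (-κ / C + C * a * ((‖p1.fst + p2.fst‖ + 2 * ε) / P) ^ 2 + C * (M + ε)) := by
      gcongr
    linarith [e3.1, e4.1]
  have l1 : Tendsto (fun ε : ℝ => p1.snd + p2.snd - 2 * ε) (𝓝[>] 0) (𝓝 (p1.snd + p2.snd)) := by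
    have h0 : Continuous (fun ε : ℝ => p1.snd + p2.snd - 2 * ε) := by fun_prop
    have := (h0.tendsto 0).mono_left (nhdsWithin_le_nhds (s := Set.Ioi 0))
    simpa using this
  have l2 : Tendsto (fun ε : ℝ => 2 + P ^ γ * (-κ / C + C * a * ((‖p1.fst + p2.fst‖ + 2 * ε) / P) ^ 2
      + C * (M + ε))) (𝓝[>] 0)
      (𝓝 (2 + P ^ γ * (-κ / C + C * a * (‖p1.fst + p2.fst‖ / P) ^ 2 + C * M))) := by
    have h0 : Continuous (fun ε : ℝ => 2 + P ^ γ * (-κ / C + C * a *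
      ((‖p1.fst + p2.fst‖ + 2 * ε) / P) ^ 2 + C * (M + ε))) := by fun_prop
    have := (h0.tendsto 0).mono_left (nhdsWithin_le_nhds (s := Set.Ioi 0))
    simpa using this
  exact le_of_tendsto_of_tendsto l1 l2 key

/-- The penalization used in the doubling of variables. -/
def auxPsi {n : ℕ} (g : ℝ → ℝ) (x0 : En n) (t0 M μ N l : ℝ) (z1 z2 : WithLp 2 (En n × ℝ)) : ℝ :=
  g (‖z1.fst - z2.fst‖ ^ 2) + M / 2 * ‖z1.fst - x0‖ ^ 2 + M / 2 * (z1.snd - t0) ^ 2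
    + μ * Real.exp (N * (z1.snd - t0)) + (z1.snd - z2.snd) ^ 2 / (2 * l)

set_option maxHeartbeats 1000000 in
open Filter Topology in
theorem aux_expand {n : ℕ} (g : ℝ → ℝ) (a1 a2 : ℝ) (x0 : En n) (t0 M μ N l : ℝ) (hl : 0 < l)
    (hμ : 0 ≤ μ)
    (U V : WithLp 2 (En n × ℝ) → ℝ) (zh1 zh2 : WithLp 2 (En n × ℝ))
    (hg : ∀ η > (0:ℝ), ∀ᶠ s in 𝓝 (0:ℝ), g (‖zh1.fst - zh2.fst‖ ^ 2 + s) ≤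
      g (‖zh1.fst - zh2.fst‖ ^ 2) + a1 * s + 1 / 2 * a2 * s ^ 2 + η * s ^ 2)
    (hmax : ∀ᶠ h in 𝓝 (0:WithLp 2 (WithLp 2 (En n × ℝ) × WithLp 2 (En n × ℝ))),
      U (zh1 + h.fst) + V (zh2 + h.snd) - auxPsi g x0 t0 M μ N l (zh1 + h.fst) (zh2 + h.snd)
        ≤ U zh1 + V zh2 - auxPsi g x0 t0 M μ N l zh1 zh2) :
    ∃ A : WithLp 2 (WithLp 2 (En n × ℝ) × WithLp 2 (En n × ℝ)) →L[ℝ]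
          WithLp 2 (WithLp 2 (En n × ℝ) × WithLp 2 (En n × ℝ)),
      (∀ x y, ⟪A x, y⟫ = ⟪x, A y⟫) ∧
      (∀ η > (0:ℝ), ∀ᶠ h in 𝓝 (0:WithLp 2 (WithLp 2 (En n × ℝ) × WithLp 2 (En n × ℝ))),
        U (zh1 + h.fst) + V (zh2 + h.snd) ≤ U zh1 + V zh2
        + ⟪(WithLp.toLp 2 ((2 * a1) • (zh1.fst - zh2.fst) + M • (zh1.fst - x0),
            M * (zh1.snd - t0) + μ * Real.exp (N * (zh1.snd - t0)) * N + (zh1.snd - zh2.snd) / l) :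
            WithLp 2 (En n × ℝ)), h.fst⟫
        + ⟪(WithLp.toLp 2 (-((2 * a1) • (zh1.fst - zh2.fst)), -((zh1.snd - zh2.snd) / l)) :
            WithLp 2 (En n × ℝ)), h.snd⟫
        + 1 / 2 * ⟪A h, h⟫ + η * ‖h‖ ^ 2) ∧
      (∀ h k : En n, ⟪A (WithLp.toLp 2 (WithLp.toLp 2 (h, 0), WithLp.toLp 2 (k, 0))),
        WithLp.toLp 2 (WithLp.toLp 2 (h, 0), WithLp.toLp 2 (k, 0))⟫
          = 2 * a1 * ‖h - k‖ ^ 2 + 4 * a2 * ⟪zh1.fst - zh2.fst, h - k⟫ ^ 2 + M * ‖h‖ ^ 2) := by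
  set z := zh1.fst - zh2.fst with hz
  set E := Real.exp (N * (zh1.snd - t0)) with hE
  have hE0 : 0 < E := Real.exp_pos _
  let F1 := WithLp.fstL 2 ℝ (WithLp 2 (En n × ℝ)) (WithLp 2 (En n × ℝ))
  let F2 := WithLp.sndL 2 ℝ (WithLp 2 (En n × ℝ)) (WithLp 2 (En n × ℝ))
  let fs := WithLp.fstL 2 ℝ (En n) ℝ
  let sn := WithLp.sndL 2 ℝ (En n) ℝ
  obtain ⟨A1, s1, q1⟩ := aux_isQ (2 * a1) (fs.comp F1 - fs.comp F2)
  obtain ⟨A2, s2, q2⟩ := aux_isQ (4 * a2) ((innerSL ℝ z).comp (fs.comp F1 - fs.comp F2))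
  obtain ⟨A3, s3, q3⟩ := aux_isQ M (fs.comp F1)
  obtain ⟨A4, s4, q4⟩ := aux_isQ (M + 2 * μ * E * N ^ 2) (sn.comp F1)
  obtain ⟨A5, s5, q5⟩ := aux_isQ (1 / l) (sn.comp F1 - sn.comp F2)
  have hq : ∀ h, ⟪(A1 + A2 + A3 + A4 + A5) h, h⟫ = 2 * a1 * ‖h.fst.fst - h.snd.fst‖ ^ 2
      + 4 * a2 * ⟪z, h.fst.fst - h.snd.fst⟫ ^ 2 + M * ‖h.fst.fst‖ ^ 2
      + (M + 2 * μ * E * N ^ 2) * h.fst.snd ^ 2 + 1 / l * (h.fst.snd - h.snd.snd) ^ 2 := by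
    intro h
    simp only [_root_.add_apply, inner_add_left, q1, q2, q3, q4, q5]
    congr 1
    · congr 1
      · congr 2
        rw [Real.norm_eq_abs, sq_abs]; rfl
      · congr 1
        rw [Real.norm_eq_abs, sq_abs]; rfl
    · rw [Real.norm_eq_abs, sq_abs]; rfl
  refine ⟨A1 + A2 + A3 + A4 + A5, ?_, ?_, ?_⟩
  · intro x y
    simp only [_root_.add_apply, inner_add_left, inner_add_right, s1, s2, s3, s4, s5]
  · intro η hη
    have hr := aux_radial g a1 a2 z hg (η / 2) (by positivity)
    have ht : Tendsto (fun h : WithLp 2 (WithLp 2 (En n × ℝ) × WithLp 2 (En n × ℝ)) =>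
        (fs.comp F1 - fs.comp F2) h) (𝓝 0) (𝓝 0) := by
      have := (fs.comp F1 - fs.comp F2).continuous.tendsto 0
      rwa [map_zero] at this
    have ht2 : Tendsto (fun h : WithLp 2 (WithLp 2 (En n × ℝ) × WithLp 2 (En n × ℝ)) =>
        |N * (sn.comp F1) h|) (𝓝 0) (𝓝 0) := by
      have h0 : Continuous (fun h : WithLp 2 (WithLp 2 (En n × ℝ) × WithLp 2 (En n × ℝ)) =>
        |N * (sn.comp F1) h|) := by fun_prop
      have := h0.tendsto 0
      simpa using this
    filter_upwards [hmax, ht.eventually hr, ht2.eventually (gt_mem_nhds one_pos)] with h h1 h2 h3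
    have h3 : |N * h.fst.snd| < 1 := h3
    have h2 : g (‖z + (h.fst.fst - h.snd.fst)‖ ^ 2) ≤ g (‖z‖ ^ 2)
      + 2 * a1 * ⟪z, h.fst.fst - h.snd.fst⟫
      + 1 / 2 * (2 * a1 * ‖h.fst.fst - h.snd.fst‖ ^ 2 + 4 * a2 * ⟪z, h.fst.fst - h.snd.fst⟫ ^ 2)
      + η / 2 * ‖h.fst.fst - h.snd.fst‖ ^ 2 := h2
    rw [hq]
    have hexp : Real.exp (N * h.fst.snd) ≤ 1 + N * h.fst.snd + (N * h.fst.snd) ^ 2 := by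
      have := (abs_le.mp (Real.abs_exp_sub_one_sub_id_le h3.le)).2
      linarith
    have hpsi : auxPsi g x0 t0 M μ N l (zh1 + h.fst) (zh2 + h.snd) =
        g (‖z + (h.fst.fst - h.snd.fst)‖ ^ 2) + M / 2 * ‖(zh1.fst - x0) + h.fst.fst‖ ^ 2
        + M / 2 * ((zh1.snd - t0) + h.fst.snd) ^ 2 + μ * (E * Real.exp (N * h.fst.snd))
        + ((zh1.snd - zh2.snd) + (h.fst.snd - h.snd.snd)) ^ 2 / (2 * l) := by
      unfold auxPsi
      rw [hE, ← Real.exp_add]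
      simp only [WithLp.add_fst, WithLp.add_snd]
      rw [hz]
      congr 2
      · congr 1
        · congr 1
          · congr 3
            abel
          · congr 3
            abel
        · congr 2
          ring
      · congr 1
        ring_nf
      · ring
    have hn : ‖h.fst.fst - h.snd.fst‖ ^ 2 ≤ 2 * ‖h‖ ^ 2 := by
      have e1 := WithLp.prod_norm_sq_eq_of_L2 h
      have e2 := WithLp.prod_norm_sq_eq_of_L2 h.fst
      have e3 := WithLp.prod_norm_sq_eq_of_L2 h.snd
      have e4 := norm_sub_sq_real h.fst.fst h.snd.fst
      have e5 := norm_add_sq_real h.fst.fst h.snd.fst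
      nlinarith [sq_nonneg ‖h.fst.fst + h.snd.fst‖, sq_nonneg ‖h.fst.snd‖, sq_nonneg ‖h.snd.snd‖]
    have hi1 : ⟪(WithLp.toLp 2 ((2 * a1) • z + M • (zh1.fst - x0),
            M * (zh1.snd - t0) + μ * E * N + (zh1.snd - zh2.snd) / l) :
            WithLp 2 (En n × ℝ)), h.fst⟫ = 2 * a1 * ⟪z, h.fst.fst⟫ + M * ⟪zh1.fst - x0, h.fst.fst⟫
            + (M * (zh1.snd - t0) + μ * E * N + (zh1.snd - zh2.snd) / l) * h.fst.snd := by
      rw [WithLp.prod_inner_apply]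
      change ⟪(2 * a1) • z + M • (zh1.fst - x0), h.fst.fst⟫ + ⟪M * (zh1.snd - t0) + μ * E * N
        + (zh1.snd - zh2.snd) / l, h.fst.snd⟫ = _
      rw [inner_add_left, real_inner_smul_left, real_inner_smul_left]
      rw [RCLike.inner_apply, conj_trivial]
      ring
    have hi2 : ⟪(WithLp.toLp 2 (-((2 * a1) • z), -((zh1.snd - zh2.snd) / l)) :
            WithLp 2 (En n × ℝ)), h.snd⟫ = - (2 * a1 * ⟪z, h.snd.fst⟫)
            - ((zh1.snd - zh2.snd) / l) * h.snd.snd := by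
      rw [WithLp.prod_inner_apply]
      simp only [inner_neg_left, real_inner_smul_left]
      simp [mul_comm]
      ring
    rw [hi1, hi2]
    rw [hpsi] at h1
    have hpsi0 : auxPsi g x0 t0 M μ N l zh1 zh2 = g (‖z‖ ^ 2) + M / 2 * ‖zh1.fst - x0‖ ^ 2
      + M / 2 * (zh1.snd - t0) ^ 2 + μ * E + (zh1.snd - zh2.snd) ^ 2 / (2 * l) := rfl
    rw [hpsi0, norm_add_sq_real (zh1.fst - x0)] at h1
    have hμE : μ * (E * Real.exp (N * h.fst.snd)) ≤
        μ * (E * (1 + N * h.fst.snd + (N * h.fst.snd) ^ 2)) := by gcongr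
    have hl2 : ((zh1.snd - zh2.snd) + (h.fst.snd - h.snd.snd)) ^ 2 / (2 * l)
        = (zh1.snd - zh2.snd) ^ 2 / (2 * l) + (zh1.snd - zh2.snd) / l * (h.fst.snd - h.snd.snd)
          + 1 / 2 * (1 / l * (h.fst.snd - h.snd.snd) ^ 2) := by field_simp; ring
    rw [hl2] at h1
    have hη2 : η / 2 * ‖h.fst.fst - h.snd.fst‖ ^ 2 ≤ η * ‖h‖ ^ 2 := by
      calc _ ≤ η / 2 * (2 * ‖h‖ ^ 2) := by gcongr
        _ = _ := by ring
    have hzz : ⟪z, h.fst.fst - h.snd.fst⟫ = ⟪z, h.fst.fst⟫ - ⟪z, h.snd.fst⟫ := inner_sub_right _ _ _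
    rw [hzz] at h2
    rw [hzz]
    linarith
  · intro h k
    rw [hq]
    simp

theorem aux_fst_le {n : ℕ} (z : WithLp 2 (En n × ℝ)) : ‖z.fst‖ ≤ ‖z‖ := by
  have e1 := WithLp.prod_norm_sq_eq_of_L2 z
  nlinarith [sq_nonneg ‖z.snd‖, norm_nonneg z, norm_nonneg z.fst]

theorem aux_snd_le {n : ℕ} (z : WithLp 2 (En n × ℝ)) : |z.snd| ≤ ‖z‖ := by
  have e1 := WithLp.prod_norm_sq_eq_of_L2 z
  have : |z.snd| = ‖z.snd‖ := (Real.norm_eq_abs _).symm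
  rw [this]
  nlinarith [sq_nonneg ‖z.fst‖, norm_nonneg z, norm_nonneg z.snd]

theorem aux_cont_fst {n : ℕ} : Continuous (fun z : WithLp 2 (En n × ℝ) => z.fst) :=
  (WithLp.fstL 2 ℝ (En n) ℝ).continuous

theorem aux_cont_snd {n : ℕ} : Continuous (fun z : WithLp 2 (En n × ℝ) => z.snd) :=
  (WithLp.sndL 2 ℝ (En n) ℝ).continuous

/-- The compact space-time set used in the doubling argument. -/
def auxS (n : ℕ) (t0 : ℝ) : Set (WithLp 2 (En n × ℝ)) :=
  {z | ‖z.fst‖ ≤ 63 / 64 ∧ -(63 / 64) ≤ z.snd ∧ z.snd ≤ t0 / 8}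

theorem auxS_compact (n : ℕ) (t0 : ℝ) (ht0 : t0 < 0) : IsCompact (auxS n t0) := by
  have : ProperSpace (WithLp 2 (En n × ℝ)) := FiniteDimensional.proper ℝ _
  apply Metric.isCompact_of_isClosed_isBounded
  · have h1 : IsClosed {z : WithLp 2 (En n × ℝ) | ‖z.fst‖ ≤ 63 / 64} :=
      isClosed_le aux_cont_fst.norm continuous_const
    have h2 : IsClosed {z : WithLp 2 (En n × ℝ) | -(63 / 64) ≤ z.snd} :=
      isClosed_le continuous_const aux_cont_snd
    have h3 : IsClosed {z : WithLp 2 (En n × ℝ) | z.snd ≤ t0 / 8} :=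
      isClosed_le aux_cont_snd continuous_const
    exact h1.inter (h2.inter h3)
  · refine (Metric.isBounded_closedBall (x := (0 : WithLp 2 (En n × ℝ))) (r := 2)).subset ?_
    rintro z ⟨h1, h2, h3⟩
    rw [mem_closedBall_zero_iff]
    have e1 := WithLp.prod_norm_sq_eq_of_L2 z
    rw [Real.norm_eq_abs, sq_abs] at e1
    nlinarith [norm_nonneg z, norm_nonneg z.fst]

open Topology in
theorem auxS_nhds {n : ℕ} {t0 : ℝ} (z : WithLp 2 (En n × ℝ)) (h1 : ‖z.fst‖ < 63 / 64)
    (h2 : -(63 / 64) < z.snd) (h3 : z.snd < t0 / 8) : auxS n t0 ∈ 𝓝 z := by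
  have h1' : IsOpen {z : WithLp 2 (En n × ℝ) | ‖z.fst‖ < 63 / 64} :=
    isOpen_lt aux_cont_fst.norm continuous_const
  have h2' : IsOpen {z : WithLp 2 (En n × ℝ) | -(63 / 64) < z.snd} :=
    isOpen_lt continuous_const aux_cont_snd
  have h3' : IsOpen {z : WithLp 2 (En n × ℝ) | z.snd < t0 / 8} :=
    isOpen_lt aux_cont_snd continuous_const
  refine Filter.mem_of_superset ((h1'.inter (h2'.inter h3')).mem_nhds ⟨h1, h2, h3⟩) ?_
  rintro y ⟨a, b, c⟩
  exact ⟨le_of_lt a, le_of_lt b, le_of_lt c⟩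

open Topology in
theorem auxS_nhds' {n : ℕ} {t0 m : ℝ} (hm : m ≤ 1 / 256) (hm2 : m ≤ -t0 / 16)
    (zh : WithLp 2 (En n × ℝ)) (h1 : ‖zh.fst‖ ≤ 62 / 64)
    (h2 : -(31 / 32) ≤ zh.snd) (h3 : zh.snd ≤ 7 * t0 / 16) (ht0 : t0 < 0)
    (x y : WithLp 2 (En n × ℝ)) (hx : ‖x - zh‖ < m) (hy : ‖x - y‖ ≤ m) :
    auxS n t0 ∈ 𝓝 y := by
  have h4 : ‖y - zh‖ < 2 * m := by
    have : y - zh = (x - zh) - (x - y) := by abel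
    rw [this]
    have := norm_sub_le (x - zh) (x - y)
    linarith
  have h5 := aux_fst_le (y - zh)
  have h6 := aux_snd_le (y - zh)
  rw [WithLp.sub_fst] at h5
  rw [WithLp.sub_snd] at h6
  have h7 := abs_le.mp h6
  have h8 : ‖y.fst‖ ≤ ‖y.fst - zh.fst‖ + ‖zh.fst‖ := by
    have := norm_add_le (y.fst - zh.fst) zh.fst
    rwa [sub_add_cancel] at this
  apply auxS_nhds
  · linarith
  · linarith
  · linarith

theorem aux_semi_cont {n : ℕ} (U : WithLp 2 (En n × ℝ) → ℝ) (c : ℝ)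
    (hU : ConvexOn ℝ univ (fun z => U z + c * ‖z‖ ^ 2)) : Continuous U := by
  have h1 := ConvexOn.continuousOn isOpen_univ hU
  rw [continuousOn_univ] at h1
  have h2 : Continuous (fun z : WithLp 2 (En n × ℝ) => c * ‖z‖ ^ 2) := by fun_prop
  have e : (fun z => (U z + c * ‖z‖ ^ 2) - c * ‖z‖ ^ 2) = U := by
    funext z
    ring
  rw [← e]
  exact h1.sub h2

/-- Closeness of the sup-convolution to the function. -/
theorem aux_close {n : ℕ} (v : WithLp 2 (En n × ℝ) → ℝ) (S : Set (WithLp 2 (En n × ℝ)))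
    (hv : ∀ z ∈ S, |v z| ≤ 1) (l m ε : ℝ) (hl : 0 < l) (hm : 0 ≤ m) (hlm : 4 * l = m ^ 2)
    (huc : ∀ x ∈ S, ∀ y ∈ S, ‖x - y‖ ≤ m → |v x - v y| ≤ ε)
    (U : WithLp 2 (En n × ℝ) → ℝ)
    (hU1 : ∀ x, ∃ y ∈ S, U x = v y - ‖x - y‖ ^ 2 / (2 * l))
    (hU2 : ∀ x, ∀ y ∈ S, v y - ‖x - y‖ ^ 2 / (2 * l) ≤ U x) (z : WithLp 2 (En n × ℝ))
    (hz : z ∈ S) : U z ≤ v z + ε ∧ v z ≤ U z ∧ U z ≤ 1 := by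
  obtain ⟨y, hy, h1⟩ := hU1 z
  have h2 := hU2 z z hz
  have h3 : ‖z - z‖ ^ 2 / (2 * l) = 0 := by simp
  have h4 : 0 ≤ ‖z - y‖ ^ 2 / (2 * l) := by positivity
  have h5 := abs_le.mp (hv y hy)
  have h6 := abs_le.mp (hv z hz)
  have h7 : ‖z - y‖ ^ 2 / (2 * l) ≤ 2 := by linarith
  rw [div_le_iff₀ (by positivity)] at h7
  have h8 : ‖z - y‖ ≤ m := by
    refine (sq_le_sq₀ (norm_nonneg _) hm).mp ?_
    linarith
  have h9 := abs_le.mp (huc z hz y hy h8)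
  refine ⟨?_, ?_, ?_⟩ <;> linarith

set_option maxHeartbeats 1000000 in
open Filter Topology in
theorem aux_loc {n : ℕ} (w : En n × ℝ → ℝ) (hc : ContinuousOn w (pCyl n 1))
    (hw : ∀ z ∈ pCyl n 1, |w z| ≤ 1) (g : ℝ → ℝ) (hgc : Continuous g)
    (hg0 : ∀ ρ, 0 ≤ ρ → ρ ≤ 4 → 0 ≤ g ρ)
    (hg2 : ∀ ρ, (1 / 64) ^ 2 ≤ ρ → ρ ≤ 4 → 2 ≤ g ρ) (x0 y0 : En n) (t0 : ℝ)
    (hx0 : (x0, t0) ∈ pCyl n (15 / 16)) (hy0 : (y0, t0) ∈ pCyl n (15 / 16))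
    (hgt : g (‖x0 - y0‖ ^ 2) < w (x0, t0) - w (y0, t0)) :
    ∃ (S : Set (WithLp 2 (En n × ℝ))) (l μ N d : ℝ) (U V : WithLp 2 (En n × ℝ) → ℝ)
      (zh1 zh2 : WithLp 2 (En n × ℝ)),
      (∀ z ∈ S, (z.fst, z.snd) ∈ pCyl n 1) ∧ 0 < l ∧ 0 ≤ μ ∧ 0 ≤ N ∧ 0 < d ∧
      ConvexOn ℝ univ (fun z => U z + (1 / l) / 2 * ‖z‖ ^ 2) ∧
      ConvexOn ℝ univ (fun z => V z + (1 / l) / 2 * ‖z‖ ^ 2) ∧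
      (∀ x, ∃ y ∈ S, U x = w (y.fst, y.snd) - ‖x - y‖ ^ 2 / (2 * l)) ∧
      (∀ x, ∀ y ∈ S, w (y.fst, y.snd) - ‖x - y‖ ^ 2 / (2 * l) ≤ U x) ∧
      (∀ x, ∃ y ∈ S, V x = -w (y.fst, y.snd) - ‖x - y‖ ^ 2 / (2 * l)) ∧
      (∀ x, ∀ y ∈ S, -w (y.fst, y.snd) - ‖x - y‖ ^ 2 / (2 * l) ≤ V x) ∧
      (∀ x y, ‖x - zh1‖ < d → ‖x - y‖ ^ 2 ≤ 4 * l → S ∈ 𝓝 y) ∧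
      (∀ x y, ‖x - zh2‖ < d → ‖x - y‖ ^ 2 ≤ 4 * l → S ∈ 𝓝 y) ∧
      (∀ᶠ h in 𝓝 (0:WithLp 2 (WithLp 2 (En n × ℝ) × WithLp 2 (En n × ℝ))),
        U (zh1 + h.fst) + V (zh2 + h.snd)
          - auxPsi g x0 t0 16384 μ N l (zh1 + h.fst) (zh2 + h.snd)
        ≤ U zh1 + V zh2 - auxPsi g x0 t0 16384 μ N l zh1 zh2) ∧
      ‖zh1.fst - x0‖ < 1 / 64 ∧ |zh1.snd - t0| < 1 / 64 ∧ zh1.snd < 0 ∧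
      ‖zh1.fst - zh2.fst‖ < 1 / 64 ∧
      8192 * ‖zh1.fst - x0‖ ^ 2 < w (zh1.fst, zh1.snd) - w (zh2.fst, zh1.snd) := by
  obtain ⟨hx0n, ht0a, ht0⟩ := hx0
  obtain ⟨hy0n, -, -⟩ := hy0
  simp only at hx0n hy0n ht0a ht0
  set θ := w (x0, t0) - w (y0, t0) - g (‖x0 - y0‖ ^ 2) with hθ
  have hθ0 : 0 < θ := by linarith
  set μ := θ / 4 with hμ
  have hμ0 : 0 < μ := by positivity
  set N := 4 / (μ * (-t0)) with hN
  have hN0 : 0 < N := by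
    have : 0 < -t0 := by linarith
    positivity
  set S := auxS n t0 with hS
  have hSc : IsCompact S := auxS_compact n t0 ht0
  have hSQ : ∀ z ∈ S, (z.fst, z.snd) ∈ pCyl n 1 := by
    rintro z ⟨h1, h2, h3⟩
    refine ⟨?_, ?_, ?_⟩
    · change ‖z.fst‖ < 1; linarith
    · change -1 ^ 2 < z.snd; norm_num; linarith
    · change z.snd < 0; linarith
  set v : WithLp 2 (En n × ℝ) → ℝ := fun z => w (z.fst, z.snd) with hv
  have hvc : ContinuousOn v S := by
    apply ContinuousOn.comp hc
    · exact (aux_cont_fst.prodMk aux_cont_snd).continuousOn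
    · exact hSQ
  have hv1 : ∀ z ∈ S, |v z| ≤ 1 := fun z hz => hw _ (hSQ z hz)
  have huc := hSc.uniformContinuousOn_of_continuous hvc
  rw [Metric.uniformContinuousOn_iff] at huc
  obtain ⟨δ, hδ, huc⟩ := huc (θ / 8) (by positivity)
  set m := min (min (1 / 256) (-t0 / 16)) (δ / 2) with hm
  have hm0 : 0 < m := by
    rw [hm]
    refine lt_min (lt_min (by norm_num) ?_) (by positivity)
    linarith
  have hm1 : m ≤ 1 / 256 := (min_le_left _ _).trans (min_le_left _ _)
  have hm2 : m ≤ -t0 / 16 := (min_le_left _ _).trans (min_le_right _ _)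
  have hm3 : m < δ := lt_of_le_of_lt (min_le_right _ _) (by linarith)
  have huc' : ∀ x ∈ S, ∀ y ∈ S, ‖x - y‖ ≤ m → |v x - v y| ≤ θ / 8 := by
    intro x hx y hy hxy
    have := huc x hx y hy (by rw [dist_eq_norm]; linarith)
    rw [Real.dist_eq] at this
    exact this.le
  set l := m ^ 2 / 4 with hl
  have hl0 : 0 < l := by positivity
  have hlm : 4 * l = m ^ 2 := by rw [hl]; ring
  set z0 : WithLp 2 (En n × ℝ) := WithLp.toLp 2 (x0, t0) with hz0
  set z0' : WithLp 2 (En n × ℝ) := WithLp.toLp 2 (y0, t0) with hz0'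
  have hz0S : z0 ∈ S := by
    refine ⟨?_, ?_, ?_⟩
    · change ‖x0‖ ≤ _; linarith
    · change _ ≤ t0; norm_num at ht0a ⊢; linarith
    · change t0 ≤ _; linarith
  have hz0'S : z0' ∈ S := by
    refine ⟨?_, ?_, ?_⟩
    · change ‖y0‖ ≤ _; linarith
    · change _ ≤ t0; norm_num at ht0a ⊢; linarith
    · change t0 ≤ _; linarith
  obtain ⟨U, hUc, hU1, hU2⟩ := aux_supconv v S hSc ⟨z0, hz0S⟩ hvc l hl0
  obtain ⟨V, hVc, hV1, hV2⟩ := aux_supconv (fun z => - v z) S hSc ⟨z0, hz0S⟩ hvc.neg l hl0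
  have hUcont := aux_semi_cont U _ hUc
  have hVcont := aux_semi_cont V _ hVc
  have hUcl := aux_close v S hv1 l m (θ / 8) hl0 hm0.le hlm huc' U hU1 hU2
  have hVcl := aux_close (fun z => - v z) S (fun z hz => by simpa using hv1 z hz) l m (θ / 8) hl0
    hm0.le hlm (fun x hx y hy hxy => by
      have := huc' y hy x hx (by rwa [norm_sub_rev])
      rwa [show - v x - - v y = v y - v x by ring]) V hV1 hV2
  have hΨc : Continuous (fun q : WithLp 2 (En n × ℝ) × WithLp 2 (En n × ℝ) =>
      U q.1 + V q.2 - auxPsi g x0 t0 16384 μ N l q.1 q.2) := by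
    have a1 : Continuous (fun q : WithLp 2 (En n × ℝ) × WithLp 2 (En n × ℝ) => q.1.fst) :=
      aux_cont_fst.comp continuous_fst
    have a2 : Continuous (fun q : WithLp 2 (En n × ℝ) × WithLp 2 (En n × ℝ) => q.2.fst) :=
      aux_cont_fst.comp continuous_snd
    have a3 : Continuous (fun q : WithLp 2 (En n × ℝ) × WithLp 2 (En n × ℝ) => q.1.snd) :=
      aux_cont_snd.comp continuous_fst
    have a4 : Continuous (fun q : WithLp 2 (En n × ℝ) × WithLp 2 (En n × ℝ) => q.2.snd) :=
      aux_cont_snd.comp continuous_snd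
    unfold auxPsi
    fun_prop
  obtain ⟨⟨zh1, zh2⟩, ⟨hzh1, hzh2⟩, hmax⟩ := (hSc.prod hSc).exists_isMaxOn
    ⟨(z0, z0'), hz0S, hz0'S⟩ hΨc.continuousOn
  simp only at hzh1 hzh2
  have hmax' : ∀ a ∈ S, ∀ b ∈ S, U a + V b - auxPsi g x0 t0 16384 μ N l a b ≤
      U zh1 + V zh2 - auxPsi g x0 t0 16384 μ N l zh1 zh2 := by
    intro a ha b hb
    exact hmax (show (a, b) ∈ S ×ˢ S from ⟨ha, hb⟩)
  have hval := hmax' z0 hz0S z0' hz0'S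
  have hΨ0 : auxPsi g x0 t0 16384 μ N l z0 z0' = g (‖x0 - y0‖ ^ 2) + μ := by
    simp [auxPsi, hz0, hz0']
  have hv0 : v z0 = w (x0, t0) := rfl
  have hv0' : v z0' = w (y0, t0) := rfl
  have b1 := (hUcl z0 hz0S).2.1
  have b2 := (hVcl z0' hz0'S).2.1
  have b3 := hUcl zh1 hzh1
  have b4 := hVcl zh2 hzh2
  have hlow : 3 * θ / 4 ≤ U zh1 + V zh2 - auxPsi g x0 t0 16384 μ N l zh1 zh2 := by
    rw [hΨ0] at hval
    linarith
  have hΨ2 : auxPsi g x0 t0 16384 μ N l zh1 zh2 < 2 := by linarith [b3.2.2, b4.2.2]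
  obtain ⟨c1, c2, c3⟩ := hzh1
  obtain ⟨e1, e2, e3⟩ := hzh2
  have hxy2 : ‖zh1.fst - zh2.fst‖ ≤ 2 := by
    have := norm_sub_le zh1.fst zh2.fst
    linarith
  have hxy4 : ‖zh1.fst - zh2.fst‖ ^ 2 ≤ 4 := by nlinarith [norm_nonneg (zh1.fst - zh2.fst)]
  have hΨe : auxPsi g x0 t0 16384 μ N l zh1 zh2 = g (‖zh1.fst - zh2.fst‖ ^ 2)
    + 16384 / 2 * ‖zh1.fst - x0‖ ^ 2 + 16384 / 2 * (zh1.snd - t0) ^ 2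
    + μ * Real.exp (N * (zh1.snd - t0)) + (zh1.snd - zh2.snd) ^ 2 / (2 * l) := rfl
  have T1 := hg0 (‖zh1.fst - zh2.fst‖ ^ 2) (by positivity) hxy4
  have T2 : 0 ≤ ‖zh1.fst - x0‖ ^ 2 := by positivity
  have T3 : 0 ≤ (zh1.snd - t0) ^ 2 := by positivity
  have T4 : 0 < μ * Real.exp (N * (zh1.snd - t0)) := by positivity
  have T5 : 0 ≤ (zh1.snd - zh2.snd) ^ 2 / (2 * l) := by positivity
  have r1 : ‖zh1.fst - x0‖ < 1 / 64 := by nlinarith [norm_nonneg (zh1.fst - x0)]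
  have r2 : |zh1.snd - t0| < 1 / 64 := by
    apply abs_lt_of_sq_lt_sq _ (by norm_num)
    linarith
  have r3 : ‖zh1.fst - zh2.fst‖ < 1 / 64 := by
    by_contra hcon
    push Not at hcon
    have := hg2 (‖zh1.fst - zh2.fst‖ ^ 2) (by gcongr) hxy4
    linarith
  have r4 : zh1.snd < t0 / 2 := by
    by_contra hcon
    push Not at hcon
    have k1 : 2 / μ ≤ N * (zh1.snd - t0) := by
      have k2 : 2 / μ = N * (-t0 / 2) := by
        have ht0n : t0 ≠ 0 := ht0.ne
        rw [hN]
        field_simp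
        norm_num
      rw [k2]
      gcongr
      linarith
    have k3 := Real.add_one_le_exp (N * (zh1.snd - t0))
    have k4 : μ * (2 / μ + 1) ≤ μ * Real.exp (N * (zh1.snd - t0)) := by
      gcongr
      linarith
    have k5 : μ * (2 / μ + 1) = 2 + μ := by field_simp
    linarith
  have r5 : |zh1.snd - zh2.snd| ≤ m := by
    have : (zh1.snd - zh2.snd) ^ 2 / (2 * l) ≤ 2 := by linarith
    rw [div_le_iff₀ (by positivity)] at this
    apply abs_le_of_sq_le_sq _ hm0.le
    linarith
  have r2' := abs_lt.mp r2
  have r5' := abs_le.mp r5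
  norm_num at ht0a
  have hn1 : ‖zh1.fst‖ < 61 / 64 := by
    have := norm_add_le (zh1.fst - x0) x0
    rw [sub_add_cancel] at this
    linarith
  have hn2 : ‖zh2.fst‖ < 62 / 64 := by
    have := norm_sub_le zh1.fst (zh1.fst - zh2.fst)
    rw [sub_sub_cancel] at this
    linarith
  have sq_m : ∀ x y : WithLp 2 (En n × ℝ), ‖x - y‖ ^ 2 ≤ 4 * l → ‖x - y‖ ≤ m := by
    intro x y hxy
    refine (sq_le_sq₀ (norm_nonneg _) hm0.le).mp ?_
    linarith
  have N1 : ∀ x y, ‖x - zh1‖ < m → ‖x - y‖ ^ 2 ≤ 4 * l → S ∈ 𝓝 y := fun x y hx hy =>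
    auxS_nhds' hm1 hm2 zh1 (by linarith) (by linarith) (by linarith) ht0 x y hx (sq_m x y hy)
  have N2 : ∀ x y, ‖x - zh2‖ < m → ‖x - y‖ ^ 2 ≤ 4 * l → S ∈ 𝓝 y := fun x y hx hy =>
    auxS_nhds' hm1 hm2 zh2 (by linarith) (by linarith) (by linarith) ht0 x y hx (sq_m x y hy)
  refine ⟨S, l, μ, N, m, U, V, zh1, zh2, hSQ, hl0, hμ0.le, hN0.le, hm0, hUc, hVc, hU1, hU2, hV1,
    hV2, N1, N2, ?_, r1, r2, by linarith, r3, ?_⟩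
  · have s1 : S ∈ 𝓝 zh1 := N1 zh1 zh1 (by simpa using hm0) (by simp; positivity)
    have s2 : S ∈ 𝓝 zh2 := N2 zh2 zh2 (by simpa using hm0) (by simp; positivity)
    have f1 : Tendsto (fun h : WithLp 2 (WithLp 2 (En n × ℝ) × WithLp 2 (En n × ℝ)) =>
        zh1 + h.fst) (𝓝 0) (𝓝 zh1) := by
      have c0 : Continuous (fun h : WithLp 2 (WithLp 2 (En n × ℝ) × WithLp 2 (En n × ℝ)) =>
        zh1 + h.fst) := continuous_const.add
          (WithLp.fstL 2 ℝ (WithLp 2 (En n × ℝ)) (WithLp 2 (En n × ℝ))).continuous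
      have := c0.tendsto 0
      simpa using this
    have f2 : Tendsto (fun h : WithLp 2 (WithLp 2 (En n × ℝ) × WithLp 2 (En n × ℝ)) =>
        zh2 + h.snd) (𝓝 0) (𝓝 zh2) := by
      have c0 : Continuous (fun h : WithLp 2 (WithLp 2 (En n × ℝ) × WithLp 2 (En n × ℝ)) =>
        zh2 + h.snd) := continuous_const.add
          (WithLp.sndL 2 ℝ (WithLp 2 (En n × ℝ)) (WithLp 2 (En n × ℝ))).continuous
      have := c0.tendsto 0
      simpa using this
    filter_upwards [f1.eventually s1, f2.eventually s2] with h h1 h2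
    exact hmax' _ h1 _ h2
  · set zb : WithLp 2 (En n × ℝ) := WithLp.toLp 2 (zh2.fst, zh1.snd) with hzb
    have hzbS : zb ∈ S := ⟨e1, c2, c3⟩
    have hd : ‖zb - zh2‖ ≤ m := by
      have q1 := WithLp.prod_norm_sq_eq_of_L2 (zb - zh2)
      have q2 : (zb - zh2).fst = 0 := by simp [hzb]
      have q3 : (zb - zh2).snd = zh1.snd - zh2.snd := rfl
      rw [q2, q3, norm_zero, Real.norm_eq_abs, sq_abs] at q1
      refine (sq_le_sq₀ (norm_nonneg _) hm0.le).mp ?_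
      have q7 := sq_le_sq' r5'.1 r5'.2
      rw [q1]
      norm_num
      exact q7
    have q4 := abs_le.mp (huc' zb hzbS zh2 ⟨e1, e2, e3⟩ hd)
    have q5 : v zb = w (zh2.fst, zh1.snd) := rfl
    have q6 : v zh1 = w (zh1.fst, zh1.snd) := rfl
    rw [← q5, ← q6]
    linarith [b3.1, b4.1]

set_option maxHeartbeats 1000000 in
open Filter Topology in
theorem aux_step (n : ℕ) (γ p : ℝ) (hγ : γ ∈ Set.Ioo (-1 : ℝ) 0) (hp : 1 < p) :
    ∃ C : ℝ, 1 ≤ C ∧ ∀ (K : En n) (w f : En n × ℝ → ℝ), IsDevSol γ p K f w (pCyl n 1) →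
      (∀ z ∈ pCyl n 1, |w z| ≤ 1) → (∀ z ∈ pCyl n 1, |f z| ≤ 1) →
      ∀ (g g1 g2 G : ℝ → ℝ) (x0 y0 : En n) (t0 : ℝ), Continuous g →
      (∀ ρ, 0 ≤ ρ → ρ ≤ 4 → 0 ≤ g ρ) → (∀ ρ, (1 / 64) ^ 2 ≤ ρ → ρ ≤ 4 → 2 ≤ g ρ) →
      (∀ ρ, 0 < ρ → ∀ η > (0:ℝ), ∀ᶠ s in 𝓝 (0:ℝ),
        g (ρ + s) ≤ g ρ + g1 ρ * s + 1 / 2 * g2 ρ * s ^ 2 + η * s ^ 2) →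
      (x0, t0) ∈ pCyl n (15 / 16) → (y0, t0) ∈ pCyl n (15 / 16) →
      (∀ (x y : En n) (t : ℝ), ‖x - x0‖ ≤ 1 / 64 → ‖x - y‖ ≤ 1 / 64 → |t - t0| ≤ 1 / 64 → t < 0 →
        w (x, t) - w (y, t) ≤ G ‖x - y‖) →
      (∀ r, 0 < r → r < 1 / 64 → 0 < g1 (r ^ 2) ∧
        8 * C * (‖K‖ + 300) ≤ 2 * g1 (r ^ 2) * r ∧
        (0 ≤ G r → C * (260 * (2 * g1 (r ^ 2) * r) ^ (-γ)
          + C * (4 * 16384 * G r / (r * (2 * g1 (r ^ 2) * r))) + C * 16384)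
          < -(2 * g1 (r ^ 2) + 4 * g2 (r ^ 2) * r ^ 2))) →
      w (x0, t0) - w (y0, t0) ≤ g (‖x0 - y0‖ ^ 2) := by
  obtain ⟨C, hC1, hpt⟩ := aux_point n γ p hγ hp
  refine ⟨C, hC1, ?_⟩
  intro K w f hsol hw hf g g1 g2 G x0 y0 t0 hgc hg0 hg2 htay hx0 hy0 hG hP
  by_contra hgt
  push Not at hgt
  have hc : ContinuousOn w (pCyl n 1) := by
    have h1 : ContinuousOn (fun z : En n × ℝ => w z + ⟪K, z.1⟫) (pCyl n 1) := hsol.1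
    have h2 : ContinuousOn (fun z : En n × ℝ => ⟪K, z.1⟫) (pCyl n 1) := by fun_prop
    have e : (fun z : En n × ℝ => (w z + ⟪K, z.1⟫) - ⟪K, z.1⟫) = w := by
      funext z
      ring
    rw [← e]
    exact h1.sub h2
  obtain ⟨S, l, μ, N, d, U, V, zh1, zh2, hSQ, hl, hμ, hN, hd, hUc, hVc, hU1, hU2, hV1, hV2,
    hN1, hN2, hmax, r1, r2, r3, r4, r5⟩ := aux_loc w hc hw g hgc hg0 hg2 x0 y0 t0 hx0 hy0 hgt
  set z := zh1.fst - zh2.fst with hz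
  have hz0 : z ≠ 0 := by
    intro h0
    have : zh1.fst = zh2.fst := sub_eq_zero.mp h0
    rw [this, sub_self] at r5
    have : 0 ≤ 8192 * ‖zh2.fst - x0‖ ^ 2 := by positivity
    linarith
  set r := ‖z‖ with hr
  have hr0 : 0 < r := norm_pos_iff.mpr hz0
  obtain ⟨hg1, hP1, hP2⟩ := hP r hr0 r4
  have hGr := hG zh1.fst zh2.fst zh1.snd r1.le r4.le r2.le r3
  rw [← hz, ← hr] at hGr
  set D := ‖zh1.fst - x0‖ with hD
  have hD0 : 0 ≤ D := norm_nonneg _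
  have hG0 : 8192 * D ^ 2 ≤ G r := by linarith
  have hG00 : 0 ≤ G r := le_trans (by positivity) hG0
  replace hP2 := hP2 hG00
  set a := 2 * g1 (r ^ 2) with ha
  have ha0 : 0 < a := by positivity
  set P := a * r with hPdef
  have hP0 : 0 < P := by positivity
  set κ := -(a + 4 * g2 (r ^ 2) * r ^ 2) with hκ
  have hPγ : 0 < P ^ (-γ) := Real.rpow_pos_of_pos hP0 _
  have hκ0 : 0 < κ := by
    refine lt_of_le_of_lt ?_ hP2
    positivity
  obtain ⟨A, hA1, hA2, hA3⟩ := aux_expand g (g1 (r ^ 2)) (g2 (r ^ 2)) x0 t0 16384 μ N l hl hμ U V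
    zh1 zh2 (htay (r ^ 2) (by positivity)) hmax
  rw [← hz, ← ha] at hA2
  rw [← hz, ← ha] at hA3
  have nz : ‖a • z‖ = P := by
    rw [norm_smul, Real.norm_eq_abs, abs_of_pos ha0]
  have nM : ‖(16384:ℝ) • (zh1.fst - x0)‖ = 16384 * D := by
    rw [norm_smul, Real.norm_eq_abs, abs_of_pos (by norm_num)]
  have hPb : 8 * (‖K‖ + 300) ≤ P := by
    refine le_trans ?_ hP1
    have : 0 ≤ ‖K‖ := norm_nonneg _
    nlinarith
  have hPC : 8 * C * 300 ≤ P := by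
    refine le_trans ?_ hP1
    have : 0 ≤ ‖K‖ := norm_nonneg _
    have : 0 ≤ C * ‖K‖ := by positivity
    nlinarith
  have hK0 : 0 ≤ ‖K‖ := norm_nonneg _
  have hsum : (a • z + (16384:ℝ) • (zh1.fst - x0)) + -(a • z) = (16384:ℝ) • (zh1.fst - x0) := by
    abel
  have key := hpt K w f hsol hw hf S hSQ l hl U V hUc hVc hU1 hU2 hV1 hV2 zh1 zh2 _ _ d hd hN1 hN2
    A hA1 hA2 P a (4 * g2 (r ^ 2)) 16384 κ z hP0 ha0 hκ0 (by norm_num) hz0 rfl hA3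
    (by
      change P / 2 < ‖a • z + (16384:ℝ) • (zh1.fst - x0) + K‖
      have h1 := norm_sub_le (a • z + (16384:ℝ) • (zh1.fst - x0) + K)
        ((16384:ℝ) • (zh1.fst - x0) + K)
      have h2 := norm_add_le ((16384:ℝ) • (zh1.fst - x0)) K
      have e : a • z + (16384:ℝ) • (zh1.fst - x0) + K - ((16384:ℝ) • (zh1.fst - x0) + K)
        = a • z := by abel
      rw [e, nz] at h1
      linarith)
    (by
      change ‖a • z + (16384:ℝ) • (zh1.fst - x0) + K‖ < 2 * P
      have h1 := norm_add_le (a • z + (16384:ℝ) • (zh1.fst - x0)) K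
      have h2 := norm_add_le (a • z) ((16384:ℝ) • (zh1.fst - x0))
      linarith)
    (by
      change P / 2 < ‖-(a • z) - K‖
      have h1 := norm_add_le (-(a • z) - K) K
      rw [sub_add_cancel, norm_neg, nz] at h1
      linarith)
    (by
      change ‖-(a • z) - K‖ < 2 * P
      have h1 := norm_sub_le (-(a • z)) K
      rw [norm_neg, nz] at h1
      linarith)
    (by
      change C * ‖(a • z + (16384:ℝ) • (zh1.fst - x0)) + -(a • z)‖ < P
      rw [hsum, nM]
      nlinarith)
  change (16384 * (zh1.snd - t0) + μ * Real.exp (N * (zh1.snd - t0)) * N + (zh1.snd - zh2.snd) / l)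
    + -((zh1.snd - zh2.snd) / l) ≤ 2 + P ^ γ * (-κ / C + C * a *
      (‖(a • z + (16384:ℝ) • (zh1.fst - x0)) + -(a • z)‖ / P) ^ 2 + C * 16384) at key
  rw [hsum, nM] at key
  have hE : 0 ≤ μ * Real.exp (N * (zh1.snd - t0)) * N := by positivity
  have r2' := abs_lt.mp r2
  have k1 : -258 ≤ P ^ γ * (-κ / C + C * a * (16384 * D / P) ^ 2 + C * 16384) := by linarith
  have k2 : P ^ (-γ) * P ^ γ = 1 := by
    rw [← Real.rpow_add hP0]; simp
  have k3 : -258 * P ^ (-γ) ≤ -κ / C + C * a * (16384 * D / P) ^ 2 + C * 16384 := by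
    have := mul_le_mul_of_nonneg_left k1 hPγ.le
    rw [← mul_assoc, k2, one_mul] at this
    linarith
  have k4 : a * (16384 * D / P) ^ 2 ≤ 4 * 16384 * G r / (r * P) := by
    have e : a * (16384 * D / P) ^ 2 = 2 * 16384 * (8192 * D ^ 2) / (r * P) := by
      rw [hPdef]
      field_simp
      ring
    rw [e]
    gcongr
    linarith
  have k5 : C * (a * (16384 * D / P) ^ 2) ≤ C * (4 * 16384 * G r / (r * P)) := by gcongr
  have k6 : κ / C ≤ 258 * P ^ (-γ) + C * (4 * 16384 * G r / (r * P)) + C * 16384 := by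
    have : -κ / C = -(κ / C) := by ring
    rw [this] at k3
    linarith
  rw [div_le_iff₀ (by linarith)] at k6
  have k7 : 0 < P ^ (-γ) * C := by positivity
  linarith

theorem aux_pow4 (s : ℝ) (hs : 0 ≤ s) (e : ℝ) : (s ^ 4) ^ e = s ^ (4 * e) := by
  rw [← Real.rpow_natCast, ← Real.rpow_mul hs]
  norm_num

theorem aux_pow4_inv (s : ℝ) (hs : 0 < s) (e : ℝ) (k : ℕ) (h : 4 * e = -(k : ℝ)) :
    (s ^ 4) ^ e = 1 / s ^ k := by
  rw [aux_pow4 s hs.le, h, Real.rpow_neg hs.le, Real.rpow_natCast, one_div]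

theorem aux_pow4_nat (s : ℝ) (hs : 0 ≤ s) (e : ℝ) (k : ℕ) (h : 4 * e = (k : ℝ)) :
    (s ^ 4) ^ e = s ^ k := by
  rw [aux_pow4 s hs, h, Real.rpow_natCast]

/-- Sublinear growth of the power `-γ`. -/
theorem aux_sublin (γ : ℝ) (hγ : γ ∈ Set.Ioo (-1 : ℝ) 0) (c : ℝ) (hc : 0 < c) :
    ∃ B : ℝ, 1 ≤ B ∧ ∀ P, B ≤ P → c * P ^ (-γ) ≤ P := by
  obtain ⟨h1, h2⟩ := hγ
  have h3 : 0 < 1 + γ := by linarith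
  refine ⟨max 1 (c ^ (1 / (1 + γ))), le_max_left _ _, ?_⟩
  intro P hP
  have hP1 : 1 ≤ P := (le_max_left _ _).trans hP
  have hP2 : c ^ (1 / (1 + γ)) ≤ P := (le_max_right _ _).trans hP
  have hP0 : 0 < P := by linarith
  have h4 : c ≤ P ^ (1 + γ) := by
    have := Real.rpow_le_rpow (by positivity) hP2 h3.le
    rwa [← Real.rpow_mul hc.le, one_div_mul_cancel h3.ne', Real.rpow_one] at this
  calc c * P ^ (-γ) ≤ P ^ (1 + γ) * P ^ (-γ) := by gcongr
    _ = P := by rw [← Real.rpow_add hP0]; simp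

open Filter Topology in
theorem aux_tay_pow (L c : ℝ) (ρ : ℝ) (hρ : 0 < ρ) (e e' : ℝ) :
    ∀ η > (0:ℝ), ∀ᶠ s in 𝓝 (0:ℝ), L * ((ρ + s) ^ e - c * (ρ + s) ^ e') ≤
      L * (ρ ^ e - c * ρ ^ e') + L * (e * ρ ^ (e - 1) - c * (e' * ρ ^ (e' - 1))) * s
      + 1 / 2 * (L * (e * ((e - 1) * ρ ^ (e - 1 - 1)) - c * (e' * ((e' - 1) * ρ ^ (e' - 1 - 1)))))
        * s ^ 2 + η * s ^ 2 := by
  have hd : ∀ e y : ℝ, 0 < y → HasDerivAt (fun x : ℝ => x ^ e) (e * y ^ (e - 1)) y :=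
    fun e y hy => Real.hasDerivAt_rpow_const (Or.inl hy.ne')
  refine aux_taylor1 (fun x => L * (x ^ e - c * x ^ e'))
    (fun x => L * (e * x ^ (e - 1) - c * (e' * x ^ (e' - 1)))) _ ρ ?_ ?_
  · filter_upwards [lt_mem_nhds hρ] with y hy
    exact ((hd e y hy).sub ((hd e' y hy).const_mul c)).const_mul L
  · exact ((((hd (e - 1) ρ hρ).const_mul e)).sub
      (((hd (e' - 1) ρ hρ).const_mul e').const_mul c)).const_mul L

theorem aux_sqrt_rep (r : ℝ) (hr : 0 ≤ r) : ∃ s, 0 ≤ s ∧ r = s ^ 2 ∧ Real.sqrt r = s :=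
  ⟨Real.sqrt r, Real.sqrt_nonneg r, (Real.sq_sqrt hr).symm, rfl⟩

theorem aux_cont_g (L c e e' : ℝ) (he : 0 ≤ e) (he' : 0 ≤ e') :
    Continuous (fun x : ℝ => L * (x ^ e - c * x ^ e')) := by
  have h1 : Continuous (fun x : ℝ => x ^ e) := Real.continuous_rpow_const he
  have h2 : Continuous (fun x : ℝ => x ^ e') := Real.continuous_rpow_const he'
  fun_prop

theorem aux_rep4 (ρ : ℝ) (hρ : 0 ≤ ρ) : ∃ s, 0 ≤ s ∧ ρ = s ^ 4 := by
  refine ⟨ρ ^ (1 / 4 : ℝ), by positivity, ?_⟩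
  rw [← Real.rpow_natCast, ← Real.rpow_mul hρ]
  norm_num

set_option maxHeartbeats 1000000 in
theorem aux_main (n : ℕ) (γ p : ℝ) (hγ : γ ∈ Set.Ioo (-1 : ℝ) 0) (hp : 1 < p) :
    ∃ C : ℝ, 0 < C ∧ ∀ (K : En n) (w f : En n × ℝ → ℝ), 1 ≤ ‖K‖ →
      IsDevSol γ p K f w (pCyl n 1) →
      (∀ z ∈ pCyl n 1, |w z| ≤ 1) → (∀ z ∈ pCyl n 1, |f z| ≤ 1) →
      ∀ (x y : En n) (t : ℝ), (x, t) ∈ pCyl n (7/8) → (y, t) ∈ pCyl n (7/8) →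
          w (x, t) - w (y, t) ≤ C * ‖K‖ * ‖x - y‖ := by
  obtain ⟨C, hC1, hst⟩ := aux_step n γ p hγ hp
  obtain ⟨B, hB1, hB⟩ := aux_sublin γ hγ (4 * (260 * C)) (by positivity)
  set C' := 2 ^ 20 * C ^ 2 + B with hC'
  refine ⟨2 ^ 22 * C ^ 2 + 2 * B + C', by positivity, ?_⟩
  intro K w f hK hsol hw hf
  have hCC : C ≤ C ^ 2 := by nlinarith
  -- first step: a Hölder estimate
  have holder : ∀ (x y : En n) (t : ℝ), (x, t) ∈ pCyl n (15/16) → (y, t) ∈ pCyl n (15/16) →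
      w (x, t) - w (y, t) ≤ C' * ‖K‖ * Real.sqrt ‖x - y‖ := by
    intro x0 y0 t0 hx0 hy0
    set L := C' * ‖K‖ with hL
    have hLK : (2 ^ 20 * C ^ 2 + B) * ‖K‖ = L := rfl
    have hLK2 : 2 ^ 20 * C ^ 2 + B ≤ L := by
      rw [← hLK]
      exact le_mul_of_one_le_right (by positivity) hK
    have hL0 : 0 < L := by nlinarith
    have hLK3 : 2 ^ 20 * C * ‖K‖ ≤ L := by
      rw [← hLK]
      gcongr
      nlinarith
    have key := hst K w f hsol hw hf (fun x => L * (x ^ (1 / 4 : ℝ) - 0 * x ^ (1 : ℝ)))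
      (fun ρ => L * (1 / 4 * ρ ^ (1 / 4 - 1 : ℝ) - 0 * (1 * ρ ^ (1 - 1 : ℝ))))
      (fun ρ => L * (1 / 4 * ((1 / 4 - 1) * ρ ^ (1 / 4 - 1 - 1 : ℝ))
        - 0 * (1 * ((1 - 1) * ρ ^ (1 - 1 - 1 : ℝ)))))
      (fun _ => 2) x0 y0 t0 (aux_cont_g L 0 (1 / 4) 1 (by norm_num) (by norm_num)) ?_ ?_
      (fun ρ hρ => aux_tay_pow L 0 ρ hρ (1 / 4) 1) hx0 hy0 ?_ ?_
    · obtain ⟨s, hs, hrs, hsq⟩ := aux_sqrt_rep ‖x0 - y0‖ (norm_nonneg _)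
      rw [hsq]
      have e : (‖x0 - y0‖ ^ 2) ^ (1 / 4 : ℝ) = s := by
        rw [hrs, ← pow_mul]
        norm_num only
        rw [aux_pow4_nat s hs (1 / 4) 1 (by norm_num), pow_one]
      simp only [zero_mul, sub_zero] at key
      rw [e] at key
      exact key
    · intro ρ h1 h2
      simp only [zero_mul, sub_zero]
      positivity
    · intro ρ h1 h2
      simp only [zero_mul, sub_zero]
      have h3 : ((1 / 64 : ℝ) ^ 2) ^ (1 / 4 : ℝ) ≤ ρ ^ (1 / 4 : ℝ) :=
        Real.rpow_le_rpow (by positivity) h1 (by norm_num)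
      have h4 : ((1 / 64 : ℝ) ^ 2) ^ (1 / 4 : ℝ) = 1 / 8 := by
        have := aux_pow4_nat (1 / 8) (by norm_num) (1 / 4) 1 (by norm_num)
        rw [pow_one] at this
        rw [← this]
        norm_num
      rw [h4] at h3
      nlinarith
    · intro x y t h1 h2 h3 h4
      have hx1 : (x, t) ∈ pCyl n 1 ∧ (y, t) ∈ pCyl n 1 := by
        obtain ⟨a1, a2, a3⟩ := hx0
        simp only at a1 a2 a3
        norm_num at a2
        have b1 := norm_add_le (x - x0) x0
        rw [sub_add_cancel] at b1
        have b2 := norm_sub_le x (x - y)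
        rw [sub_sub_cancel] at b2
        have b3 := abs_le.mp h3
        refine ⟨⟨?_, ?_, h4⟩, ⟨?_, ?_, h4⟩⟩
        · change ‖x‖ < 1; linarith
        · change -1 ^ 2 < t; linarith
        · change ‖y‖ < 1; linarith
        · change -1 ^ 2 < t; linarith
      have c1 := abs_le.mp (hw _ hx1.1)
      have c2 := abs_le.mp (hw _ hx1.2)
      linarith
    · intro r hr0 hr1
      obtain ⟨s, hs, hrs, -⟩ := aux_sqrt_rep r hr0.le
      have hs0 : 0 < s := by
        rcases hs.eq_or_lt with h | h
        · rw [← h] at hrs; norm_num at hrs; linarith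
        · exact h
      have hs1 : s < 1 / 8 := by nlinarith
      have e4 : r ^ 2 = s ^ 4 := by rw [hrs]; ring
      have p1 : (s ^ 4) ^ (1 / 4 - 1 : ℝ) = 1 / s ^ 3 := aux_pow4_inv s hs0 _ 3 (by norm_num)
      have p2 : (s ^ 4) ^ (1 / 4 - 1 - 1 : ℝ) = 1 / s ^ 7 := aux_pow4_inv s hs0 _ 7 (by norm_num)
      simp only [zero_mul, sub_zero]
      rw [e4, p1, p2, hrs]
      have eP : 2 * (L * (1 / 4 * (1 / s ^ 3))) * s ^ 2 = L / (2 * s) := by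
        field_simp; norm_num
      have eκ : -(2 * (L * (1 / 4 * (1 / s ^ 3))) + 4 * (L * (1 / 4 * ((1 / 4 - 1) * (1 / s ^ 7))))
        * s ^ 4) = L / (4 * s ^ 3) := by
        field_simp; norm_num
      rw [eP, eκ]
      have hPL : 4 * L ≤ L / (2 * s) := by
        rw [le_div_iff₀ (by positivity)]
        nlinarith
      refine ⟨by positivity, ?_, fun _ => ?_⟩
      · have : 8 * C * (‖K‖ + 300) ≤ 2 ^ 20 * C * ‖K‖ := by nlinarith
        linarith
      · have q1 := hB (L / (2 * s)) (by nlinarith)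
        have q2 : L / (2 * s) ≤ L / (2 * s ^ 3) := by
          gcongr
          have : s ^ 3 ≤ s ^ 1 := pow_le_pow_of_le_one hs (by linarith) (by norm_num)
          linarith
        have e1 : (4 * 16384 * 2 / (s ^ 2 * (L / (2 * s)))) = 262144 / (L * s) := by
          field_simp; norm_num
        have q3 : C * (C * (262144 / (L * s))) ≤ L / (32 * s ^ 3) := by
          rw [show C * (C * (262144 / (L * s))) = C ^ 2 * 262144 / (L * s) by ring,
            div_le_div_iff₀ (by positivity) (by positivity)]
          have w1 : C ^ 2 * 262144 ≤ L / 4 := by linarith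
          have w2 : 1 ≤ L := by nlinarith
          have w3 : s ^ 2 ≤ 1 / 64 := by nlinarith
          calc C ^ 2 * 262144 * (32 * s ^ 3) ≤ L / 4 * (32 * s ^ 3) := by gcongr
            _ = 8 * L * s * s ^ 2 := by ring
            _ ≤ 8 * L * s * (1 / 64) := by gcongr
            _ ≤ L * s * 1 := by nlinarith [mul_pos hL0 hs0]
            _ ≤ L * s * L := by gcongr
            _ = L * (L * s) := by ring
        have q4 : C * (C * 16384) ≤ L / (32 * s ^ 3) := by
          rw [le_div_iff₀ (by positivity)]
          have w3 : s ^ 3 ≤ 1 := pow_le_one₀ hs (by linarith)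
          calc C * (C * 16384) * (32 * s ^ 3) ≤ C * (C * 16384) * (32 * 1) := by gcongr
            _ ≤ L := by nlinarith
        rw [e1]
        have q5 : L / (2 * s ^ 3) = 16 * (L / (32 * s ^ 3)) := by field_simp; norm_num
        have q6 : L / (4 * s ^ 3) = 8 * (L / (32 * s ^ 3)) := by field_simp; norm_num
        have q7 : 0 < L / (32 * s ^ 3) := by positivity
        rw [q6, mul_add, mul_add]
        have q8 : C * (260 * (L / (2 * s)) ^ (-γ)) = 4 * (260 * C) * (L / (2 * s)) ^ (-γ) / 4 := by
          ring
        rw [q8]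
        linarith
  -- second step: the Lipschitz estimate
  intro x0 y0 t0 hx0 hy0
  set H := C' * ‖K‖ with hH
  set L := (2 ^ 22 * C ^ 2 + 2 * B + C') * ‖K‖ with hL
  have hH0 : 0 ≤ H := by positivity
  have hHL : H ≤ L := by
    rw [hL, hH]
    gcongr
    have : 0 ≤ 2 ^ 22 * C ^ 2 + 2 * B := by positivity
    linarith
  have hC'0 : 0 ≤ C' := by positivity
  have hLK2 : 2 ^ 22 * C ^ 2 + 2 * B ≤ L := by
    have : 2 ^ 22 * C ^ 2 + 2 * B + C' ≤ L := le_mul_of_one_le_right (by positivity) hK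
    linarith
  have hL0 : 0 < L := by nlinarith
  have hLK3 : 2 ^ 22 * C * ‖K‖ ≤ L := by
    rw [hL]
    gcongr
    nlinarith
  have sub : ∀ z : En n × ℝ, z ∈ pCyl n (7 / 8) → z ∈ pCyl n (15 / 16) := by
    rintro z ⟨h1, h2, h3⟩
    refine ⟨by linarith, ?_, h3⟩
    norm_num at h2 ⊢
    linarith
  have key := hst K w f hsol hw hf (fun x => L * (x ^ (1 / 2 : ℝ) - 1 / 3 * x ^ (3 / 4 : ℝ)))
    (fun ρ => L * (1 / 2 * ρ ^ (1 / 2 - 1 : ℝ) - 1 / 3 * (3 / 4 * ρ ^ (3 / 4 - 1 : ℝ))))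
    (fun ρ => L * (1 / 2 * ((1 / 2 - 1) * ρ ^ (1 / 2 - 1 - 1 : ℝ))
      - 1 / 3 * (3 / 4 * ((3 / 4 - 1) * ρ ^ (3 / 4 - 1 - 1 : ℝ)))))
    (fun r => H * Real.sqrt r) x0 y0 t0
    (aux_cont_g L (1 / 3) (1 / 2) (3 / 4) (by norm_num) (by norm_num)) ?_ ?_
    (fun ρ hρ => aux_tay_pow L (1 / 3) ρ hρ (1 / 2) (3 / 4)) (sub _ hx0) (sub _ hy0) ?_ ?_
  · refine key.trans ?_
    have e : (‖x0 - y0‖ ^ 2) ^ (1 / 2 : ℝ) = ‖x0 - y0‖ := by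
      rw [← Real.sqrt_eq_rpow, Real.sqrt_sq (norm_nonneg _)]
    rw [e]
    have : 0 ≤ (‖x0 - y0‖ ^ 2) ^ (3 / 4 : ℝ) := by positivity
    gcongr
    linarith
  · intro ρ h1 h2
    obtain ⟨s, hs, rfl⟩ := aux_rep4 ρ h1
    rw [aux_pow4_nat s hs (1 / 2) 2 (by norm_num), aux_pow4_nat s hs (3 / 4) 3 (by norm_num)]
    have hs2 : s ≤ 2 := by
      by_contra hcon
      push Not at hcon
      have : (2:ℝ) ^ 4 < s ^ 4 := by gcongr
      linarith
    have : s ^ 2 - 1 / 3 * s ^ 3 = s ^ 2 * (1 - s / 3) := by ring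
    rw [this]
    have : 0 ≤ 1 - s / 3 := by linarith
    positivity
  · intro ρ h1 h2
    obtain ⟨s, hs, rfl⟩ := aux_rep4 ρ (le_trans (by positivity) h1)
    rw [aux_pow4_nat s hs (1 / 2) 2 (by norm_num), aux_pow4_nat s hs (3 / 4) 3 (by norm_num)]
    have hs2 : s ≤ 3 / 2 := by
      by_contra hcon
      push Not at hcon
      have : (3 / 2:ℝ) ^ 4 < s ^ 4 := by gcongr
      norm_num at this
      linarith
    have hs3 : 1 / 8 ≤ s := by
      by_contra hcon
      push Not at hcon
      have : s ^ 4 < (1 / 8 : ℝ) ^ 4 := by gcongr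
      norm_num at this h1
      linarith
    have : s ^ 2 - 1 / 3 * s ^ 3 = s ^ 2 * (1 - s / 3) := by ring
    rw [this]
    have h5 : 1 / 2 ≤ 1 - s / 3 := by linarith
    have h6 : 256 ≤ L := by nlinarith
    calc (2:ℝ) = 256 * ((1 / 8) ^ 2 * (1 / 2)) := by norm_num
      _ ≤ _ := by gcongr
  · intro x y t h1 h2 h3 h4
    obtain ⟨a1, a2, a3⟩ := hx0
    simp only at a1 a2 a3
    norm_num at a2
    have b1 := norm_add_le (x - x0) x0
    rw [sub_add_cancel] at b1
    have b2 := norm_sub_le x (x - y)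
    rw [sub_sub_cancel] at b2
    have b3 := abs_le.mp h3
    refine holder x y t ⟨?_, ?_, h4⟩ ⟨?_, ?_, h4⟩
    · change ‖x‖ < _; linarith
    · change -(15 / 16) ^ 2 < t; norm_num; linarith
    · change ‖y‖ < _; linarith
    · change -(15 / 16) ^ 2 < t; norm_num; linarith
  · intro r hr0 hr1
    obtain ⟨s, hs, hrs, hsq⟩ := aux_sqrt_rep r hr0.le
    have hs0 : 0 < s := by
      rcases hs.eq_or_lt with h | h
      · rw [← h] at hrs; norm_num at hrs; linarith
      · exact h
    have hs1 : s < 1 / 8 := by nlinarith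
    have e4 : r ^ 2 = s ^ 4 := by rw [hrs]; ring
    have p1 : (s ^ 4) ^ (1 / 2 - 1 : ℝ) = 1 / s ^ 2 := aux_pow4_inv s hs0 _ 2 (by norm_num)
    have p2 : (s ^ 4) ^ (1 / 2 - 1 - 1 : ℝ) = 1 / s ^ 6 := aux_pow4_inv s hs0 _ 6 (by norm_num)
    have p3 : (s ^ 4) ^ (3 / 4 - 1 : ℝ) = 1 / s ^ 1 := aux_pow4_inv s hs0 _ 1 (by norm_num)
    have p4 : (s ^ 4) ^ (3 / 4 - 1 - 1 : ℝ) = 1 / s ^ 5 := aux_pow4_inv s hs0 _ 5 (by norm_num)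
    rw [hsq, e4, p1, p2, p3, p4, hrs]
    have eP : 2 * (L * (1 / 2 * (1 / s ^ 2) - 1 / 3 * (3 / 4 * (1 / s ^ 1)))) * s ^ 2
        = L * (1 - s / 2) := by
      field_simp; ring
    have eκ : -(2 * (L * (1 / 2 * (1 / s ^ 2) - 1 / 3 * (3 / 4 * (1 / s ^ 1))))
        + 4 * (L * (1 / 2 * ((1 / 2 - 1) * (1 / s ^ 6))
          - 1 / 3 * (3 / 4 * ((3 / 4 - 1) * (1 / s ^ 5))))) * s ^ 4) = L / (4 * s) := by
      field_simp; ring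
    have eg : L * (1 / 2 * (1 / s ^ 2) - 1 / 3 * (3 / 4 * (1 / s ^ 1)))
        = L * (1 - s / 2) / (2 * s ^ 2) := by
      field_simp; ring
    rw [eP, eκ, eg]
    set P := L * (1 - s / 2) with hP
    have hP1 : L / 2 ≤ P := by nlinarith
    have hP2 : P ≤ L := by nlinarith
    have hP0 : 0 < P := by linarith
    refine ⟨by positivity, ?_, fun _ => ?_⟩
    · have : 8 * C * (‖K‖ + 300) ≤ 2 ^ 20 * C * ‖K‖ := by nlinarith
      linarith
    · have q1 := hB P (by nlinarith)
      have q0 : 8 * L ≤ L / s := by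
        rw [le_div_iff₀ hs0]
        nlinarith
      have q3 : C * (C * (4 * 16384 * (H * s) / (s ^ 2 * P))) ≤ L / s / 16 := by
        have e1 : C * (C * (4 * 16384 * (H * s) / (s ^ 2 * P))) = C ^ 2 * 65536 * (H / P) / s := by
          field_simp
          ring
        have e2 : L / s / 16 = L / 16 / s := by ring
        have e3 : H / P ≤ 2 := by
          rw [div_le_iff₀ hP0]
          linarith
        rw [e1, e2]
        gcongr
        nlinarith
      have q4 : C * (C * 16384) ≤ L / 16 := by nlinarith
      have q5 : L / (4 * s) = L / s / 4 := by field_simp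
      rw [q5]
      rw [mul_add, mul_add]
      have q6 : C * (260 * P ^ (-γ)) = 4 * (260 * C) * P ^ (-γ) / 4 := by ring
      rw [q6]
      linarith

/-- **Estimate (2.3).** For `-1 < γ < 0`, `1 < p < ∞`, `K ∈ ℝⁿ` with `|K| ≥ 1` and `w` a
bounded viscosity solution of the deviation equation
`∂ₜ w - |Dw+K|^γ [Δw + (p-2)⟨D²w (Dw+K), Dw+K⟩/|Dw+K|²] = f̃` in `Q₁` with `w(0,0) = 0`,
`‖w‖_∞ ≤ 1`, `‖f̃‖_∞ ≤ 1`, there is `C̄ = C̄(p,n,γ) > 0` such that for all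
`(x,t), (y,t) ∈ Q_{7/8}`, `|w(x,t) - w(y,t)| ≤ C̄ |K|^{1/(1+γ)} |x - y|`. -/
theorem deviation_lipschitz_estimate
    (n : ℕ) (hn : 1 ≤ n) (γ p : ℝ) (hγ : γ ∈ Set.Ioo (-1 : ℝ) 0) (hp : 1 < p) :
    ∃ C : ℝ, 0 < C ∧
      ∀ (K : En n) (w f : En n × ℝ → ℝ),
        1 ≤ ‖K‖ →
        IsDevSol γ p K f w (pCyl n 1) →
        w (0, 0) = 0 →
        (∀ z ∈ pCyl n 1, |w z| ≤ 1) →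
        (∀ z ∈ pCyl n 1, |f z| ≤ 1) →
        ∀ (x y : En n) (t : ℝ), (x, t) ∈ pCyl n (7/8) → (y, t) ∈ pCyl n (7/8) →
          |w (x, t) - w (y, t)| ≤ C * ‖K‖ ^ (1 / (1 + γ)) * ‖x - y‖ := by
  obtain ⟨C, hC, h⟩ := aux_main n γ p hγ hp
  refine ⟨C, hC, ?_⟩
  intro K w f hK hsol _ hw hf x y t hx hy
  have h1 := h K w f hK hsol hw hf x y t hx hy
  have h2 := h K w f hK hsol hw hf y x t hy hx
  rw [norm_sub_rev] at h2
  have h3 : ‖K‖ ≤ ‖K‖ ^ (1 / (1 + γ)) := by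
    have h4 : (1:ℝ) ≤ 1 / (1 + γ) := by
      rw [le_div_iff₀ (by linarith [hγ.1])]
      linarith [hγ.2]
    calc ‖K‖ = ‖K‖ ^ (1:ℝ) := (Real.rpow_one _).symm
      _ ≤ _ := Real.rpow_le_rpow_of_exponent_le hK h4
  have h5 : C * ‖K‖ * ‖x - y‖ ≤ C * ‖K‖ ^ (1 / (1 + γ)) * ‖x - y‖ := by gcongr
  rw [abs_le]
  constructor <;> linarith
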